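/- arXiv:2504.16205 — 2 statements merged into one kernel-verified Lean document; each statement's English description precedes it below -/
import Mathlib

section
/- Let G = R(m;a,b,c) be a connected generalized rose window graph (m ≥ 3, a, b, c ∈ ZMod m nonzero, 2a ≠ 0, 2b ≠ 0, gcd(m,a,b,c) = 1) with a ≠ b and a ≠ −b. Let H be the spanning subgraph of G obtained by deleting all spokes of type c (the edges u_i v_{i+c}, i ∈ ZMod m), and let H_0 denote the induced subgraph of H on the connected component of H containing the vertex u_0. Suppose gcd(m,a,b) > 1 (gcd of m with the canonical integer representatives of a and b). If there exists x ∈ ZMod m with u_x a vertex of H_0 such that H_0 has a Hamilton cycle containing the four edges u_x u_{x+a}, u_{x+b} u_{x+a+b}, v_x v_{x+b} and v_{x+a} v_{x+a+b} (a 4-hooked Hamilton cycle), then G is Hamiltonian. -/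
open SimpleGraph

/-- The bicirculant graph `B(m;R,S,T)` on vertex set `ZMod m ⊕ ZMod m`. -/
def bicirculant (m : ℕ) (R S T : Set (ZMod m)) : SimpleGraph (ZMod m ⊕ ZMod m) :=
  SimpleGraph.fromRel (fun x y =>
    match x, y with
    | Sum.inl i, Sum.inl i' => ∃ j ∈ R, i' = i + j
    | Sum.inr i, Sum.inr i' => ∃ j ∈ T, i' = i + j
    | Sum.inl i, Sum.inr i' => ∃ j ∈ S, i' = i + j
    | Sum.inr _, Sum.inl _ => False)

/-- The generalized rose window graph `R(m;a,b,c) = B(m;{a,-a},{0,c},{b,-b})`. -/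
def roseWindow (m : ℕ) (a b c : ZMod m) : SimpleGraph (ZMod m ⊕ ZMod m) :=
  bicirculant m {a, -a} {0, c} {b, -b}

/-- `H`: the spanning subgraph of `R(m;a,b,c)` obtained by deleting the spokes of
type `c`, i.e. all edges `u_i v_{i+c}`. -/
def rwH (m : ℕ) (a b c : ZMod m) : SimpleGraph (ZMod m ⊕ ZMod m) :=
  (roseWindow m a b c).deleteEdges
    {e | ∃ i : ZMod m, e = s(Sum.inl i, Sum.inr (i + c))}

/-- The vertex set of the connected component of `H` containing `u_0`. -/
def rwK (m : ℕ) (a b c : ZMod m) : Set (ZMod m ⊕ ZMod m) :=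
  ((rwH m a b c).connectedComponentMk (Sum.inl 0)).supp

/-- `H_0`: the induced subgraph of `H` on the connected component of `u_0`. -/
def rwH0 (m : ℕ) (a b c : ZMod m) : SimpleGraph (rwK m a b c) :=
  (rwH m a b c).induce (rwK m a b c)

namespace RoseWindow

variable {V : Type*}

/-- `Seg R x y s`: some `R`-path from `x` to `y` has vertex multiset `s`. -/
def Seg (R : V → V → Prop) (x y : V) (s : Multiset V) : Prop :=
  ∃ l : List V, l.IsChain R ∧ l.head? = some x ∧ l.getLast? = some y ∧ (l : Multiset V) = s

/-- A multiset containing every element exactly once. -/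
def Full (s : Multiset V) : Prop := s.Nodup ∧ ∀ w, w ∈ s

/-- There is a Hamilton path of `R` from `x` to `y`. -/
def HamPath (R : V → V → Prop) (x y : V) : Prop := ∃ s, Full s ∧ Seg R x y s

variable {R : V → V → Prop}

theorem Seg.single (x : V) : Seg R x x {x} :=
  ⟨[x], by simp, rfl, rfl, rfl⟩

theorem Seg.join {x y z w : V} {s t : Multiset V} (h : Seg R x y s) (hr : R y z)
    (h' : Seg R z w t) : Seg R x w (s + t) := by
  obtain ⟨l, hl, hx, hy, rfl⟩ := h
  obtain ⟨l', hl', hz, hw, rfl⟩ := h'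
  refine ⟨l ++ l', ?_, ?_, ?_, by simp⟩
  · rw [List.isChain_append]
    refine ⟨hl, hl', fun p hp q hq => ?_⟩
    rw [hy] at hp; rw [hz] at hq
    simp only [Option.mem_def, Option.some.injEq] at hp hq
    rwa [← hp, ← hq]
  · simp [List.head?_append, hx]
  · simp [List.getLast?_append, hw]

theorem Seg.reverse {x y : V} {s : Multiset V} (hR : ∀ {x y}, R x y → R y x)
    (h : Seg R x y s) : Seg R y x s := by
  obtain ⟨l, hl, hx, hy, rfl⟩ := h
  refine ⟨l.reverse, ?_, by simp [hy], by simp [hx], by simp⟩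
  rw [List.isChain_reverse]
  exact hl.imp fun _ _ h => hR h

theorem HamPath.reverse {x y : V} (hR : ∀ {x y}, R x y → R y x) (h : HamPath R x y) :
    HamPath R y x := by
  obtain ⟨s, hs, h⟩ := h
  exact ⟨s, hs, h.reverse hR⟩

/-- A Hamilton cycle of `R` of length `N`, as an `N`-periodic sequence. -/
structure Cyc (R : V → V → Prop) (N : ℤ) (f : ℤ → V) : Prop where
  symm : ∀ {x y}, R x y → R y x
  three_le : 3 ≤ N
  eq_iff : ∀ i j, f i = f j ↔ N ∣ i - j
  surj : ∀ w, ∃ i, f i = w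
  step : ∀ i, R (f i) (f (i + 1))

/-- The sequence `f` runs from `x` to `y` in one step. -/
def Arc (f : ℤ → V) (x y : V) : Prop := ∃ k, f k = x ∧ f (k + 1) = y

namespace Cyc

variable {N : ℤ} {f : ℤ → V}

theorem add_period (C : Cyc R N f) (i : ℤ) : f (i + N) = f i :=
  (C.eq_iff _ _).2 (by simp)

theorem per (C : Cyc R N f) {i : ℤ} {x : V} (h : f i = x) : f (i + N) = x := by
  rw [C.add_period, h]

theorem per' (C : Cyc R N f) {i : ℤ} {x : V} (h : f (i + 1) = x) : f (i + N + 1) = x := by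
  rw [add_right_comm, C.add_period, h]

theorem eq_of_lt (C : Cyc R N f) {i j : ℤ} (h : f i = f j) (h1 : i < j + N) (h2 : j < i + N) :
    i = j := by
  have := Int.eq_zero_of_abs_lt_dvd ((C.eq_iff _ _).1 h) (by rw [abs_lt]; constructor <;> omega)
  omega

theorem exists_between (C : Cyc R N f) (k : ℤ) (w : V) : ∃ i, k ≤ i ∧ i < k + N ∧ f i = w := by
  obtain ⟨i, hi⟩ := C.surj w
  have hN : 0 < N := by have := C.three_le; omega
  have h1 := Int.emod_nonneg (i - k) hN.ne'
  have h2 := Int.emod_lt_of_pos (i - k) hN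
  refine ⟨k + (i - k) % N, by omega, by omega, ?_⟩
  rw [← hi, C.eq_iff]
  have := Int.emod_add_mul_ediv (i - k) N
  exact ⟨-((i - k) / N), by linarith⟩

theorem exists_arc (C : Cyc R N f) {i : ℤ} {w x y : V} (hi : f i = w) (h : Arc f x y)
    (hx : x ≠ w) : ∃ k, i < k ∧ k < i + N ∧ f k = x ∧ f (k + 1) = y := by
  obtain ⟨k, hk, hk'⟩ := h
  obtain ⟨l, h1, h2, h3⟩ := C.exists_between i x
  refine ⟨l, lt_of_le_of_ne h1 ?_, h2, h3, ?_⟩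
  · rintro rfl
    exact hx (h3.symm.trans hi)
  · rw [← hk', C.eq_iff, add_sub_add_right_eq_sub, ← C.eq_iff, h3, hk]

theorem arc_right_unique (C : Cyc R N f) {w x y : V} (h : Arc f w x) (h' : Arc f w y) : x = y := by
  obtain ⟨k, hk, rfl⟩ := h
  obtain ⟨l, hl, rfl⟩ := h'
  rw [C.eq_iff, add_sub_add_right_eq_sub, ← C.eq_iff, hk, hl]

theorem arc_left_unique (C : Cyc R N f) {w x y : V} (h : Arc f x w) (h' : Arc f y w) : x = y := by
  obtain ⟨k, rfl, hk⟩ := h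
  obtain ⟨l, rfl, hl⟩ := h'
  rw [C.eq_iff, ← add_sub_add_right_eq_sub k l 1, ← C.eq_iff, hk, hl]

theorem ne_add_two (C : Cyc R N f) (i : ℤ) : f i ≠ f (i + 1 + 1) := by
  intro h
  have := C.three_le
  have := C.eq_of_lt h (by omega) (by omega)
  omega

theorem arc_asymm (C : Cyc R N f) {x y : V} (h : Arc f x y) (h' : Arc f y x) : False := by
  obtain ⟨k, rfl, rfl⟩ := h
  have := C.arc_right_unique h' ⟨k + 1, rfl, rfl⟩
  exact C.ne_add_two k this

theorem rev (C : Cyc R N f) : Cyc R N (fun i => f (-i)) where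
  symm := C.symm
  three_le := C.three_le
  eq_iff i j := by rw [C.eq_iff, ← dvd_neg]; ring_nf
  surj w := by
    obtain ⟨i, hi⟩ := C.surj w
    exact ⟨-i, by simpa using hi⟩
  step i := by
    have := C.step (-(i + 1))
    rw [show -(i + 1) + 1 = -i by ring] at this
    exact C.symm this

theorem arc_rev {x y : V} : Arc (fun i => f (-i)) x y ↔ Arc f y x := by
  constructor
  · rintro ⟨k, h1, h2⟩
    exact ⟨-(k + 1), h2, by rw [show -(k + 1) + 1 = -k by ring]; exact h1⟩
  · rintro ⟨k, h1, h2⟩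
    exact ⟨-(k + 1), by simpa using h2, by
      simpa using h1⟩

/-- Vertices at positions `i ≤ k < j`. -/
noncomputable def span (f : ℤ → V) (i j : ℤ) : Multiset V := (Finset.Ico i j).val.map f

theorem span_single (f : ℤ → V) (i : ℤ) : span f i (i + 1) = {f i} := by
  have : Finset.Ico i (i + 1) = {i} := by ext j; simp; omega
  simp [span, this]

theorem span_add (f : ℤ → V) {i j k : ℤ} (h : i ≤ j) (h' : j ≤ k) :
    span f i j + span f j k = span f i k := by
  unfold span
  rw [← Multiset.map_add, ← Finset.Ico_union_Ico_eq_Ico h h',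
    ← Finset.disjUnion_eq_union _ _ (Finset.Ico_disjoint_Ico_consecutive i j k)]
  rfl

theorem seg (C : Cyc R N f) {i j : ℤ} (h : i ≤ j) : Seg R (f i) (f j) (span f i (j + 1)) := by
  obtain ⟨n, rfl⟩ := Int.le.dest h
  clear h
  induction n with
  | zero =>
    simpa [span_single] using Seg.single (R := R) (f i)
  | succ n ih =>
    have hr := C.step (i + n)
    have h1 := ih.join hr (Seg.single (f (i + n + 1)))
    rw [← span_single, span_add f (by omega) (by omega)] at h1
    push_cast
    rw [← add_assoc]
    exact h1

theorem seg' (C : Cyc R N f) {i j : ℤ} (h : i < j) : Seg R (f (i + 1)) (f j)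
    (span f (i + 1) (j + 1)) := C.seg (by omega)

theorem segRev (C : Cyc R N f) {i j : ℤ} (h : i < j) : Seg R (f j) (f (i + 1))
    (span f (i + 1) (j + 1)) := (C.seg' h).reverse C.symm

theorem full (C : Cyc R N f) (i : ℤ) : Full (span f i (i + N)) := by
  refine ⟨?_, fun w => ?_⟩
  · unfold span
    rw [Multiset.nodup_map_iff_of_inj_on]
    · exact (Finset.Ico i (i + N)).nodup
    · intro p hp q hq h
      simp only [Finset.mem_val, Finset.mem_Ico] at hp hq
      exact C.eq_of_lt h (by omega) (by omega)
  · obtain ⟨j, h1, h2, h3⟩ := C.exists_between i w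
    exact Multiset.mem_map.2 ⟨j, by simp; omega, h3⟩

/-- Reconnecting a cycle cut at two places. -/
theorem exchTwo' (C : Cyc R N f) {i j : ℤ} (hij : i < j) (hj : j < i + N) {x x' y y' : V}
    (hx : f i = x) (hx' : f (i + 1) = x') (hy : f j = y) (hy' : f (j + 1) = y')
    (h : R x y) : HamPath R x' y' := by
  subst hx hx' hy hy'
  refine ⟨_, C.full (i + 1), ?_⟩
  have h1 := (C.seg' hij).join (z := f (i + N)) (by rw [C.add_period]; exact C.symm h)
    (C.segRev hj)
  rwa [span_add f (by omega) (by omega), show i + N + 1 = i + 1 + N by ring] at h1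

section exchThree

variable {i j k : ℤ} {x x' y y' z z' : V}

theorem span_three (f : ℤ → V) (hij : i < j) (hjk : j < k) (hk : k < i + N) :
    span f (i + 1) (i + 1 + N) = span f (i + 1) (j + 1) + span f (j + 1) (k + 1) +
      span f (k + 1) (i + N + 1) := by
  rw [span_add f (by omega) (by omega), span_add f (by omega) (by omega),
    show i + 1 + N = i + N + 1 by ring]

/-- Reconnecting a cycle cut at three places, segments in the order `R⁻¹ Q P`. -/
theorem exchA (C : Cyc R N f) (hij : i < j) (hjk : j < k) (hk : k < i + N)
    (hx : f i = x) (hx' : f (i + 1) = x') (hy : f j = y) (hy' : f (j + 1) = y')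
    (hz : f k = z) (hz' : f (k + 1) = z') (h1 : R z' y') (h2 : R z x') : HamPath R x y := by
  subst hx hx' hy hy' hz hz'
  refine ⟨_, C.full (i + 1), ?_⟩
  have h := ((C.segRev hk).join h1 (C.seg' hjk)).join h2 (C.seg' hij)
  rw [C.add_period] at h
  rw [span_three f hij hjk hk]
  convert h using 1
  abel

/-- Reconnecting a cycle cut at three places, segments in the order `R⁻¹ P⁻¹ Q⁻¹`. -/
theorem exchB (C : Cyc R N f) (hij : i < j) (hjk : j < k) (hk : k < i + N)
    (hx : f i = x) (hx' : f (i + 1) = x') (hy : f j = y) (hy' : f (j + 1) = y')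
    (hz : f k = z) (hz' : f (k + 1) = z') (h1 : R z' y) (h2 : R x' z) : HamPath R x y' := by
  subst hx hx' hy hy' hz hz'
  refine ⟨_, C.full (i + 1), ?_⟩
  have h := ((C.segRev hk).join h1 (C.segRev hij)).join h2 (C.segRev hjk)
  rw [C.add_period] at h
  rw [span_three f hij hjk hk]
  convert h using 1
  abel

/-- Reconnecting a cycle cut at three places, segments in the order `R⁻¹ P Q⁻¹`. -/
theorem exchC (C : Cyc R N f) (hij : i < j) (hjk : j < k) (hk : k < i + N)
    (hx : f i = x) (hx' : f (i + 1) = x') (hy : f j = y) (hy' : f (j + 1) = y')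
    (hz : f k = z) (hz' : f (k + 1) = z') (h1 : R z' x') (h2 : R y z) : HamPath R x y' := by
  subst hx hx' hy hy' hz hz'
  refine ⟨_, C.full (i + 1), ?_⟩
  have h := ((C.segRev hk).join h1 (C.seg' hij)).join h2 (C.segRev hjk)
  rw [C.add_period] at h
  rw [span_three f hij hjk hk]
  convert h using 1
  abel

/-- Reconnecting a cycle cut at three places, segments in the order `R⁻¹ P⁻¹ Q`. -/
theorem exchD (C : Cyc R N f) (hij : i < j) (hjk : j < k) (hk : k < i + N)
    (hx : f i = x) (hx' : f (i + 1) = x') (hy : f j = y) (hy' : f (j + 1) = y')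
    (hz : f k = z) (hz' : f (k + 1) = z') (h1 : R z' y) (h2 : R x' y') : HamPath R x z := by
  subst hx hx' hy hy' hz hz'
  refine ⟨_, C.full (i + 1), ?_⟩
  have h := ((C.segRev hk).join h1 (C.segRev hij)).join h2 (C.seg' hjk)
  rw [C.add_period] at h
  rw [span_three f hij hjk hk]
  convert h using 1
  abel

end exchThree

end Cyc

end RoseWindow

namespace RoseWindow

variable {M V : Type*} {R : V → V → Prop}

/-- A path from `y` to `y'` through the edge `p p'`, cut at that edge. -/
def Half (R : V → V → Prop) (y y' p p' : V) (s t : Multiset V) : Prop :=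
  (Seg R y p s ∧ Seg R y' p' t) ∨ (Seg R y p' s ∧ Seg R y' p t)

theorem Half.flip {y y' p p' : V} {s t : Multiset V} (h : Half R y y' p p' s t) :
    Half R y' y p' p t s := by
  rcases h with h | h
  · exact .inl ⟨h.2, h.1⟩
  · exact .inr ⟨h.2, h.1⟩

/-- Two disjoint paths `v₁ ~ v₂` and `v₃ ~ v₄` covering everything, the first one through `u₁u₂` and
the second one through `u₃u₄`. -/
def Double (R : V → V → Prop) (u v : M → V) (p₁ p₂ p₃ p₄ : M) : Prop :=
  ∃ s₁ s₂ s₃ s₄, Full (s₁ + s₂ + s₃ + s₄) ∧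
    Half R (v p₁) (v p₂) (u p₁) (u p₂) s₁ s₂ ∧ Half R (v p₃) (v p₄) (u p₃) (u p₄) s₃ s₄

theorem Double.flip {u v : M → V} {p₁ p₂ p₃ p₄ : M} (h : Double R u v p₁ p₂ p₃ p₄) :
    Double R u v p₂ p₁ p₄ p₃ := by
  obtain ⟨s₁, s₂, s₃, s₄, h, h1, h2⟩ := h
  exact ⟨s₂, s₁, s₄, s₃, by convert h using 1; abel, h1.flip, h2.flip⟩

theorem Double.exchange {u v : M → V} {p₁ p₂ p₃ p₄ : M} (h : Double R u v p₁ p₂ p₃ p₄) :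
    Double R u v p₃ p₄ p₁ p₂ := by
  obtain ⟨s₁, s₂, s₃, s₄, h, h1, h2⟩ := h
  exact ⟨s₃, s₄, s₁, s₂, by convert h using 1; abel, h2, h1⟩

/-- The cycle `f` runs through `u₁u₂`, `u₃u₄`, `v₄v₂`, `v₃v₁` in this cyclic order. -/
def Twisted (f : ℤ → V) (N : ℤ) (u v : M → V) (p₁ p₂ p₃ p₄ : M) : Prop :=
  ∃ i p q r, i < p ∧ p < q ∧ q < r ∧ r < i + N ∧ f i = u p₁ ∧ f (i + 1) = u p₂ ∧
    f p = u p₃ ∧ f (p + 1) = u p₄ ∧ f q = v p₄ ∧ f (q + 1) = v p₂ ∧ f r = v p₃ ∧ f (r + 1) = v p₁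

namespace Cyc

variable {N : ℤ} {f : ℤ → V} {u v : M → V} {p₁ p₂ p₃ p₄ : M}

theorem full_four (C : Cyc R N f) {i j k l : ℤ} (hij : i < j) (hjk : j < k) (hkl : k < l)
    (hl : l < i + N) {s : Multiset V} (hs : s = span f (i + 1) (j + 1) + span f (j + 1) (k + 1) +
      span f (k + 1) (l + 1) + span f (l + 1) (i + N + 1)) : Full s := by
  rw [hs, span_add f (by omega) (by omega), span_add f (by omega) (by omega),
    span_add f (by omega) (by omega), add_right_comm]
  exact C.full _

theorem segPer (C : Cyc R N f) {i l : ℤ} {x y : V} (h : l < i + N) (hx : f (l + 1) = x)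
    (hy : f i = y) : Seg R x y (span f (l + 1) (i + N + 1)) := by
  have := C.seg' h
  rwa [hx, C.per hy] at this

theorem segOf (C : Cyc R N f) {i l : ℤ} {x y : V} (h : l < i) (hx : f (l + 1) = x)
    (hy : f i = y) : Seg R x y (span f (l + 1) (i + 1)) := by
  have := C.seg' h
  rwa [hx, hy] at this

theorem segOfRev (C : Cyc R N f) {i l : ℤ} {x y : V} (h : l < i) (hx : f (l + 1) = x)
    (hy : f i = y) : Seg R y x (span f (l + 1) (i + 1)) :=
  (C.segOf h hx hy).reverse C.symm

theorem octagon (C : Cyc R N f) (hu : Function.Injective u) (hv : Function.Injective v)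
    (huv : ∀ i j, u i ≠ v j) (hs : ∀ i, R (u i) (v i))
    (h12 : p₁ ≠ p₂) (h14 : p₁ ≠ p₄) (h32 : p₃ ≠ p₂) (h34 : p₃ ≠ p₄) (h13 : p₁ ≠ p₃)
    (e₁ : Arc f (u p₁) (u p₂))
    (e₂ : Arc f (u p₃) (u p₄) ∨ Arc f (u p₄) (u p₃))
    (f₁ : Arc f (v p₁) (v p₃) ∨ Arc f (v p₃) (v p₁))
    (f₂ : Arc f (v p₂) (v p₄) ∨ Arc f (v p₄) (v p₂)) :
    HamPath R (u p₁) (u p₃) ∨ HamPath R (u p₂) (u p₄) ∨ HamPath R (v p₁) (v p₂) ∨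
      HamPath R (v p₃) (v p₄) ∨ Double R u v p₁ p₂ p₃ p₄ ∨ Double R v u p₁ p₃ p₂ p₄ ∨
      Twisted f N u v p₁ p₂ p₃ p₄ ∨ Twisted (fun i => f (-i)) N u v p₂ p₁ p₄ p₃ := by
  set G := _ ∨ _ with hG
  have gu13 : HamPath R (u p₁) (u p₃) → G := fun h => .inl h
  have gu42 : HamPath R (u p₄) (u p₂) → G := fun h => .inr (.inl (h.reverse C.symm))
  have gv12 : HamPath R (v p₁) (v p₂) → G := fun h => .inr (.inr (.inl h))
  have gv21 : HamPath R (v p₂) (v p₁) → G := fun h => gv12 (h.reverse C.symm)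
  have gv34 : HamPath R (v p₃) (v p₄) → G := fun h => .inr (.inr (.inr (.inl h)))
  have gv43 : HamPath R (v p₄) (v p₃) → G := fun h => gv34 (h.reverse C.symm)
  have gd : Double R u v p₁ p₂ p₃ p₄ → G := fun h => .inr (.inr (.inr (.inr (.inl h))))
  have gd' : Double R v u p₁ p₃ p₂ p₄ → G := fun h => .inr (.inr (.inr (.inr (.inr (.inl h)))))
  have gx : Twisted f N u v p₁ p₂ p₃ p₄ → G :=
    fun h => .inr (.inr (.inr (.inr (.inr (.inr (.inl h))))))
  have gx' : Twisted (fun i => f (-i)) N u v p₂ p₁ p₄ p₃ → G :=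
    fun h => .inr (.inr (.inr (.inr (.inr (.inr (.inr h))))))
  clear_value G
  have s1 := hs p₁
  have s2 := hs p₂
  have s3 := hs p₃
  have s4 := hs p₄
  have t1 := C.symm s1
  have t2 := C.symm s2
  have t3 := C.symm s3
  have t4 := C.symm s4
  obtain ⟨i, hi, hi'⟩ := e₁
  have key : ∀ {x y}, Arc f x y → x ≠ u p₁ → ∃ k, i < k ∧ k < i + N ∧ f k = x ∧ f (k + 1) = y :=
    fun h hx => C.exists_arc hi h hx
  have order : ∀ p q r : ℤ, p ≠ q → p ≠ r → q ≠ r → (p < q ∧ q < r) ∨ (p < r ∧ r < q) ∨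
      (q < p ∧ p < r) ∨ (q < r ∧ r < p) ∨ (r < p ∧ p < q) ∨ (r < q ∧ q < p) := by
    intros; omega
  have ne : ∀ {k l : ℤ} {x y : V}, f k = x → f l = y → x ≠ y → k ≠ l := by
    rintro k l x y h1 h2 h rfl
    exact h (h1.symm.trans h2)
  rcases e₂ with e₂ | e₂ <;> rcases f₁ with f₁ | f₁ <;> rcases f₂ with f₂ | f₂
  · obtain ⟨p, hp1, hp2, hp, hp'⟩ := key e₂ (hu.ne h13.symm)
    obtain ⟨q, hq1, hq2, hq, hq'⟩ := key f₁ (huv _ _).symm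
    obtain ⟨r, hr1, hr2, hr, hr'⟩ := key f₂ (huv _ _).symm
    rcases order p q r (ne hp hq (huv _ _)) (ne hp hr (huv _ _)) (ne hq hr (hv.ne h12)) with
      ⟨h1, h2⟩ | ⟨h1, h2⟩ | ⟨h1, h2⟩ | ⟨h1, h2⟩ | ⟨h1, h2⟩ | ⟨h1, h2⟩
    · exact gu13 (C.exchA (by omega) (by omega) (by omega) hi hi' hp hp' hr hr' t4 t2)
    · exact gu13 (C.exchA (by omega) (by omega) (by omega) hi hi' hp hp' hr hr' t4 t2)
    · exact gu13 (C.exchA (by omega) (by omega) (by omega) hi hi' hp hp' hr hr' t4 t2)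
    · exact gv12 (C.exchA (by omega) (by omega) (by omega) hq hq' hr hr' hp hp' s4 s3)
    · exact gv21 (C.exchD (by omega) (by omega) (by omega) hr hr' hp hp' hq hq' t3 t4)
    · refine gx' ⟨-(i + N + 1), -(p + 1), -(q + 1), -(r + 1), by omega, by omega, by omega, by omega,
        ?_, ?_, ?_, ?_, ?_, ?_, ?_, ?_⟩
      · simpa using C.per' hi'
      · simpa using C.per hi
      all_goals simpa
  · obtain ⟨p, hp1, hp2, hp, hp'⟩ := key e₂ (hu.ne h13.symm)
    obtain ⟨q, hq1, hq2, hq, hq'⟩ := key f₁ (huv _ _).symm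
    obtain ⟨r, hr1, hr2, hr, hr'⟩ := key f₂ (huv _ _).symm
    rcases order p q r (ne hp hq (huv _ _)) (ne hp hr (huv _ _)) (ne hq hr (hv.ne h14)) with
      ⟨h1, h2⟩ | ⟨h1, h2⟩ | ⟨h1, h2⟩ | ⟨h1, h2⟩ | ⟨h1, h2⟩ | ⟨h1, h2⟩
    · exact gv12 (C.exchB (by omega) (by omega) (by omega)
        hq hq' hr hr' (C.per hp) (C.per' hp') s4 t3)
    · exact gv43 (C.exchC (by omega) (by omega) (by omega)
        hr hr' hq hq' (C.per hi) (C.per' hi') s2 t1)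
    · refine gd ⟨_, _, _, _, C.full_four hq1 h1 h2 hr2 ?_,
        .inr ⟨C.segOfRev hq1 hi' hq, (C.segPer hr2 hr' hi)⟩,
        .inl ⟨C.segOf h1 hq' hp, C.segOfRev h2 hp' hr⟩⟩
      abel
    · exact gu13 (C.exchD (by omega) (by omega) (by omega) hi hi' hr hr' hp hp' s4 s2)
    · exact gu13 (C.exchD (by omega) (by omega) (by omega) hi hi' hr hr' hp hp' s4 s2)
    · exact gv43 (C.exchC (by omega) (by omega) (by omega)
        hr hr' hq hq' (C.per hi) (C.per' hi') s2 t1)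
  · obtain ⟨p, hp1, hp2, hp, hp'⟩ := key e₂ (hu.ne h13.symm)
    obtain ⟨q, hq1, hq2, hq, hq'⟩ := key f₁ (huv _ _).symm
    obtain ⟨r, hr1, hr2, hr, hr'⟩ := key f₂ (huv _ _).symm
    rcases order p q r (ne hp hq (huv _ _)) (ne hp hr (huv _ _)) (ne hq hr (hv.ne h32)) with
      ⟨h1, h2⟩ | ⟨h1, h2⟩ | ⟨h1, h2⟩ | ⟨h1, h2⟩ | ⟨h1, h2⟩ | ⟨h1, h2⟩
    · exact gu13 (C.exchA (by omega) (by omega) (by omega) hi hi' hp hp' hr hr' t4 t2)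
    · exact gu13 (C.exchA (by omega) (by omega) (by omega) hi hi' hp hp' hr hr' t4 t2)
    · exact gv34 (C.exchB (by omega) (by omega) (by omega)
        hq hq' hr hr' (C.per hi) (C.per' hi') s2 t1)
    · exact gv34 (C.exchB (by omega) (by omega) (by omega)
        hq hq' hr hr' (C.per hi) (C.per' hi') s2 t1)
    · refine gd ⟨_, _, _, _, C.full_four hr1 h1 h2 hq2 ?_,
        .inl ⟨C.segPer hq2 hq' hi, C.segOfRev hr1 hi' hr⟩,
        .inr ⟨C.segOfRev h2 hp' hq, C.segOf h1 hr' hp⟩⟩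
      abel
    · exact gv21 (C.exchC (by omega) (by omega) (by omega) hr hr' hq hq' hp hp' s4 t3)
  · obtain ⟨p, hp1, hp2, hp, hp'⟩ := key e₂ (hu.ne h13.symm)
    obtain ⟨q, hq1, hq2, hq, hq'⟩ := key f₁ (huv _ _).symm
    obtain ⟨r, hr1, hr2, hr, hr'⟩ := key f₂ (huv _ _).symm
    rcases order p q r (ne hp hq (huv _ _)) (ne hp hr (huv _ _)) (ne hq hr (hv.ne h34)) with
      ⟨h1, h2⟩ | ⟨h1, h2⟩ | ⟨h1, h2⟩ | ⟨h1, h2⟩ | ⟨h1, h2⟩ | ⟨h1, h2⟩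
    · exact gv34 (C.exchA (by omega) (by omega) (by omega)
        hq hq' hr hr' (C.per hi) (C.per' hi') s2 s1)
    · exact gx ⟨i, p, r, q, by omega, by omega, by omega, by omega,
        hi, hi', hp, hp', hr, hr', hq, hq'⟩
    · exact gv34 (C.exchA (by omega) (by omega) (by omega)
        hq hq' hr hr' (C.per hi) (C.per' hi') s2 s1)
    · exact gv34 (C.exchA (by omega) (by omega) (by omega)
        hq hq' hr hr' (C.per hi) (C.per' hi') s2 s1)
    · exact gu13 (C.exchD (by omega) (by omega) (by omega) hi hi' hr hr' hp hp' s4 s2)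
    · exact gu13 (C.exchD (by omega) (by omega) (by omega) hi hi' hr hr' hp hp' s4 s2)
  · obtain ⟨p, hp1, hp2, hp, hp'⟩ := key e₂ (hu.ne h14.symm)
    obtain ⟨q, hq1, hq2, hq, hq'⟩ := key f₁ (huv _ _).symm
    obtain ⟨r, hr1, hr2, hr, hr'⟩ := key f₂ (huv _ _).symm
    rcases order p q r (ne hp hq (huv _ _)) (ne hp hr (huv _ _)) (ne hq hr (hv.ne h12)) with
      ⟨h1, h2⟩ | ⟨h1, h2⟩ | ⟨h1, h2⟩ | ⟨h1, h2⟩ | ⟨h1, h2⟩ | ⟨h1, h2⟩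
    · exact gu13 (C.exchB (by omega) (by omega) (by omega) hi hi' hp hp' hr hr' t4 s2)
    · exact gu13 (C.exchB (by omega) (by omega) (by omega) hi hi' hp hp' hr hr' t4 s2)
    · exact gu42 (C.exchC (by omega) (by omega) (by omega)
        hp hp' (C.per hi) (C.per' hi') (C.per hq) (C.per' hq') t3 s1)
    · exact gu42 (C.exchC (by omega) (by omega) (by omega)
        hp hp' (C.per hi) (C.per' hi') (C.per hq) (C.per' hq') t3 s1)
    · refine gd' ⟨_, _, _, _, C.full_four hr1 h1 h2 hq2 ?_,
        .inr ⟨(C.segPer hq2 hq' hi).reverse C.symm, C.segOf h2 hp' hq⟩,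
        .inl ⟨C.segOf hr1 hi' hr, C.segOfRev h1 hr' hp⟩⟩
      abel
    · exact gu42 (C.exchC (by omega) (by omega) (by omega)
        hp hp' (C.per hi) (C.per' hi') (C.per hq) (C.per' hq') t3 s1)
  · obtain ⟨p, hp1, hp2, hp, hp'⟩ := key e₂ (hu.ne h14.symm)
    obtain ⟨q, hq1, hq2, hq, hq'⟩ := key f₁ (huv _ _).symm
    obtain ⟨r, hr1, hr2, hr, hr'⟩ := key f₂ (huv _ _).symm
    rcases order p q r (ne hp hq (huv _ _)) (ne hp hr (huv _ _)) (ne hq hr (hv.ne h14)) with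
      ⟨h1, h2⟩ | ⟨h1, h2⟩ | ⟨h1, h2⟩ | ⟨h1, h2⟩ | ⟨h1, h2⟩ | ⟨h1, h2⟩
    · exact gu13 (C.exchC (by omega) (by omega) (by omega) hi hi' hp hp' hr hr' t2 s4)
    · exact gu13 (C.exchC (by omega) (by omega) (by omega) hi hi' hp hp' hr hr' t2 s4)
    · exact gu42 (C.exchC (by omega) (by omega) (by omega)
        hp hp' (C.per hi) (C.per' hi') (C.per hq) (C.per' hq') t3 s1)
    · exact gu42 (C.exchC (by omega) (by omega) (by omega)
        hp hp' (C.per hi) (C.per' hi') (C.per hq) (C.per' hq') t3 s1)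
    · exact gv43 (C.exchC (by omega) (by omega) (by omega)
        hr hr' hq hq' (C.per hi) (C.per' hi') s2 t1)
    · exact gv43 (C.exchC (by omega) (by omega) (by omega)
        hr hr' hq hq' (C.per hi) (C.per' hi') s2 t1)
  · obtain ⟨p, hp1, hp2, hp, hp'⟩ := key e₂ (hu.ne h14.symm)
    obtain ⟨q, hq1, hq2, hq, hq'⟩ := key f₁ (huv _ _).symm
    obtain ⟨r, hr1, hr2, hr, hr'⟩ := key f₂ (huv _ _).symm
    rcases order p q r (ne hp hq (huv _ _)) (ne hp hr (huv _ _)) (ne hq hr (hv.ne h32)) with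
      ⟨h1, h2⟩ | ⟨h1, h2⟩ | ⟨h1, h2⟩ | ⟨h1, h2⟩ | ⟨h1, h2⟩ | ⟨h1, h2⟩
    · exact gu13 (C.exchB (by omega) (by omega) (by omega) hi hi' hp hp' hr hr' t4 s2)
    · exact gu13 (C.exchB (by omega) (by omega) (by omega) hi hi' hp hp' hr hr' t4 s2)
    · exact gu42 (C.exchB (by omega) (by omega) (by omega)
        hp hp' (C.per hi) (C.per' hi') (C.per hq) (C.per' hq') t1 s3)
    · exact gv34 (C.exchB (by omega) (by omega) (by omega)
        hq hq' hr hr' (C.per hi) (C.per' hi') s2 t1)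
    · refine gd ⟨_, _, _, _, C.full_four hr1 h1 h2 hq2 ?_,
        .inl ⟨C.segPer hq2 hq' hi, C.segOfRev hr1 hi' hr⟩,
        .inl ⟨C.segOfRev h2 hp' hq, C.segOf h1 hr' hp⟩⟩
      abel
    · exact gu42 (C.exchB (by omega) (by omega) (by omega)
        hp hp' (C.per hi) (C.per' hi') (C.per hq) (C.per' hq') t1 s3)
  · obtain ⟨p, hp1, hp2, hp, hp'⟩ := key e₂ (hu.ne h14.symm)
    obtain ⟨q, hq1, hq2, hq, hq'⟩ := key f₁ (huv _ _).symm
    obtain ⟨r, hr1, hr2, hr, hr'⟩ := key f₂ (huv _ _).symm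
    rcases order p q r (ne hp hq (huv _ _)) (ne hp hr (huv _ _)) (ne hq hr (hv.ne h34)) with
      ⟨h1, h2⟩ | ⟨h1, h2⟩ | ⟨h1, h2⟩ | ⟨h1, h2⟩ | ⟨h1, h2⟩ | ⟨h1, h2⟩
    · exact gu13 (C.exchC (by omega) (by omega) (by omega) hi hi' hp hp' hr hr' t2 s4)
    · exact gu13 (C.exchC (by omega) (by omega) (by omega) hi hi' hp hp' hr hr' t2 s4)
    · exact gu42 (C.exchB (by omega) (by omega) (by omega)
        hp hp' (C.per hi) (C.per' hi') (C.per hq) (C.per' hq') t1 s3)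
    · exact gv34 (C.exchA (by omega) (by omega) (by omega)
        hq hq' hr hr' (C.per hi) (C.per' hi') s2 s1)
    · refine gd' ⟨_, _, _, _, C.full_four hr1 h1 h2 hq2 ?_,
        .inl ⟨(C.segPer hq2 hq' hi).reverse C.symm, C.segOf h2 hp' hq⟩,
        .inr ⟨C.segOf hr1 hi' hr, C.segOfRev h1 hr' hp⟩⟩
      abel
    · exact gu42 (C.exchB (by omega) (by omega) (by omega)
        hp hp' (C.per hi) (C.per' hi') (C.per hq) (C.per' hq') t1 s3)

end Cyc

end RoseWindow

namespace RoseWindow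

variable {M V : Type*} {R : V → V → Prop}

/-- `R` is the adjacency relation of the cubic graph on `{uᵢ} ∪ {vᵢ}` with edges `uᵢ uᵢ₊ₐ`,
`vᵢ vᵢ₊ᵦ` and `uᵢ vᵢ`. -/
structure IsLayer [AddCommGroup M] (R : V → V → Prop) (u v : M → V) (a b : M) : Prop where
  u_inj : Function.Injective u
  v_inj : Function.Injective v
  u_ne_v : ∀ i j, u i ≠ v j
  cover : ∀ w, (∃ i, u i = w) ∨ ∃ i, v i = w
  u_adj : ∀ i w, R (u i) w ↔ w = u (i + a) ∨ w = u (i - a) ∨ w = v i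
  v_adj : ∀ i w, R (v i) w ↔ w = v (i + b) ∨ w = v (i - b) ∨ w = u i
  two_a : a + a ≠ 0
  two_b : b + b ≠ 0
  ne : a ≠ b
  ne_neg : a ≠ -b
  three : ¬(3 • a = 0 ∧ 3 • b = 0)

/-- Path systems of a layer from which Hamilton cycles of chains of layers can be assembled. -/
def Good [AddCommGroup M] (R : V → V → Prop) (u v : M → V) (a b : M) : Prop :=
  (∃ i, HamPath R (v i) (v (i + a))) ∨ (∃ i, HamPath R (u i) (u (i + b))) ∨
    (∃ i, Double R u v i (i + a) (i + b) (i + a + b)) ∨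
    (∃ i, Double R v u i (i + b) (i + a) (i + a + b))

/-- The points `p₁, p₁ + a, p₁ + b, p₁ + a + b`. -/
def Sq [AddCommGroup M] (a b p₁ p₂ p₃ p₄ : M) : Prop :=
  p₂ = p₁ + a ∧ p₃ = p₁ + b ∧ p₄ = p₁ + a + b

/-- The cycle `f` uses the spoke at `i`. -/
def Turn (f : ℤ → V) (u v : M → V) (i : M) : Prop := Arc f (u i) (v i) ∨ Arc f (v i) (u i)

theorem Turn.swap {f : ℤ → V} {u v : M → V} {i : M} (h : Turn f u v i) : Turn f v u i := h.symm

theorem turn_rev {f : ℤ → V} {u v : M → V} {i : M} :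
    Turn (fun i => f (-i)) u v i ↔ Turn f u v i := by
  simp only [Turn, Cyc.arc_rev, or_comm]

section Layer

variable [AddCommGroup M] {u v : M → V} {a b : M}

theorem Good.swap (h : Good R u v a b) : Good R v u b a := by
  rcases h with h | h | ⟨i, h⟩ | ⟨i, h⟩
  · exact .inr (.inl h)
  · exact .inl h
  · exact .inr (.inr (.inr ⟨i, by rwa [add_right_comm]⟩))
  · exact .inr (.inr (.inl ⟨i, by rwa [add_right_comm]⟩))

namespace IsLayer

theorem swap (L : IsLayer R u v a b) : IsLayer R v u b a where
  u_inj := L.v_inj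
  v_inj := L.u_inj
  u_ne_v i j := (L.u_ne_v j i).symm
  cover w := (L.cover w).symm
  u_adj := L.v_adj
  v_adj := L.u_adj
  two_a := L.two_b
  two_b := L.two_a
  ne := L.ne.symm
  ne_neg h := L.ne_neg (by rw [h, neg_neg])
  three h := L.three h.symm

theorem neg_left (L : IsLayer R u v a b) : IsLayer R u v (-a) b where
  u_inj := L.u_inj
  v_inj := L.v_inj
  u_ne_v := L.u_ne_v
  cover := L.cover
  u_adj i w := by
    rw [L.u_adj, sub_neg_eq_add, ← sub_eq_add_neg]
    tauto
  v_adj := L.v_adj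
  two_a h := L.two_a (by rw [← neg_eq_zero]; rw [← h]; abel)
  two_b := L.two_b
  ne h := L.ne_neg (by rw [← h, neg_neg])
  ne_neg h := L.ne (neg_injective h)
  three h := L.three ⟨by simpa using h.1, h.2⟩

theorem neg_right (L : IsLayer R u v a b) : IsLayer R u v a (-b) := L.swap.neg_left.swap

theorem rel (L : IsLayer R u v a b) (i : M) : R (u i) (v i) := (L.u_adj _ _).2 (by simp)

theorem rel_u (L : IsLayer R u v a b) (i : M) : R (u i) (u (i + a)) := (L.u_adj _ _).2 (by simp)

theorem rel_v (L : IsLayer R u v a b) (i : M) : R (v i) (v (i + b)) := (L.v_adj _ _).2 (by simp)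

theorem a_ne (L : IsLayer R u v a b) : a ≠ 0 := fun h => L.two_a (by simp [h])

theorem symm (L : IsLayer R u v a b) {x y : V} (h : R x y) : R y x := by
  rcases L.cover x with ⟨i, rfl⟩ | ⟨i, rfl⟩
  · rcases (L.u_adj _ _).1 h with rfl | rfl | rfl
    · exact (L.u_adj _ _).2 (by simp)
    · exact (L.u_adj _ _).2 (by simp)
    · exact (L.v_adj _ _).2 (by simp)
  · rcases (L.v_adj _ _).1 h with rfl | rfl | rfl
    · exact (L.v_adj _ _).2 (by simp)
    · exact (L.v_adj _ _).2 (by simp)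
    · exact (L.u_adj _ _).2 (by simp)

end IsLayer

theorem Good.neg_left (h : Good R u v (-a) b) (hR : ∀ {x y}, R x y → R y x) : Good R u v a b := by
  rcases h with ⟨i, h⟩ | h | ⟨i, h⟩ | ⟨i, h⟩
  · exact .inl ⟨i + -a, by simpa using h.reverse hR⟩
  · exact .inr (.inl h)
  · exact .inr (.inr (.inl ⟨i + -a, by
      have := h.flip
      convert this using 1 <;> abel⟩))
  · exact .inr (.inr (.inr ⟨i + -a, by
      have := h.exchange
      convert this using 1 <;> abel⟩))

theorem Good.neg_right (h : Good R u v a (-b)) (hR : ∀ {x y}, R x y → R y x) : Good R u v a b :=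
  (h.swap.neg_left hR).swap

theorem Good.of_v {i j : M} (hR : ∀ {x y}, R x y → R y x) (h : HamPath R (v i) (v j))
    (hij : j = i + a ∨ i = j + a) : Good R u v a b := by
  rcases hij with rfl | rfl
  · exact .inl ⟨_, h⟩
  · exact .inl ⟨_, h.reverse hR⟩

theorem Good.of_u {i j : M} (hR : ∀ {x y}, R x y → R y x) (h : HamPath R (u i) (u j))
    (hij : j = i + b ∨ i = j + b) : Good R u v a b :=
  (Good.of_v (u := v) (a := b) (b := a) hR h hij).swap

theorem Sq.swap {p₁ p₂ p₃ p₄ : M} (h : Sq a b p₁ p₂ p₃ p₄) : Sq b a p₁ p₃ p₂ p₄ :=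
  ⟨h.2.1, h.1, by rw [h.2.2, add_right_comm]⟩

theorem Sq.refl {p₁ p₂ p₃ p₄ : M} (h : Sq a b p₁ p₂ p₃ p₄) : Sq (-a) (-b) p₄ p₃ p₂ p₁ := by
  obtain ⟨rfl, rfl, rfl⟩ := h
  refine ⟨?_, ?_, ?_⟩ <;> abel

variable {N : ℤ} {f : ℤ → V}

namespace IsLayer

theorem octagon (L : IsLayer R u v a b) (C : Cyc R N f) {p₁ p₂ p₃ p₄ : M}
    (hp : Sq a b p₁ p₂ p₃ p₄) (e₁ : Arc f (u p₁) (u p₂))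
    (e₂ : Arc f (u p₃) (u p₄) ∨ Arc f (u p₄) (u p₃))
    (f₁ : Arc f (v p₁) (v p₃) ∨ Arc f (v p₃) (v p₁))
    (f₂ : Arc f (v p₂) (v p₄) ∨ Arc f (v p₄) (v p₂)) :
    Good R u v a b ∨ Twisted f N u v p₁ p₂ p₃ p₄ ∨
      Twisted (fun i => f (-i)) N u v p₂ p₁ p₄ p₃ := by
  obtain ⟨rfl, rfl, rfl⟩ := hp
  have h0 := L.a_ne
  have h0' := L.swap.a_ne
  rcases C.octagon L.u_inj L.v_inj L.u_ne_v L.rel (by simpa using h0) (by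
      rw [add_assoc, Ne, left_eq_add]
      exact fun h => L.ne_neg (eq_neg_of_add_eq_zero_left h)) (by simpa using L.ne.symm)
      (by rw [add_right_comm]; simpa using h0) (by simpa using h0') e₁ e₂ f₁ f₂ with
    h | h | h | h | h | h | h | h
  · exact .inl (Good.of_u L.symm h (.inl rfl))
  · exact .inl (Good.of_u L.symm h (.inl rfl))
  · exact .inl (Good.of_v L.symm h (.inl rfl))
  · exact .inl (Good.of_v L.symm h (.inl (add_right_comm _ _ _)))
  · exact .inl (.inr (.inr (.inl ⟨_, h⟩)))
  · exact .inl (.inr (.inr (.inr ⟨_, h⟩)))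
  · exact .inr (.inl h)
  · exact .inr (.inr h)

/-- The six ways in which a cycle can run through `uᵢ`. -/
theorem arc_cases (L : IsLayer R u v a b) (C : Cyc R N f) (i : M) :
    (Arc f (u (i - a)) (u i) ∧ Arc f (u i) (u (i + a))) ∨
    (Arc f (u (i + a)) (u i) ∧ Arc f (u i) (u (i - a))) ∨
    (Arc f (u (i - a)) (u i) ∧ Arc f (u i) (v i)) ∨
    (Arc f (u (i + a)) (u i) ∧ Arc f (u i) (v i)) ∨
    (Arc f (v i) (u i) ∧ Arc f (u i) (u (i + a))) ∨
    (Arc f (v i) (u i) ∧ Arc f (u i) (u (i - a))) := by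
  obtain ⟨k, hk⟩ := C.surj (u i)
  have h1 := C.step k
  have h2 := C.symm (C.step (k - 1))
  have hne := C.ne_add_two (k - 1)
  have A1 : Arc f (u i) (f (k + 1)) := ⟨k, hk, rfl⟩
  have A2 : Arc f (f (k - 1)) (u i) := ⟨k - 1, rfl, by rw [sub_add_cancel, hk]⟩
  rw [sub_add_cancel] at h2 hne
  rw [hk, L.u_adj] at h1 h2
  rcases h1 with h1 | h1 | h1 <;> rcases h2 with h2 | h2 | h2 <;> rw [h1] at A1 hne <;>
    rw [h2] at A2 hne <;> first | exact absurd rfl hne | tauto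

variable {i j : M}

theorem cross_cases (L : IsLayer R u v a b) (C : Cyc R N f) (h : ¬Turn f u v i) :
    (Arc f (u (i - a)) (u i) ∧ Arc f (u i) (u (i + a))) ∨
    (Arc f (u (i + a)) (u i) ∧ Arc f (u i) (u (i - a))) := by
  have := L.arc_cases C i
  unfold Turn at h
  tauto

theorem cross_arc (L : IsLayer R u v a b) (C : Cyc R N f) (h : ¬Turn f u v i)
    (h' : Arc f (u j) (u i)) (hij : i = j + a) : Arc f (u i) (u (i + a)) := by
  rcases L.cross_cases C h with h1 | h1
  · exact h1.2
  · have := L.u_inj (C.arc_left_unique h1.1 h')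
    rw [hij, add_assoc] at this
    exact absurd (by simpa using this) L.two_a

theorem turn_arc (L : IsLayer R u v a b) (C : Cyc R N f) (h : Turn f u v i)
    (h' : Arc f (u j) (u i)) : Arc f (u i) (v i) :=
  h.resolve_right fun h2 => L.u_ne_v _ _ (C.arc_left_unique h' h2)

theorem turn_arc' (L : IsLayer R u v a b) (C : Cyc R N f) (h : Turn f u v i)
    (h' : Arc f (u i) (u j)) : Arc f (v i) (u i) :=
  h.resolve_left fun h2 => L.u_ne_v _ _ (C.arc_right_unique h' h2)

theorem turn_of_unused (L : IsLayer R u v a b) (C : Cyc R N f) (hij : j = i + a ∨ i = j + a)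
    (h : ¬Arc f (u i) (u j)) (h' : ¬Arc f (u j) (u i)) : Turn f u v i := by
  by_contra hc
  rcases hij with rfl | rfl
  · have := L.cross_cases C hc
    tauto
  · have := L.cross_cases C hc
    rw [add_sub_cancel_right] at this
    tauto

theorem not_turn (L : IsLayer R u v a b) (C : Cyc R N f) {k : M} (h : Arc f (u j) (u i))
    (h' : Arc f (v k) (v i)) : ¬Turn f u v i := by
  rintro (h2 | h2)
  · exact L.u_ne_v _ _ (C.arc_left_unique h2 h')
  · exact L.u_ne_v _ _ (C.arc_left_unique h h2)

theorem good_of_parallel (L : IsLayer R u v a b) (C : Cyc R N f) (h : Arc f (u i) (v i))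
    (h' : Arc f (u j) (v j)) (hij : j = i + a) : Good R u v a b := by
  obtain ⟨k, hk, hk'⟩ := h
  obtain ⟨l, h1, h2, hl, hl'⟩ := C.exists_arc hk h' (by
    rw [hij, L.u_inj.ne_iff]; simpa using L.a_ne)
  exact Good.of_v L.symm (C.exchTwo' h1 h2 hk hk' hl hl' (hij ▸ L.rel_u i)) (.inl hij)

theorem good_of_parallel' (L : IsLayer R u v a b) (C : Cyc R N f) (h : Arc f (v i) (u i))
    (h' : Arc f (v j) (u j)) (hij : j = i + a) : Good R u v a b :=
  L.good_of_parallel C.rev (Cyc.arc_rev.2 h) (Cyc.arc_rev.2 h') hij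

end IsLayer

end Layer

end RoseWindow

namespace RoseWindow

variable {M V : Type*} {R : V → V → Prop} {u v : M → V}
  {N : ℤ} {f : ℤ → V} {p₁ p₂ p₃ p₄ : M}

theorem Twisted.swap (h : Twisted f N u v p₁ p₂ p₃ p₄) :
    Twisted (fun i => f (-i)) N v u p₁ p₃ p₂ p₄ := by
  obtain ⟨i, p, q, r, h1, h2, h3, h4, e1, e2, e3, e4, e5, e6, e7, e8⟩ := h
  refine ⟨-(r + 1), -(q + 1), -(p + 1), -(i + 1), by omega, by omega, by omega, by omega, ?_⟩
  simp [*]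

theorem Twisted.refl (C : Cyc R N f) (h : Twisted f N u v p₁ p₂ p₃ p₄) :
    Twisted (fun i => f (-i)) N u v p₄ p₃ p₂ p₁ := by
  obtain ⟨i, p, q, r, h1, h2, h3, h4, e1, e2, e3, e4, e5, e6, e7, e8⟩ := h
  refine ⟨-(p + 1), -(i + 1), -(r + 1) + N, -(q + 1) + N, by omega, by omega, by omega, by omega,
    ?_, ?_, ?_, ?_, C.rev.per ?_, C.rev.per' ?_, C.rev.per ?_, C.rev.per' ?_⟩ <;> simp [*]

variable [AddCommGroup M] {a b : M}

/-- A layer together with a Hamilton cycle running through a square in the twisted way. -/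
structure Tw (R : V → V → Prop) (u v : M → V) (a b : M) (N : ℤ) (f : ℤ → V) (p₁ p₂ p₃ p₄ : M) :
    Prop where
  lay : IsLayer R u v a b
  cyc : Cyc R N f
  sq : Sq a b p₁ p₂ p₃ p₄
  tw : Twisted f N u v p₁ p₂ p₃ p₄

namespace Tw

theorem swap (T : Tw R u v a b N f p₁ p₂ p₃ p₄) :
    Tw R v u b a N (fun i => f (-i)) p₁ p₃ p₂ p₄ :=
  ⟨T.lay.swap, T.cyc.rev, T.sq.swap, T.tw.swap⟩

theorem refl (T : Tw R u v a b N f p₁ p₂ p₃ p₄) :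
    Tw R u v (-a) (-b) N (fun i => f (-i)) p₄ p₃ p₂ p₁ :=
  ⟨T.lay.neg_left.neg_right, T.cyc.rev, T.sq.refl, T.tw.refl T.cyc⟩

theorem good_refl (T : Tw R u v a b N f p₁ p₂ p₃ p₄) (h : Good R u v (-a) (-b)) :
    Good R u v a b := (h.neg_left T.lay.symm).neg_right T.lay.symm

theorem e₁ (T : Tw R u v a b N f p₁ p₂ p₃ p₄) : Arc f (u p₁) (u p₂) := by
  obtain ⟨i, p, q, r, h1, h2, h3, h4, e1, e2, e3, e4, e5, e6, e7, e8⟩ := T.tw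
  exact ⟨i, e1, e2⟩

theorem e₂ (T : Tw R u v a b N f p₁ p₂ p₃ p₄) : Arc f (u p₃) (u p₄) := by
  obtain ⟨i, p, q, r, h1, h2, h3, h4, e1, e2, e3, e4, e5, e6, e7, e8⟩ := T.tw
  exact ⟨p, e3, e4⟩

theorem f₂ (T : Tw R u v a b N f p₁ p₂ p₃ p₄) : Arc f (v p₄) (v p₂) := by
  obtain ⟨i, p, q, r, h1, h2, h3, h4, e1, e2, e3, e4, e5, e6, e7, e8⟩ := T.tw
  exact ⟨q, e5, e6⟩

theorem f₁ (T : Tw R u v a b N f p₁ p₂ p₃ p₄) : Arc f (v p₃) (v p₁) := by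
  obtain ⟨i, p, q, r, h1, h2, h3, h4, e1, e2, e3, e4, e5, e6, e7, e8⟩ := T.tw
  exact ⟨r, e7, e8⟩

theorem not_turn₂ (T : Tw R u v a b N f p₁ p₂ p₃ p₄) : ¬Turn f u v p₂ :=
  T.lay.not_turn T.cyc T.e₁ T.f₂

theorem arc_right (T : Tw R u v a b N f p₁ p₂ p₃ p₄) : Arc f (u p₂) (u (p₂ + a)) :=
  T.lay.cross_arc T.cyc T.not_turn₂ T.e₁ T.sq.1

theorem arc_down (T : Tw R u v a b N f p₁ p₂ p₃ p₄) : Arc f (v p₂) (v (p₂ - b)) := by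
  have := T.lay.swap.neg_left.cross_arc T.cyc (fun h => T.not_turn₂ h.swap) T.f₂ (by
    rw [T.sq.1, T.sq.2.2]; abel)
  rwa [← sub_eq_add_neg] at this

theorem step_right (T : Tw R u v a b N f p₁ p₂ p₃ p₄) (h4 : ¬Turn f u v p₄) :
    Good R u v a b ∨ Tw R u v a b N f p₂ (p₂ + a) p₄ (p₄ + a) := by
  have L := T.lay
  have C := T.cyc
  obtain ⟨s1, s2, s3⟩ := T.sq
  have hs : p₄ + a = p₂ + a + b := by rw [s1, s3]; abel
  have A1 := T.arc_right
  have A2 : Arc f (u p₄) (u (p₄ + a)) := L.cross_arc C h4 T.e₂ (by rw [s2, s3]; abel)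
  by_cases h : Arc f (v (p₂ + a)) (v (p₄ + a)) ∨ Arc f (v (p₄ + a)) (v (p₂ + a))
  · rcases L.octagon C (p₁ := p₂) (p₂ := p₂ + a) (p₃ := p₄) (p₄ := p₄ + a)
      ⟨rfl, by rw [s1, s3], hs⟩ A1 (.inl A2) (.inr T.f₂) h with h' | h' | h'
    · exact .inl h'
    · exact .inr ⟨L, C, ⟨rfl, by rw [s1, s3], hs⟩, h'⟩
    · obtain ⟨i, p, q, r, _, _, _, _, _, _, _, _, e5, e6, e7, e8⟩ := h'
      exact (C.arc_asymm T.f₂ (Cyc.arc_rev.1 ⟨q, e5, e6⟩)).elim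
  · push Not at h
    left
    have t1 : Turn f u v (p₂ + a) :=
      (L.swap.turn_of_unused C (.inl hs) h.1 h.2).swap
    have t2 : Turn f u v (p₄ + a) :=
      (L.swap.turn_of_unused C (.inr hs) h.2 h.1).swap
    exact (L.swap.good_of_parallel' C (L.turn_arc C t1 A1) (L.turn_arc C t2 A2) hs).swap

end Tw

end RoseWindow

namespace RoseWindow

variable {M V : Type*} {R : V → V → Prop} [AddCommGroup M] {u v : M → V} {a b : M}
  {N : ℤ} {f : ℤ → V} {p₁ p₂ p₃ p₄ : M}

theorem Cyc.pos_eq {R : V → V → Prop} (C : Cyc R N f) {w x : V} (h : Arc f w x) {k : ℤ}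
    (hk : f k = w) : f (k + 1) = x :=
  C.arc_right_unique ⟨k, hk, rfl⟩ h

theorem Cyc.exists_arc_succ (C : Cyc R N f) {i : ℤ} {w x y z : V} (hi : f i = w) (h : Arc f x y)
    (h' : Arc f y z) (hx : x ≠ w) (hy : y ≠ w) :
    ∃ k, i < k ∧ k + 1 < i + N ∧ f k = x ∧ f (k + 1) = y ∧ f (k + 1 + 1) = z := by
  obtain ⟨k, h1, h2, h3, h4⟩ := C.exists_arc hi h hx
  refine ⟨k, h1, lt_of_le_of_ne (by omega) fun h => hy ?_, h3, h4, C.pos_eq h' h4⟩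
  rw [← h4, h, C.add_period, hi]

namespace Tw

theorem turn_right (T : Tw R u v a b N f p₁ p₂ p₃ p₄) (h4 : Turn f u v p₄) :
    Good R u v a b ∨ Arc f (u (p₂ + a)) (v (p₂ + a)) := by
  have L := T.lay
  have C := T.cyc
  obtain ⟨s1, s2, s3⟩ := T.sq
  have A1 := T.arc_right
  have A4 := L.turn_arc C h4 T.e₂
  have hz : p₄ + a = p₂ + a + b := by rw [s1, s3]; abel
  have hz' : p₄ = p₃ + a := by rw [s2, s3]; abel
  have hT : Turn f u v (p₄ + a) := by
    refine L.turn_of_unused (j := p₄) C (.inr rfl) (fun h => ?_) fun h => ?_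
    · have := L.u_inj (C.arc_left_unique h T.e₂)
      rw [hz', add_assoc] at this
      exact L.two_a (by simpa using this)
    · exact L.u_ne_v _ _ (C.arc_right_unique h A4)
  rcases hT with hT | hT
  · exact .inl (L.good_of_parallel C A4 hT rfl)
  by_cases hs : Turn f u v (p₂ + a)
  · exact .inr (L.turn_arc C hs A1)
  left
  have hB : Arc f (v (p₂ + a - b)) (v (p₂ + a)) ∧ Arc f (v (p₂ + a)) (v (p₄ + a)) := by
    rw [hz]
    rcases L.swap.cross_cases C (fun h => hs h.swap) with h | h
    · exact h
    · rw [← hz] at h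
      exact (L.u_ne_v _ _ (C.arc_right_unique hT h.1)).elim
  obtain ⟨B1, B2⟩ := hB
  have hba := L.ne.symm
  obtain ⟨i, hi, hi'⟩ := A1
  obtain ⟨q, hq1, hq2, hq, hq', hq''⟩ := C.exists_arc_succ hi T.f₂ T.arc_down (L.u_ne_v _ _).symm
    (L.u_ne_v _ _).symm
  obtain ⟨k, hk1, hk2, hk, hk', hk''⟩ := C.exists_arc_succ hi B1 B2 (L.u_ne_v _ _).symm
    (L.u_ne_v _ _).symm
  have hkq : k ≠ q := by
    rintro rfl
    have := L.v_inj (hk'.symm.trans hq')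
    exact L.a_ne (by simpa using this)
  rcases lt_or_gt_of_ne hkq with h | h
  · exact Good.of_v L.symm (C.exchC (by omega) (by omega) (by omega) hk hk' hq' hq'' (C.per hi)
      (C.per' hi') (L.rel _) (L.symm (L.rel _))) (.inr (by abel))
  · exact Good.of_v L.symm (C.exchB (by omega) (by omega) (by omega) hq hq' hk' hk'' (C.per hi)
      (C.per' hi') (L.rel _) (L.symm (L.rel _))) (.inl rfl)

theorem turn_up (T : Tw R u v a b N f p₁ p₂ p₃ p₄) (h4 : Turn f u v p₄) :
    Good R u v a b ∨ Arc f (u (p₃ + b)) (v (p₃ + b)) := by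
  rcases T.swap.turn_right (turn_rev.2 h4.swap) with h | h
  · exact .inl h.swap
  · exact .inr (Cyc.arc_rev.1 h)

theorem turn_left (T : Tw R u v a b N f p₁ p₂ p₃ p₄) (h1 : Turn f u v p₁) :
    Good R u v a b ∨ Arc f (v (p₃ - a)) (u (p₃ - a)) := by
  rcases T.refl.turn_right (turn_rev.2 h1) with h | h
  · exact .inl (T.good_refl h)
  · exact .inr (by simpa [sub_eq_add_neg] using Cyc.arc_rev.1 h)

theorem turn_down (T : Tw R u v a b N f p₁ p₂ p₃ p₄) (h1 : Turn f u v p₁) :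
    Good R u v a b ∨ Arc f (v (p₂ - b)) (u (p₂ - b)) := by
  rcases T.refl.turn_up (turn_rev.2 h1) with h | h
  · exact .inl (T.good_refl h)
  · exact .inr (by simpa [sub_eq_add_neg] using Cyc.arc_rev.1 h)

end Tw

end RoseWindow

namespace RoseWindow

variable {M V : Type*} {R : V → V → Prop} [AddCommGroup M] {u v : M → V} {a b : M}
  {N : ℤ} {f : ℤ → V} {p₁ p₂ p₃ p₄ : M}

namespace Tw

theorem congr {p₁' p₂' p₃' p₄' : M} (T : Tw R u v a b N f p₁ p₂ p₃ p₄) (h₁ : p₁ = p₁')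
    (h₂ : p₂ = p₂') (h₃ : p₃ = p₃') (h₄ : p₄ = p₄') : Tw R u v a b N f p₁' p₂' p₃' p₄' := by
  subst h₁ h₂ h₃ h₄
  exact T

theorem swap' (T : Tw R v u b a N (fun i => f (-i)) p₁ p₃ p₂ p₄) :
    Tw R u v a b N f p₁ p₂ p₃ p₄ := by
  simpa using T.swap

theorem refl' (T : Tw R u v (-a) (-b) N (fun i => f (-i)) p₄ p₃ p₂ p₁) :
    Tw R u v a b N f p₁ p₂ p₃ p₄ := by
  simpa using T.refl

theorem step_up (T : Tw R u v a b N f p₁ p₂ p₃ p₄) (h4 : ¬Turn f u v p₄) :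
    Good R u v a b ∨ Tw R u v a b N f p₃ p₄ (p₃ + b) (p₄ + b) :=
  (T.swap.step_right fun h => h4 (turn_rev.1 h).swap).imp Good.swap swap'

theorem step_left (T : Tw R u v a b N f p₁ p₂ p₃ p₄) (h1 : ¬Turn f u v p₁) :
    Good R u v a b ∨ Tw R u v a b N f (p₁ - a) p₁ (p₃ - a) p₃ := by
  simp only [sub_eq_add_neg]
  exact (T.refl.step_right fun h => h1 (turn_rev.1 h)).imp T.good_refl refl'

theorem step_down (T : Tw R u v a b N f p₁ p₂ p₃ p₄) (h1 : ¬Turn f u v p₁) :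
    Good R u v a b ∨ Tw R u v a b N f (p₁ - b) (p₂ - b) p₁ p₂ := by
  simp only [sub_eq_add_neg]
  exact (T.refl.step_up fun h => h1 (turn_rev.1 h)).imp T.good_refl refl'

theorem step_diag_of_turn (T : Tw R u v a b N f p₁ p₂ p₃ p₄) (h1 : Turn f u v p₁)
    (h4 : Turn f u v p₄) :
    Good R u v a b ∨ Tw R u v a b N f (p₂ - b) (p₂ + a - b) p₂ (p₂ + a) := by
  have L := T.lay
  have C := T.cyc
  rcases T.turn_right h4 with h | hs
  · exact .inl h
  rcases T.turn_down h1 with h | hq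
  · exact .inl h
  have hzs : p₂ + a = p₂ + a - b + b := by abel
  have hzq : p₂ + a - b = p₂ - b + a := by abel
  by_cases hz : Turn f u v (p₂ + a - b)
  · left
    rcases hz with hz | hz
    · exact (L.swap.good_of_parallel' C hz hs hzs).swap
    · exact L.good_of_parallel' C hq hz hzq
  · have A : Arc f (u (p₂ - b)) (u (p₂ + a - b)) := by
      rcases L.cross_cases C hz with h | h
      · rw [show p₂ + a - b - a = p₂ - b by abel] at h
        exact h.1
      · rw [show p₂ + a - b - a = p₂ - b by abel] at h
        exact (L.u_ne_v _ _ (C.arc_left_unique h.2 hq)).elim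
    have B : Arc f (v (p₂ + a)) (v (p₂ + a - b)) := by
      rcases L.swap.cross_cases C (fun h => hz h.swap) with h | h
      · rw [← hzs] at h
        exact (L.u_ne_v _ _ (C.arc_left_unique hs h.2)).elim
      · rw [← hzs] at h
        exact h.1
    have S : Sq a b (p₂ - b) (p₂ + a - b) p₂ (p₂ + a) := ⟨by abel, by abel, by abel⟩
    rcases L.octagon C S A (.inl T.arc_right) (.inr T.arc_down) (.inr B) with h | h | h
    · exact .inl h
    · exact .inr ⟨L, C, S, h⟩
    · obtain ⟨i, p, q, r, _, _, _, _, _, _, _, _, e5, e6, e7, e8⟩ := h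
      exact (C.arc_asymm T.arc_down (Cyc.arc_rev.1 ⟨q, e5, e6⟩)).elim

theorem step_diag (T : Tw R u v a b N f p₁ p₂ p₃ p₄) :
    Good R u v a b ∨ Tw R u v a b N f (p₂ - b) (p₂ + a - b) p₂ (p₂ + a) := by
  by_cases h4 : Turn f u v p₄
  · by_cases h1 : Turn f u v p₁
    · exact T.step_diag_of_turn h1 h4
    · rcases T.step_down h1 with h | T'
      · exact .inl h
      · refine (T'.step_right T.not_turn₂).imp_right fun T' => T'.congr rfl ?_ rfl rfl
        abel
  · rcases T.step_right h4 with h | T'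
    · exact .inl h
    · exact T'.step_down T.not_turn₂

/-- The twisted squares propagate along `⟨a - b⟩`, keeping the types of their corners. -/
theorem diag (T : Tw R u v a b N f p₁ p₂ p₃ p₄) (hG : ¬Good R u v a b) (k : ℕ) :
    Tw R u v a b N f (p₁ + k • (a - b)) (p₂ + k • (a - b)) (p₃ + k • (a - b))
      (p₄ + k • (a - b)) ∧ (Turn f u v (p₁ + k • (a - b)) ↔ Turn f u v p₁) ∧
      (Turn f u v (p₄ + k • (a - b)) ↔ Turn f u v p₄) := by
  induction k with
  | zero => simpa using T
  | succ k ih =>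
    obtain ⟨ih, ih1, ih4⟩ := ih
    obtain ⟨s1, s2, s3⟩ := T.sq
    have T' := ih.step_diag.resolve_left hG
    have e1 : p₂ + k • (a - b) - b = p₁ + (k + 1) • (a - b) := by
      rw [s1, succ_nsmul]; abel
    have e4 : p₂ + k • (a - b) + a = p₄ + (k + 1) • (a - b) := by
      rw [s3, s1, succ_nsmul]; abel
    refine ⟨T'.congr e1 ?_ ?_ e4, ?_, ?_⟩
    · rw [succ_nsmul]; abel
    · rw [s1, s2, succ_nsmul]; abel
    · rw [← ih1, ← e1]
      constructor
      · intro h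
        have := T'.turn_left h |>.resolve_left hG
        rw [show p₂ + k • (a - b) - a = p₁ + k • (a - b) by rw [s1]; abel] at this
        exact .inr this
      · exact fun h => .inr (ih.turn_down h |>.resolve_left hG)
    · rw [← ih4, ← e4]
      constructor
      · intro h
        have := T'.turn_up h |>.resolve_left hG
        rw [show p₂ + k • (a - b) + b = p₄ + k • (a - b) by rw [s1, s3]; abel] at this
        exact .inl this
      · exact fun h => .inl (ih.turn_right h |>.resolve_left hG)

end Tw

end RoseWindow

namespace RoseWindow

variable {M V : Type*} {R : V → V → Prop} {u v : M → V}
  {N : ℤ} {f : ℤ → V} {p₁ p₂ p₃ p₄ : M}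

theorem Cyc.shift (C : Cyc R N f) {i j : ℤ} (h : f i = f j) (k : ℤ) : f (k + (j - i)) = f k := by
  rw [C.eq_iff, add_sub_cancel_left, ← C.eq_iff, h]

theorem Cyc.span_seven (f : ℤ → V) {i j k l m n o : ℤ} (h₁ : i < j) (h₂ : j < k) (h₃ : k < l)
    (h₄ : l < m) (h₅ : m < n) (h₆ : n < o) (h₇ : o < i + N) :
    Cyc.span f (i + 1) (i + 1 + N) = Cyc.span f (i + 1) (j + 1) + Cyc.span f (j + 1) (k + 1) +
      Cyc.span f (k + 1) (l + 1) + Cyc.span f (l + 1) (m + 1) + Cyc.span f (m + 1) (n + 1) +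
      Cyc.span f (n + 1) (o + 1) + Cyc.span f (o + 1) (i + N + 1) := by
  rw [Cyc.span_add f (by omega) (by omega), Cyc.span_add f (by omega) (by omega),
    Cyc.span_add f (by omega) (by omega), Cyc.span_add f (by omega) (by omega),
    Cyc.span_add f (by omega) (by omega), Cyc.span_add f (by omega) (by omega),
    add_right_comm i 1 N]

/-- The twisted pattern, with `u p₁` at a prescribed position. -/
theorem Twisted.at_one (C : Cyc R N f) (h : Twisted f N u v p₁ p₂ p₃ p₄) {i : ℤ}
    (hi : f i = u p₁) : ∃ p q r, i < p ∧ p < q ∧ q < r ∧ r < i + N ∧ f (i + 1) = u p₂ ∧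
      f p = u p₃ ∧ f (p + 1) = u p₄ ∧ f q = v p₄ ∧ f (q + 1) = v p₂ ∧ f r = v p₃ ∧
      f (r + 1) = v p₁ := by
  obtain ⟨j, p, q, r, h1, h2, h3, h4, e1, e2, e3, e4, e5, e6, e7, e8⟩ := h
  have key := C.shift (e1.trans hi.symm)
  refine ⟨p + (i - j), q + (i - j), r + (i - j), by omega, by omega, by omega, by omega, ?_⟩
  simp only [add_right_comm _ (i - j), *, and_true]
  rw [← e2, ← key (j + 1)]
  congr 1
  ring

/-- The twisted pattern, with `u p₃` at a prescribed position. -/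
theorem Twisted.at_three (C : Cyc R N f) (h : Twisted f N u v p₁ p₂ p₃ p₄) {i : ℤ}
    (hi : f i = u p₃) : ∃ q r p, i < q ∧ q < r ∧ r < p ∧ p < i + N ∧ f (i + 1) = u p₄ ∧
      f q = v p₄ ∧ f (q + 1) = v p₂ ∧ f r = v p₃ ∧ f (r + 1) = v p₁ ∧ f p = u p₁ ∧
      f (p + 1) = u p₂ := by
  obtain ⟨j, p, q, r, h1, h2, h3, h4, e1, e2, e3, e4, e5, e6, e7, e8⟩ := h
  have key := C.shift (e3.trans hi.symm)
  refine ⟨q + (i - p), r + (i - p), j + N + (i - p), by omega, by omega, by omega, by omega, ?_⟩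
  simp only [add_right_comm _ (i - p), *, C.add_period, C.per' e2, and_true]
  rw [← e4, ← key (p + 1)]
  congr 1
  ring

variable [AddCommGroup M] {a b : M}

theorem Tw.good_of_cross {q₀₀ q₀₁ q₀₂ q₁₁ q₁₂ q₁₃ q₂₂ q₂₃ q₂₄ : M}
    (T₀₁ : Tw R u v a b N f q₀₁ q₀₂ q₁₂ q₁₃) (T₁₁ : Tw R u v a b N f q₁₁ q₁₂ q₂₂ q₂₃)
    (T₀₀ : Tw R u v a b N f q₀₀ q₀₁ q₁₁ q₁₂) (T₁₂ : Tw R u v a b N f q₁₂ q₁₃ q₂₃ q₂₄) :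
    Good R u v a b := by
  have L := T₀₁.lay
  have C := T₀₁.cyc
  have ne₁ : q₁₂ ≠ q₂₂ := by
    rw [T₁₁.sq.1, T₁₁.sq.2.1, Ne, add_right_inj]
    exact L.ne
  have ne₂ : q₁₃ ≠ q₂₃ := by
    rw [T₁₂.sq.1, T₁₂.sq.2.1, Ne, add_right_inj]
    exact L.ne
  obtain ⟨i, p, D, E, a1, a2, a3, a4, i0, i1, hA, hA', hD, hD', hE, hE'⟩ := T₁₁.tw
  have i2 : f (i + 1 + 1) = u q₁₃ := C.pos_eq T₁₂.e₁ i1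
  have hD'' : f (D + 1 + 1) = v q₀₁ := C.pos_eq T₀₀.f₂ hD'
  obtain ⟨D', E', F, b1, b2, b3, b4, -, kD, -, kE, -, kF, kF'⟩ := T₀₀.tw.at_three C i0
  obtain rfl : D' = D + 1 := C.eq_of_lt (kD.trans hD'.symm) (by omega) (by omega)
  obtain rfl : E' = E + 1 := C.eq_of_lt (kE.trans hE'.symm) (by omega) (by omega)
  have hF : f (F + 1 + 1) = u q₀₂ := C.pos_eq T₀₁.e₁ kF'
  obtain ⟨X, D', F', c1, c2, c3, c4, -, hX, hX', lD, -, lF, -⟩ := T₀₁.tw.at_three C i1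
  obtain rfl : D' = D + 1 := C.eq_of_lt (lD.trans hD'.symm) (by omega) (by omega)
  obtain ⟨A', X', D', d1, d2, d3, d4, -, mA, -, -, mX, -, -⟩ := T₁₂.tw.at_one C i1
  have hA1 : A' = p + 1 := C.eq_of_lt (mA.trans hA'.symm) (by omega) (by omega)
  have hX1 : X' + 1 = X := C.eq_of_lt (mX.trans hX.symm) (by omega) (by omega)
  have hp : p ≠ i + 1 := by
    rintro rfl
    exact ne₁ (L.u_inj (i1.symm.trans hA))
  have hXD : X ≠ D := by
    rintro rfl
    exact ne₂ (L.v_inj (hX.symm.trans hD))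
  have hFN : F + 1 ≠ i + N := by
    intro h
    rw [h, C.add_period] at kF'
    have := L.u_inj (kF'.symm.trans i0)
    rw [T₀₀.sq.1, T₀₀.sq.2.1, add_right_inj] at this
    exact L.ne this
  refine Good.of_u L.symm ⟨_, ?_,
    ((((((C.segOfRev (show E < F + 1 by omega) hE' kF').join (L.symm (L.rel _))
      ((C.segPer (show F + 1 < i + N by omega) hF i0).reverse C.symm)).join (L.rel _)
      (C.segOf (show X < D by omega) hX' hD)).join (L.symm (L.rel _))
      (C.segOf (show p < X by omega) hA' hX)).join (L.symm (L.rel _))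
      (C.segOf (show i + 1 < p by omega) i2 hA)).join (L.rel _)
      (C.segOfRev (show D < E by omega) hD' hE)).join (L.symm (L.rel _))
      (C.segOf (show i < i + 1 by omega) i1 i1)⟩ (.inl T₀₁.sq.2.1)
  convert C.full (i + 1) using 1
  rw [Cyc.span_seven f (show i < i + 1 by omega) (show i + 1 < p by omega) (show p < X by omega)
    (show X < D by omega) (show D < E by omega) (show E < F + 1 by omega)
    (show F + 1 < i + N by omega)]
  abel

end RoseWindow

namespace RoseWindow

variable {M V : Type*} {R : V → V → Prop} [AddCommGroup M] {u v : M → V} {a b : M}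
  {N : ℤ} {f : ℤ → V}

/-- The cycle `f` winds through the rows `y + c a + ⟨a - b⟩`, `0 ≤ c ≤ n`, going up through the
`u`s and down through the `v`s. -/
structure Band (R : V → V → Prop) (u v : M → V) (a b : M) (N : ℤ) (f : ℤ → V) (n : ℕ) (y : M) :
    Prop where
  lay : IsLayer R u v a b
  cyc : Cyc R N f
  up : ∀ (z : ℤ) (c : ℕ), c < n →
    Arc f (u (y + z • (a - b) + c • a)) (u (y + z • (a - b) + (c + 1) • a))
  top : ∀ z : ℤ, Arc f (u (y + z • (a - b) + n • a)) (v (y + z • (a - b) + n • a))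
  down : ∀ (z : ℤ) (c : ℕ), c < n →
    Arc f (v (y + z • (a - b) + (c + 1) • a)) (v (y + (z + 1) • (a - b) + c • a))
  bot : ∀ z : ℤ, Arc f (v (y + z • (a - b))) (u (y + z • (a - b)))
  row : ∀ (z : ℤ) (c : ℕ), 0 < c → c ≤ n → c • a ≠ z • (a - b)

namespace Band

variable {n : ℕ} {y : M}

theorem pos_u (B : Band R u v a b N f n y) {i z : ℤ} (h : f i = u (y + z • (a - b))) (c : ℕ)
    (hc : c ≤ n) : f (i + c) = u (y + z • (a - b) + c • a) := by
  induction c with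
  | zero => simpa using h
  | succ c ih =>
    push_cast
    rw [← add_assoc]
    exact B.cyc.pos_eq (B.up z c (by omega)) (ih (by omega))

theorem pos_v (B : Band R u v a b N f n y) {i z : ℤ} (h : f i = u (y + z • (a - b))) (c : ℕ)
    (hc : c ≤ n) : f (i + n + 1 + c) = v (y + (z + c) • (a - b) + (n - c) • a) := by
  induction c with
  | zero => simpa using B.cyc.pos_eq (B.top z) (B.pos_u h n le_rfl)
  | succ c ih =>
    push_cast
    rw [← add_assoc, ← add_assoc]
    have := B.down (z + c) (n - (c + 1)) (by omega)
    rw [show n - (c + 1) + 1 = n - c by omega] at this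
    exact B.cyc.pos_eq this (ih (by omega))

theorem pos_next (B : Band R u v a b N f n y) {i z : ℤ} (h : f i = u (y + z • (a - b))) :
    f (i + (2 * n + 2)) = u (y + (z + n) • (a - b)) := by
  have := B.pos_v h n le_rfl
  rw [Nat.sub_self, zero_smul, add_zero] at this
  rw [← B.cyc.pos_eq (B.bot _) this]
  congr 1
  ring

theorem pos_zero (B : Band R u v a b N f n y) {i : ℤ} (h : f i = u y) (j : ℤ) :
    f (i + (2 * n + 2) * j) = u (y + (n * j) • (a - b)) := by
  induction j using Int.induction_on with
  | zero => simpa using h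
  | succ j ih =>
    convert B.pos_next ih using 2
    · ring
    · rw [mul_add, mul_one]
  | pred j ih =>
    obtain ⟨k, hk⟩ := B.cyc.surj (u (y + (n * (-(j : ℤ) - 1)) • (a - b)))
    have h1 := B.pos_next hk
    rw [show (n : ℤ) * (-(j : ℤ) - 1) + n = n * -(j : ℤ) by ring, ← ih] at h1
    have h2 := B.cyc.shift h1.symm (i + (2 * n + 2) * (-(j : ℤ) - 1))
    rw [← hk, ← h2]
    congr 1
    ring

theorem exists_pos (n : ℕ) (k : ℤ) : ∃ j : ℤ, ∃ c : ℕ, c ≤ n ∧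
    (k = (2 * n + 2) * j + c ∨ k = (2 * n + 2) * j + n + 1 + c) := by
  have h1 := Int.emod_nonneg k (show (2 * n + 2 : ℤ) ≠ 0 by omega)
  have h2 := Int.emod_lt_of_pos k (show (0 : ℤ) < 2 * n + 2 by omega)
  have h3 := Int.emod_add_mul_ediv k (2 * n + 2)
  obtain ⟨c, hc⟩ := Int.eq_ofNat_of_zero_le h1
  refine ⟨k / (2 * n + 2), ?_⟩
  rcases le_or_gt c n with h | h
  · exact ⟨c, h, .inl (by omega)⟩
  · exact ⟨c - (n + 1), by omega, .inr (by omega)⟩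

theorem exists_row (B : Band R u v a b N f n y) (w : M) :
    ∃ z : ℤ, ∃ c : ℕ, c ≤ n ∧ w = y + z • (a - b) + c • a := by
  obtain ⟨i, hi⟩ := B.cyc.surj (u y)
  obtain ⟨k, hk⟩ := B.cyc.surj (u w)
  obtain ⟨j, c, hc, h | h⟩ := exists_pos n (k - i)
  · have := B.pos_u (B.pos_zero hi j) c hc
    rw [show i + (2 * n + 2) * j + c = k by omega, hk] at this
    exact ⟨_, c, hc, B.lay.u_inj this⟩
  · have := B.pos_v (B.pos_zero hi j) c hc
    rw [show i + (2 * n + 2) * j + n + 1 + c = k by omega, hk] at this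
    exact (B.lay.u_ne_v _ _ this).elim

theorem pos_of_eq (B : Band R u v a b N f n y) {i : ℤ} (hi : f i = u y) {k z : ℤ}
    (hk : f (i + k) = u (y + z • (a - b))) :
    ∃ j : ℤ, k = (2 * n + 2) * j ∧ z • (a - b) = (n * j) • (a - b) := by
  obtain ⟨j, c, hc, h | h⟩ := exists_pos n k
  · have h1 := B.pos_u (B.pos_zero hi j) c hc
    rw [show i + (2 * n + 2) * j + c = i + k by omega, hk] at h1
    have h2 := B.lay.u_inj h1
    rw [add_assoc, add_right_inj] at h2
    rcases Nat.eq_zero_or_pos c with rfl | hc0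
    · exact ⟨j, by simpa using h, by simpa using h2⟩
    · exact (B.row (z - n * j) c hc0 hc (by rw [sub_smul, h2]; abel)).elim
  · have := B.pos_v (B.pos_zero hi j) c hc
    rw [show i + (2 * n + 2) * j + n + 1 + c = i + k by omega, hk] at this
    exact (B.lay.u_ne_v _ _ this).elim

theorem exists_inv (B : Band R u v a b N f n y) :
    ∃ j : ℤ, (n * j) • (a - b) = a - b := by
  obtain ⟨i, hi⟩ := B.cyc.surj (u y)
  obtain ⟨k, hk⟩ := B.cyc.surj (u (y + (1 : ℤ) • (a - b)))
  obtain ⟨j, -, h⟩ := B.pos_of_eq hi (k := k - i) (by rwa [add_sub_cancel])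
  exact ⟨j, by simpa using h.symm⟩

theorem length (B : Band R u v a b N f n y) : N = (2 * n + 2) * addOrderOf (a - b) := by
  obtain ⟨i, hi⟩ := B.cyc.surj (u y)
  obtain ⟨j, hj⟩ := B.exists_inv
  have hN : 0 ≤ N := by have := B.cyc.three_le; omega
  refine Int.dvd_antisymm hN (by positivity) ?_ ?_
  · have h1 := B.pos_zero hi (addOrderOf (a - b))
    rw [mul_smul, natCast_zsmul (a - b), addOrderOf_nsmul_eq_zero, smul_zero, add_zero,
      ← hi, B.cyc.eq_iff, add_sub_cancel_left] at h1
    exact h1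
  · obtain ⟨k, hk, h⟩ := B.pos_of_eq hi (k := N) (z := 0) (by
      rw [B.cyc.add_period, hi, zero_smul, add_zero])
    rw [hk]
    refine mul_dvd_mul_left _ (addOrderOf_dvd_iff_zsmul_eq_zero.2 ?_)
    rw [← hj, smul_smul, show k * (n * j) = j * (n * k) by ring, mul_smul, ← h, zero_smul,
      smul_zero]

end Band

theorem Full.of_card {s t : Multiset V} (ht : Full t) (hs : ∀ w, w ∈ s)
    (h : s.card ≤ t.card) : Full s := by
  rwa [← Multiset.eq_of_le_of_card_le ((Multiset.le_iff_subset ht.1).2 fun w _ => hs w) h]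

theorem Cyc.full_of_card (C : Cyc R N f) {s : Multiset V} (hs : ∀ w, w ∈ s) (h : s.card ≤ N) :
    Full s := by
  refine (C.full 0).of_card hs ?_
  simp only [span, Multiset.card_map, Finset.card_val, Int.card_Ico]
  omega

theorem Seg.iterate {g h : ℕ → V} {s : ℕ → Multiset V} (hs : ∀ j, Seg R (g j) (h j) (s j))
    (hR : ∀ j, R (h j) (g (j + 1))) (n : ℕ) :
    Seg R (g 0) (h n) (∑ j ∈ Finset.range (n + 1), s j) := by
  induction n with
  | zero => simpa using hs 0
  | succ n ih =>
    rw [Finset.sum_range_succ]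
    exact ih.join (hR n) (hs (n + 1))

end RoseWindow

namespace RoseWindow

theorem Cyc.finite {M V : Type*} {R : V → V → Prop} {u : M → V} {N : ℤ} {f : ℤ → V} (C : Cyc R N f)
    (hu : Function.Injective u) : Finite M := by
  have : Finite V := Set.finite_univ_iff.1 <|
    (((Finset.Ico 0 (0 + N)).finite_toSet.image f).subset fun w _ => by
      obtain ⟨i, h1, h2, h3⟩ := C.exists_between 0 w
      exact ⟨i, by simp; omega, h3⟩)
  exact Finite.of_injective u hu

variable {M V : Type*} {R : V → V → Prop} [AddCommGroup M] {u v : M → V} {a b : M}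
  {N : ℤ} {f : ℤ → V} {p₁ p₂ p₃ p₄ : M}

namespace Tw

theorem diag_int (T : Tw R u v a b N f p₁ p₂ p₃ p₄) (hG : ¬Good R u v a b) (k : ℤ) :
    Tw R u v a b N f (p₁ + k • (a - b)) (p₂ + k • (a - b)) (p₃ + k • (a - b))
      (p₄ + k • (a - b)) ∧ (Turn f u v (p₁ + k • (a - b)) ↔ Turn f u v p₁) ∧
      (Turn f u v (p₄ + k • (a - b)) ↔ Turn f u v p₄) := by
  have := T.cyc.finite T.lay.u_inj
  have h : 0 ≤ k % addOrderOf (a - b) := Int.emod_nonneg _ (by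
    exact_mod_cast (addOrderOf_pos (a - b)).ne')
  obtain ⟨n, hn⟩ := Int.eq_ofNat_of_zero_le h
  rw [← mod_addOrderOf_zsmul (a - b) k, hn]
  simpa using T.diag hG n

theorem good_of_not_turn (T : Tw R u v a b N f p₁ p₂ p₃ p₄) (h1 : ¬Turn f u v p₁)
    (h4 : ¬Turn f u v p₄) : Good R u v a b := by
  by_contra hG
  obtain ⟨s1, s2, s3⟩ := T.sq
  refine hG (T.good_of_cross
    ((T.diag_int hG (-1)).1.congr rfl ?_ rfl (p₄' := p₃ + b) ?_)
    ((T.step_left h1).resolve_left hG |>.congr rfl rfl ?_ rfl)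
    ((T.step_up h4).resolve_left hG))
  · rw [s1, s2]; module
  · rw [s2, s3]; module
  · rw [s2]; module

theorem band_two (T : Tw R u v a b N f p₁ p₂ p₃ p₄) (hG : ¬Good R u v a b)
    (h1 : Turn f u v p₁) (h4 : Turn f u v p₄) : Band R u v a b N f 2 p₁ := by
  obtain ⟨s1, s2, s3⟩ := T.sq
  have top : ∀ z : ℤ, Arc f (u (p₁ + z • (a - b) + 2 • a)) (v (p₁ + z • (a - b) + 2 • a)) := by
    intro z
    obtain ⟨Tz, -, hz⟩ := T.diag_int hG z
    convert (Tz.turn_right (hz.2 h4)).resolve_left hG using 2 <;> (rw [s1]; module)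
  have bot : ∀ z : ℤ, Arc f (v (p₁ + z • (a - b))) (u (p₁ + z • (a - b))) := by
    intro z
    obtain ⟨Tz, hz, -⟩ := T.diag_int hG z
    exact T.lay.turn_arc' T.cyc (hz.2 h1) Tz.e₁
  refine ⟨T.lay, T.cyc, fun z c hc => ?_, top, fun z c hc => ?_, bot, fun z c h0 hc h => ?_⟩
  · have Tz := (T.diag_int hG z).1
    interval_cases c
    · convert Tz.e₁ using 2
      · module
      · rw [s1]; module
    · convert Tz.arc_right using 2 <;> (rw [s1]; module)
  · interval_cases c
    · convert (T.diag_int hG z).1.arc_down using 2 <;> (rw [s1]; module)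
    · convert (T.diag_int hG (z + 1)).1.f₂ using 2
      · rw [s3]; module
      · rw [s1]; module
  · interval_cases c
    · refine T.not_turn₂ ?_
      rw [s1, show p₁ + a = p₁ + z • (a - b) by rw [← h, one_smul]]
      exact .inr (bot z)
    · have h2 := top 0
      rw [h, zero_smul, add_zero] at h2
      exact T.cyc.arc_asymm h2 (bot z)

theorem band_three (T : Tw R u v a b N f p₁ p₂ p₃ p₄) (hG : ¬Good R u v a b)
    (h1 : Turn f u v p₁) (h4 : ¬Turn f u v p₄) : Band R u v a b N f 3 p₁ := by
  obtain ⟨s1, s2, s3⟩ := T.sq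
  have T' := (T.step_right h4).resolve_left hG
  have h4' : Turn f u v (p₄ + a) := by
    by_contra h
    exact hG (T'.good_of_not_turn T.not_turn₂ h)
  have top : ∀ z : ℤ, Arc f (u (p₁ + z • (a - b) + 3 • a)) (v (p₁ + z • (a - b) + 3 • a)) := by
    intro z
    obtain ⟨Tz, -, hz⟩ := T'.diag_int hG z
    convert (Tz.turn_right (hz.2 h4')).resolve_left hG using 2 <;> (rw [s1]; module)
  have bot : ∀ z : ℤ, Arc f (v (p₁ + z • (a - b))) (u (p₁ + z • (a - b))) := by
    intro z
    obtain ⟨Tz, hz, -⟩ := T.diag_int hG z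
    exact T.lay.turn_arc' T.cyc (hz.2 h1) Tz.e₁
  refine ⟨T.lay, T.cyc, fun z c hc => ?_, top, fun z c hc => ?_, bot, fun z c h0 hc h => ?_⟩
  · interval_cases c
    · convert (T.diag_int hG z).1.e₁ using 2
      · module
      · rw [s1]; module
    · convert (T'.diag_int hG z).1.e₁ using 2 <;> (rw [s1]; module)
    · convert (T'.diag_int hG z).1.arc_right using 2 <;> (rw [s1]; module)
  · interval_cases c
    · convert (T.diag_int hG z).1.arc_down using 2 <;> (rw [s1]; module)
    · convert (T'.diag_int hG z).1.arc_down using 2 <;> (rw [s1]; module)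
    · convert (T'.diag_int hG (z + 1)).1.f₂ using 2
      · rw [s3]; module
      · rw [s1]; module
  · interval_cases c
    · refine T.not_turn₂ ?_
      rw [s1, show p₁ + a = p₁ + z • (a - b) by rw [← h, one_smul]]
      exact .inr (bot z)
    · refine T'.not_turn₂ ?_
      rw [s1, show p₁ + a + a = p₁ + z • (a - b) by rw [← h]; module]
      exact .inr (bot z)
    · have h2 := top 0
      rw [h, zero_smul, add_zero] at h2
      exact T.cyc.arc_asymm h2 (bot z)

end Tw

/-- The Hamilton path of a band with four rows. -/
theorem Band.good_of_three {y : M} (B : Band R u v a b N f 3 y) : Good R u v a b := by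
  have L := B.lay
  have := B.cyc.finite L.u_inj
  obtain ⟨n, hn⟩ := Nat.exists_eq_succ_of_ne_zero (addOrderOf_pos (a - b)).ne'
  have h0 : ((n : ℤ) + 1) • (a - b) = 0 := by
    have := addOrderOf_nsmul_eq_zero (a - b)
    rw [hn] at this
    exact_mod_cast this
  have hb : ∀ {i j : M}, i = j + b → R (v i) (v j) := by
    rintro i j rfl
    exact L.symm (L.rel_v _)
  have ha : ∀ {i j : M}, j = i + a → R (u i) (u j) := by
    rintro i j rfl
    exact L.rel_u _
  have s := fun {x : V} => Seg.single (R := R) x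
  have lower := Seg.iterate (R := R) (fun j => ((s.join
    (hb (i := y + a + (j : ℤ) • (a - b)) (j := y + ((j : ℤ) + 1) • (a - b)) (by module)) s).join
    (L.symm (L.rel _)) s).join (ha (j := y + ((j : ℤ) + 1) • (a - b) + a) rfl) s)
    (fun j => by
      convert L.rel (y + a + ((j : ℤ) + 1) • (a - b)) using 2
      · module
      · push_cast; rfl) n
  have upper := Seg.iterate (R := R) (fun j => ((s.join
    (ha (i := y + 2 • a + ((j : ℤ) + -1) • (a - b)) (j := y + 3 • a + ((j : ℤ) + -1) • (a - b))
      (by module)) s).join (L.rel _) s).join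
      (hb (j := y + 2 • a + (j : ℤ) • (a - b)) (by module)) s)
    (fun j => by
      push_cast
      rw [add_neg_cancel_right]
      exact L.symm (L.rel _)) n
  have path := (lower.reverse L.symm).join (L.symm (hb (by
    linear_combination (norm := module) h0))) (upper.reverse L.symm)
  have idx : ∀ z e : ℤ, ∃ j ∈ Finset.range (n + 1), z • (a - b) = ((j : ℤ) + e) • (a - b) := by
    intro z e
    obtain ⟨j, hj⟩ := Int.eq_ofNat_of_zero_le (Int.emod_nonneg (z - e) (b := n + 1) (by omega))
    have h1 := Int.emod_lt_of_pos (z - e) (show (0 : ℤ) < n + 1 by omega)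
    have h2 := Int.emod_add_mul_ediv (z - e) (n + 1)
    refine ⟨j, by simp; omega, ?_⟩
    have h3 : z = j + e + (z - e) / (n + 1) * (n + 1) := by
      have : (z - e) % (n + 1) = j := hj
      linarith
    nth_rw 1 [h3]
    rw [add_smul, mul_smul, h0, smul_zero, add_zero]
  refine Good.of_u L.symm ⟨_, B.cyc.full_of_card (fun w => ?_) ?_, path⟩ (.inl ?_)
  · rw [Multiset.mem_add, Multiset.mem_sum, Multiset.mem_sum]
    rcases L.cover w with ⟨i, rfl⟩ | ⟨i, rfl⟩ <;>
      obtain ⟨z, c, hc, rfl⟩ := B.exists_row i <;> interval_cases c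
    · obtain ⟨j, hj, h⟩ := idx z 1
      exact .inl ⟨j, hj, by simp [h]⟩
    · obtain ⟨j, hj, h⟩ := idx z 1
      exact .inl ⟨j, hj, by simp [h]⟩
    · obtain ⟨j, hj, h⟩ := idx z (-1)
      exact .inr ⟨j, hj, by simp [h, add_right_comm y]⟩
    · obtain ⟨j, hj, h⟩ := idx z (-1)
      exact .inr ⟨j, hj, by simp [h, add_right_comm y]⟩
    · obtain ⟨j, hj, h⟩ := idx z 1
      exact .inl ⟨j, hj, by simp [h]⟩
    · obtain ⟨j, hj, h⟩ := idx z 0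
      exact .inl ⟨j, hj, by simp [h, add_right_comm y]⟩
    · obtain ⟨j, hj, h⟩ := idx z 0
      exact .inr ⟨j, hj, by simp [h, add_right_comm y]⟩
    · obtain ⟨j, hj, h⟩ := idx z (-1)
      exact .inr ⟨j, hj, by simp [h, add_right_comm y]⟩
  · rw [B.length, hn]
    simp
    omega
  · push_cast
    linear_combination (norm := module) -h0

end RoseWindow

namespace RoseWindow

theorem Cyc.translate {V : Type*} {R : V → V → Prop} {N : ℤ} {f : ℤ → V} (C : Cyc R N f)
    (i : ℤ) : Cyc R N (fun k => f (i + k)) where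
  symm := C.symm
  three_le := C.three_le
  eq_iff {j k} := by rw [C.eq_iff, add_sub_add_left_eq_sub]
  surj w := by
    obtain ⟨k, hk⟩ := C.surj w
    exact ⟨k - i, by rw [add_sub_cancel, hk]⟩
  step k := by
    rw [← add_assoc]
    exact C.step (i + k)

variable {M V : Type*} {R : V → V → Prop} [AddCommGroup M] {u v : M → V} {a b : M}
  {N : ℤ} {f : ℤ → V} {ρ s : ℤ} {y : M}

/-- A band with three rows of length `2ρ + 1`, numbered from `u y`, which closes up with a shift
by `s`. -/
structure Grid (R : V → V → Prop) (u v : M → V) (a b : M) (f : ℤ → V) (ρ s : ℤ) (y : M) :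
    Prop where
  lay : IsLayer R u v a b
  cyc : Cyc R (12 * ρ + 6) f
  pos_u : ∀ j c : ℤ, 0 ≤ c → c ≤ 2 → f (6 * j + c) = u (y + (2 * j) • (a - b) + c • a)
  pos_v : ∀ j c : ℤ, 0 ≤ c → c ≤ 2 →
    f (6 * j + 3 + c) = v (y + (2 * j + c) • (a - b) + (2 - c) • a)
  period : (2 * ρ + 1) • (a - b) = 0
  shift : (3 : ℤ) • a + s • (a - b) = 0

namespace Grid

theorem uu (G : Grid R u v a b f ρ s y) {p q : ℤ} (j c j' c' α β : ℤ)
    (h : p = 6 * j + c ∧ q = 6 * j' + c' ∧ 0 ≤ c ∧ c ≤ 2 ∧ 0 ≤ c' ∧ c' ≤ 2 ∧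
      c' = c + 1 + 3 * α ∧ 2 * j' = 2 * j + α * s + β * (2 * ρ + 1)) : R (f p) (f q) := by
  obtain ⟨rfl, rfl, h1, h2, h3, h4, h5, h6⟩ := h
  rw [G.pos_u j c h1 h2, G.pos_u j' c' h3 h4, h5, h6]
  convert G.lay.rel_u _ using 2
  linear_combination (norm := module) α • G.shift + β • G.period

theorem vv (G : Grid R u v a b f ρ s y) {p q : ℤ} (j c j' c' α β : ℤ)
    (h : p = 6 * j + 3 + c ∧ q = 6 * j' + 3 + c' ∧ 0 ≤ c ∧ c ≤ 2 ∧ 0 ≤ c' ∧ c' ≤ 2 ∧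
      c = c' + 1 + 3 * α ∧ 2 * j' + c' + 1 = 2 * j + c + α * s + β * (2 * ρ + 1)) :
    R (f p) (f q) := by
  obtain ⟨rfl, rfl, h1, h2, h3, h4, h5, h6⟩ := h
  rw [G.pos_v j c h1 h2, G.pos_v j' c' h3 h4,
    show 2 * j' + c' = 2 * j + c + α * s + β * (2 * ρ + 1) - 1 by omega, h5]
  convert G.lay.rel_v _ using 2
  linear_combination (norm := module) α • G.shift + β • G.period

theorem uv (G : Grid R u v a b f ρ s y) {p q : ℤ} (j c j' c' α β : ℤ)
    (h : p = 6 * j + c ∧ q = 6 * j' + 3 + c' ∧ 0 ≤ c ∧ c ≤ 2 ∧ 0 ≤ c' ∧ c' ≤ 2 ∧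
      2 - c' = c + 3 * α ∧ 2 * j' + c' = 2 * j + α * s + β * (2 * ρ + 1)) :
    R (f p) (f q) := by
  obtain ⟨rfl, rfl, h1, h2, h3, h4, h5, h6⟩ := h
  rw [G.pos_u j c h1 h2, G.pos_v j' c' h3 h4, h5, h6]
  convert G.lay.rel _ using 2
  linear_combination (norm := module) α • G.shift + β • G.period

end Grid

theorem Cyc.span_eight (f : ℤ → V) {i j k l m n o p q : ℤ} (h₁ : i < j) (h₂ : j < k)
    (h₃ : k < l) (h₄ : l < m) (h₅ : m < n) (h₆ : n < o) (h₇ : o < p) (h₈ : p < q) :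
    Cyc.span f (i + 1) (q + 1) = Cyc.span f (i + 1) (j + 1) + Cyc.span f (j + 1) (k + 1) +
      Cyc.span f (k + 1) (l + 1) + Cyc.span f (l + 1) (m + 1) + Cyc.span f (m + 1) (n + 1) +
      Cyc.span f (n + 1) (o + 1) + Cyc.span f (o + 1) (p + 1) + Cyc.span f (p + 1) (q + 1) := by
  rw [Cyc.span_add f (by omega) (by omega), Cyc.span_add f (by omega) (by omega),
    Cyc.span_add f (by omega) (by omega), Cyc.span_add f (by omega) (by omega),
    Cyc.span_add f (by omega) (by omega), Cyc.span_add f (by omega) (by omega),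
    Cyc.span_add f (by omega) (by omega)]

namespace Grid

theorem good_even {σ : ℤ} (G : Grid R u v a b f ρ (2 * σ) y) (h1 : 0 < σ)
    (h2 : 2 * σ + 1 ≤ ρ) : Good R u v a b := by
  have L := G.lay
  have C := G.cyc
  have path := ((((((((C.segRev (show (6 * ρ + 12 * σ + 8 : ℤ) < 12 * ρ + 5 by omega)).join
      (G.vv (ρ + 2 * σ + 1) 0 (σ - 1) 2 (-1) (-1) (by omega))
      (C.seg' (show (6 * σ - 2 : ℤ) < 6 * σ + 2 by omega))).join
      (G.uu σ 2 0 0 (-1) 0 (by omega))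
      (C.seg' (show (-1 : ℤ) < 6 * σ - 2 by omega))).join
      (L.symm (G.uv (ρ + σ) 1 (σ - 1) 1 0 (-1) (by omega)))
      (C.segRev (show (6 * ρ - 1 : ℤ) < 6 * ρ + 6 * σ + 1 by omega))).join
      (L.symm (G.uu (ρ + σ) 2 ρ 0 (-1) 0 (by omega)))
      (C.seg' (show (6 * ρ + 6 * σ + 1 : ℤ) < 6 * ρ + 6 * σ + 6 by omega))).join
      (L.symm (G.uu (ρ + 2 * σ + 1) 2 (ρ + σ + 1) 0 (-1) 0 (by omega)))
      (C.segRev (show (6 * ρ + 6 * σ + 6 : ℤ) < 6 * ρ + 12 * σ + 8 by omega))).join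
      (G.uv (ρ + σ + 1) 1 σ 1 0 (-1) (by omega))
      (C.seg' (show (6 * σ + 3 : ℤ) < 6 * ρ - 1 by omega))).join
      (L.symm (G.vv σ 0 (ρ - 1) 2 (-1) 1 (by omega)))
      (C.seg' (show (6 * σ + 2 : ℤ) < 6 * σ + 3 by omega)))
  have e₁ := G.pos_v (2 * ρ) 2 (by omega) le_rfl
  have e₂ := G.pos_v σ 0 le_rfl (by omega)
  rw [show 6 * (2 * ρ) + 3 + 2 = 12 * ρ + 5 by ring] at e₁
  rw [show 6 * σ + 3 + 0 = 6 * σ + 3 by ring] at e₂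
  rw [e₁, e₂] at path
  refine Good.of_v L.symm ⟨_, ?_, path⟩ (.inr ?_)
  · convert C.full (-1 + 1) using 1
    rw [show -1 + 1 + (12 * ρ + 6) = 12 * ρ + 5 + 1 by ring,
      Cyc.span_eight f (show -1 < 6 * σ - 2 by omega) (show _ < 6 * σ + 2 by omega)
      (show _ < 6 * σ + 3 by omega) (show _ < 6 * ρ - 1 by omega)
      (show _ < 6 * ρ + 6 * σ + 1 by omega) (show _ < 6 * ρ + 6 * σ + 6 by omega)
      (show _ < 6 * ρ + 12 * σ + 8 by omega) (show _ < 12 * ρ + 5 by omega)]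
    abel
  · linear_combination (norm := module) (2 : ℤ) • G.period - G.shift

theorem good_odd {σ : ℤ} (G : Grid R u v a b f ρ (2 * σ + 1) y) (h1 : 0 ≤ σ)
    (h2 : 2 * σ + 2 ≤ ρ) : Good R u v a b := by
  have L := G.lay
  have C := G.cyc
  have path := ((((((((C.segRev (show (6 * ρ + 12 * σ + 14 : ℤ) < 12 * ρ + 5 by omega)).join
      (G.vv (ρ + 2 * σ + 2) 0 (ρ + σ) 2 (-1) 0 (by omega))
      (C.seg' (show (6 * ρ + 6 * σ + 4 : ℤ) < 6 * ρ + 6 * σ + 8 by omega))).join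
      (G.uu (ρ + σ + 1) 2 0 0 (-1) (-1) (by omega))
      (C.seg' (show (-1 : ℤ) < 6 * σ + 1 by omega))).join
      (G.uv σ 1 (ρ + σ) 1 0 1 (by omega))
      (C.segRev (show (6 * ρ - 1 : ℤ) < 6 * ρ + 6 * σ + 4 by omega))).join
      (L.symm (G.uu σ 2 ρ 0 (-1) 1 (by omega)))
      (C.seg' (show (6 * σ + 1 : ℤ) < 6 * σ + 6 by omega))).join
      (L.symm (G.uu (ρ + 2 * σ + 2) 2 (σ + 1) 0 (-1) (-1) (by omega)))
      (C.segRev (show (6 * ρ + 6 * σ + 9 : ℤ) < 6 * ρ + 12 * σ + 14 by omega))).join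
      (L.symm (G.uv (σ + 1) 1 (ρ + σ + 1) 1 0 1 (by omega)))
      (C.seg' (show (6 * σ + 6 : ℤ) < 6 * ρ - 1 by omega))).join
      (L.symm (G.vv (ρ + σ + 1) 0 (ρ - 1) 2 (-1) 0 (by omega)))
      (C.seg' (show (6 * ρ + 6 * σ + 8 : ℤ) < 6 * ρ + 6 * σ + 9 by omega)))
  have e₁ := G.pos_v (2 * ρ) 2 (by omega) le_rfl
  have e₂ := G.pos_v (ρ + σ + 1) 0 le_rfl (by omega)
  rw [show 6 * (2 * ρ) + 3 + 2 = 12 * ρ + 5 by ring] at e₁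
  rw [show 6 * (ρ + σ + 1) + 3 + 0 = 6 * ρ + 6 * σ + 9 by ring] at e₂
  rw [e₁, e₂] at path
  refine Good.of_v L.symm ⟨_, ?_, path⟩ (.inr ?_)
  · convert C.full (-1 + 1) using 1
    rw [show -1 + 1 + (12 * ρ + 6) = 12 * ρ + 5 + 1 by ring,
      Cyc.span_eight f (show -1 < 6 * σ + 1 by omega) (show _ < 6 * σ + 6 by omega)
      (show _ < 6 * ρ - 1 by omega) (show _ < 6 * ρ + 6 * σ + 4 by omega)
      (show _ < 6 * ρ + 6 * σ + 8 by omega) (show _ < 6 * ρ + 6 * σ + 9 by omega)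
      (show _ < 6 * ρ + 12 * σ + 14 by omega) (show _ < 12 * ρ + 5 by omega)]
    abel
  · linear_combination (norm := module) G.period - G.shift

theorem good_zero (G : Grid R u v a b f ρ 0 y) (h : 2 ≤ ρ) : Good R u v a b := by
  have L := G.lay
  have C := G.cyc
  have path := (((((((C.seg' (show (1 : ℤ) < 6 by omega)).join
      (L.symm (G.uu 1 2 1 0 (-1) 0 (by omega)))
      (C.segRev (show (6 : ℤ) < 8 by omega))).join
      (G.uv 1 1 (ρ + 1) 1 0 1 (by omega))
      (C.seg' (show (6 * ρ + 9 : ℤ) < 12 * ρ + 4 by omega))).join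
      (L.symm (G.uv ρ 1 (2 * ρ) 1 0 1 (by omega)))
      (C.seg' (show (6 * ρ : ℤ) < 6 * ρ + 4 by omega))).join
      (L.symm (G.uv (2 * ρ + 1) 1 ρ 1 0 (-1) (by omega)))
      (C.segRev (show (12 * ρ + 4 : ℤ) < 12 * ρ + 7 by omega))).join
      (L.symm (G.vv (ρ + 1) 0 (2 * ρ) 2 (-1) 1 (by omega)))
      (C.segRev (show (6 * ρ + 4 : ℤ) < 6 * ρ + 9 by omega))).join
      (L.symm (G.vv 1 0 ρ 2 (-1) 1 (by omega)))
      (C.seg' (show (8 : ℤ) < 6 * ρ by omega)))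
  have e₁ : f (1 + 1) = _ := G.pos_u 0 2 (by omega) le_rfl
  have e₂ := G.pos_u ρ 0 le_rfl (by omega)
  rw [add_zero] at e₂
  rw [e₁, e₂] at path
  refine Good.of_u L.symm ⟨_, ?_, path⟩ (.inl ?_)
  · convert C.full (1 + 1) using 1
    rw [Cyc.span_seven f (show 1 < 6 by omega) (show _ < 8 by omega)
      (show _ < 6 * ρ by omega) (show _ < 6 * ρ + 4 by omega)
      (show _ < 6 * ρ + 9 by omega) (show _ < 12 * ρ + 4 by omega)
      (show _ < 1 + (12 * ρ + 6) by omega),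
      show 1 + (12 * ρ + 6) = 12 * ρ + 7 by ring]
    abel
  · linear_combination (norm := module) G.period - G.shift

end Grid

end RoseWindow

namespace RoseWindow

variable {M V : Type*} {R : V → V → Prop} [AddCommGroup M] {u v : M → V} {a b : M}
  {N : ℤ} {f : ℤ → V} {ρ s : ℤ} {y : M}

namespace Band

theorem grid (B : Band R u v a b N f 2 y) (hr : (addOrderOf (a - b) : ℤ) = 2 * ρ + 1)
    (hs : (3 : ℤ) • a + s • (a - b) = 0) : ∃ g, Grid R u v a b g ρ s y := by
  obtain ⟨i, hi⟩ := B.cyc.surj (u y)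
  have hN := B.length
  rw [hr] at hN
  have hC := B.cyc.translate i
  rw [hN, show ((2 : ℕ) : ℤ) = 2 from rfl,
    show (2 * 2 + 2) * (2 * ρ + 1) = 12 * ρ + 6 by ring] at hC
  refine ⟨_, B.lay, hC, fun j c h0 h2 => ?_, fun j c h0 h2 => ?_, ?_, hs⟩
  · obtain ⟨c, rfl⟩ := Int.eq_ofNat_of_zero_le h0
    have := B.pos_u (B.pos_zero hi j) c (by omega)
    simpa [add_assoc] using this
  · obtain ⟨c, rfl⟩ := Int.eq_ofNat_of_zero_le h0
    have := B.pos_v (B.pos_zero hi j) c (by omega)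
    convert this using 2
    · push_cast
      ring
    · rw [← natCast_zsmul, Nat.cast_sub (by omega)]
      rfl
  · rw [← hr, natCast_zsmul, addOrderOf_nsmul_eq_zero]

theorem exists_shift (B : Band R u v a b N f 2 y) : ∃ ρ s : ℤ, 0 < ρ ∧
    (addOrderOf (a - b) : ℤ) = 2 * ρ + 1 ∧ (3 : ℤ) • a + s • (a - b) = 0 ∧ 0 ≤ s ∧
      s < 2 * ρ + 1 := by
  have := B.cyc.finite B.lay.u_inj
  have hpos := addOrderOf_pos (a - b)
  have hone : addOrderOf (a - b) ≠ 1 := by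
    rw [Ne, AddMonoid.addOrderOf_eq_one_iff, sub_eq_zero]
    exact B.lay.ne
  obtain ⟨j, hj⟩ := B.exists_inv
  have hd : (addOrderOf (a - b) : ℤ) ∣ 2 * j - 1 := by
    rw [addOrderOf_dvd_iff_zsmul_eq_zero, sub_smul, one_smul, sub_eq_zero]
    exact hj
  have hodd : (addOrderOf (a - b) : ℤ) % 2 = 1 := by
    by_contra h
    have h2 : (2 : ℤ) ∣ 2 * j - 1 := (show (2 : ℤ) ∣ addOrderOf (a - b) by omega).trans hd
    omega
  obtain ⟨z, c, hc, h⟩ := B.exists_row (y + 3 • a)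
  rw [add_assoc, add_right_inj] at h
  have h3 : (3 : ℤ) • a + (-z) • (a - b) = 0 := by
    interval_cases c
    · linear_combination (norm := module) h
    · refine (B.row z 2 (by omega) le_rfl ?_).elim
      linear_combination (norm := module) h
    · refine (B.row z 1 (by omega) (by omega) ?_).elim
      linear_combination (norm := module) h
  refine ⟨addOrderOf (a - b) / 2, -z % addOrderOf (a - b), by omega, by omega, ?_,
    Int.emod_nonneg _ (by omega), ?_⟩
  · rwa [mod_addOrderOf_zsmul]
  · have := Int.emod_lt_of_pos (-z) (show (0 : ℤ) < addOrderOf (a - b) by omega)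
    omega

theorem good_of_lt (B : Band R u v a b N f 2 y) (hr : (addOrderOf (a - b) : ℤ) = 2 * ρ + 1)
    (hs : (3 : ℤ) • a + s • (a - b) = 0) (h0 : 0 ≤ s) (h : s < ρ) : Good R u v a b := by
  obtain ⟨g, G⟩ := B.grid hr hs
  obtain ⟨σ, rfl | rfl⟩ := Int.even_or_odd' s
  · rcases h0.eq_or_lt with h1 | h1
    · obtain rfl : σ = 0 := by omega
      refine G.good_zero ?_
      by_contra h2
      obtain rfl : ρ = 1 := by omega
      refine G.lay.three ⟨?_, ?_⟩
      · linear_combination (norm := module) hs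
      · linear_combination (norm := module) hs - G.period
    · exact G.good_even (by omega) (by omega)
  · exact G.good_odd (by omega) (by omega)

end Band

/-- The Hamilton path of a layer with `b = -2a`. -/
theorem IsLayer.good_of_two_smul (L : IsLayer R u v a b) (C : Cyc R N f) (hab : 2 • a + b = 0)
    {n : ℕ} (hn : (6 * (n : ℤ) + 9) • a = 0) (hN : N = 12 * n + 18)
    (hrow : ∀ w, ∃ k : ℤ, w = y + k • a) : Good R u v a b := by
  have hu : ∀ {i j : M}, j = i + a → R (u i) (u j) := by
    rintro i j rfl
    exact L.rel_u _
  have hv : ∀ {i j : M}, i = j + b → R (v i) (v j) := by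
    rintro i j rfl
    exact L.symm (L.rel_v _)
  have hw : ∀ {i j : M}, i = j → R (u i) (v j) := by
    rintro i j rfl
    exact L.rel _
  have s := fun {x : V} => Seg.single (R := R) x
  have blocks := Seg.iterate (R := R) (fun j => (((((((((((s.join
    (hu (i := y + (6 * (j : ℤ) + 1) • a) (j := y + (6 * (j : ℤ) + 2) • a) (by module)) s).join
    (hw rfl) s).join
    (hv (j := y + (6 * (j : ℤ) + 4) • a) (by linear_combination (norm := module) -hab)) s).join
    (hv (j := y + (6 * (j : ℤ) + 6) • a) (by linear_combination (norm := module) -hab)) s).join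
    (L.symm (hw rfl)) s).join
    (L.symm (hu (i := y + (6 * (j : ℤ) + 5) • a) (by module))) s).join
    (L.symm (hu (i := y + (6 * (j : ℤ) + 4) • a) (by module))) s).join
    (L.symm (hu (i := y + (6 * (j : ℤ) + 3) • a) (by module))) s).join
    (hw rfl) s).join
    (hv (j := y + (6 * (j : ℤ) + 5) • a) (by linear_combination (norm := module) -hab)) s).join
    (hv (j := y + (6 * (j : ℤ) + 7) • a) (by linear_combination (norm := module) -hab)) s))
    (fun j => L.symm (hw (by push_cast; module))) n
  have path := (((((s.join
    (hu (i := y + (6 * (n : ℤ) + 7) • a) (j := y + (6 * (n : ℤ) + 8) • a) (by module)) s).join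
    (hw rfl) s).join
    (hv (j := y + a) (by linear_combination (norm := module) hn - hab)) s).join
    (L.symm (hw (by push_cast; module))) blocks).join
    (hv (j := y) (by linear_combination (norm := module) hn - hab)) s).join (L.symm (hw rfl)) s
  refine Good.of_u L.symm ⟨_, C.full_of_card (fun w => ?_) ?_, path⟩ (.inr ?_)
  · have red : ∀ k : ℤ, ∃ l : ℤ, 0 ≤ l ∧ l < 6 * n + 9 ∧ k • a = l • a := fun k => by
      refine ⟨k % (6 * n + 9), Int.emod_nonneg _ (by omega), Int.emod_lt_of_pos _ (by omega), ?_⟩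
      nth_rw 1 [← Int.emod_add_mul_ediv k (6 * n + 9)]
      rw [add_smul, mul_comm (6 * (n : ℤ) + 9), mul_smul, hn, smul_zero, add_zero]
    have split : ∀ l e : ℤ, 0 ≤ l - e → l - e < 6 * n + 6 →
        ∃ j ∈ Finset.range (n + 1), ∃ c : ℤ, 0 ≤ c ∧ c < 6 ∧ l = 6 * (j : ℤ) + (c + e) :=
      fun l e h1 h2 => by
        obtain ⟨j, hj⟩ := Int.eq_ofNat_of_zero_le (show 0 ≤ (l - e) / 6 by omega)
        exact ⟨j, by simp; omega, (l - e) % 6, by omega, by omega, by omega⟩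
    rcases L.cover w with ⟨i, rfl⟩ | ⟨i, rfl⟩ <;> obtain ⟨k, rfl⟩ := hrow i <;>
      obtain ⟨l, h0, h1, hk⟩ := red k <;> rw [hk]
    · obtain rfl | rfl | rfl | h : l = 0 ∨ l = 6 * n + 7 ∨ l = 6 * n + 8 ∨
          (0 ≤ l - 1 ∧ l - 1 < 6 * n + 6) := by omega
      · simp
      · simp
      · simp
      · obtain ⟨j, hj, c, hc, hc', rfl⟩ := split l 1 h.1 h.2
        simp only [Multiset.mem_add, Multiset.mem_sum]
        refine .inl (.inl (.inr ⟨j, hj, ?_⟩))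
        interval_cases c <;> simp
    · obtain rfl | rfl | rfl | h : l = 0 ∨ l = 1 ∨ l = 6 * n + 8 ∨
          (0 ≤ l - 2 ∧ l - 2 < 6 * n + 6) := by omega
      · simp
      · simp
      · simp
      · obtain ⟨j, hj, c, hc, hc', rfl⟩ := split l 2 h.1 h.2
        simp only [Multiset.mem_add, Multiset.mem_sum]
        refine .inl (.inl (.inr ⟨j, hj, ?_⟩))
        interval_cases c <;> simp
  · simp [hN]
    omega
  · linear_combination (norm := module) hn - hab

theorem Band.good_of_last (B : Band R u v a b N f 2 y)
    (hr : (addOrderOf (a - b) : ℤ) = 2 * ρ + 1) (hρ : 0 < ρ)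
    (hs : (3 : ℤ) • a + (2 * ρ) • (a - b) = 0) : Good R u v a b := by
  obtain ⟨g, G⟩ := B.grid hr hs
  obtain ⟨n, rfl⟩ : ∃ n : ℕ, ρ = n + 1 := ⟨(ρ - 1).toNat, by omega⟩
  have h3 : a - b = (3 : ℤ) • a := by
    linear_combination (norm := module) G.period - hs
  refine B.lay.good_of_two_smul (y := y) G.cyc (n := n) ?_ ?_ (by ring) fun w => ?_
  · linear_combination (norm := module) -h3
  · linear_combination (norm := module) G.period - (2 * (n : ℤ) + 3) • h3
  · obtain ⟨z, c, -, rfl⟩ := B.exists_row w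
    refine ⟨3 * z + c, ?_⟩
    linear_combination (norm := module) z • h3

theorem Band.good_of_two {g : ℤ → V} (B : Band R u v a b N f 2 y) {y' : M}
    (B' : Band R v u b a N g 2 y') : Good R u v a b := by
  obtain ⟨ρ, s, hρ, hr, hs, h0, h1⟩ := B.exists_shift
  have hr' : (addOrderOf (b - a) : ℤ) = 2 * ρ + 1 := by
    rw [← neg_sub, addOrderOf_neg, hr]
  have hp : (2 * ρ + 1) • (a - b) = 0 := by
    rw [← hr, natCast_zsmul, addOrderOf_nsmul_eq_zero]
  obtain h | rfl | rfl | ⟨h2, h3⟩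
      : s < ρ ∨ s = 2 * ρ ∨ s = 2 * ρ - 1 ∨ (ρ ≤ s ∧ s ≤ 2 * ρ - 2) := by
    omega
  · exact B.good_of_lt hr hs h0 h
  · exact B.good_of_last hr hρ hs
  · refine (B'.good_of_last hr' hρ ?_).swap
    linear_combination (norm := module) hs - (2 : ℤ) • hp
  · refine (B'.good_of_lt (s := 2 * ρ - 2 - s) hr' ?_ (by omega) (by omega)).swap
    linear_combination (norm := module) hs - hp

theorem Tw.good_of_turn {p₁ p₂ p₃ p₄ : M} (T : Tw R u v a b N f p₁ p₂ p₃ p₄)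
    (h1 : Turn f u v p₁) : Good R u v a b := by
  by_contra hG
  by_cases h4 : Turn f u v p₄
  · exact hG ((T.band_two hG h1 h4).good_of_two (T.swap.band_two (fun h => hG h.swap)
      (turn_rev.2 h1.swap) (turn_rev.2 h4.swap)))
  · exact hG (T.band_three hG h1 h4).good_of_three

theorem Tw.good {p₁ p₂ p₃ p₄ : M} (T : Tw R u v a b N f p₁ p₂ p₃ p₄) : Good R u v a b := by
  by_cases h1 : Turn f u v p₁
  · exact T.good_of_turn h1
  · by_cases h4 : Turn f u v p₄
    · exact T.good_refl (T.refl.good_of_turn (turn_rev.2 h4))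
    · exact T.good_of_not_turn h1 h4

end RoseWindow

namespace RoseWindow

variable {M V : Type*} {R : V → V → Prop} [AddCommGroup M] {u v : M → V} {a b : M}
  {N : ℤ} {f : ℤ → V}

namespace IsLayer

theorem good_of_arc (L : IsLayer R u v a b) (C : Cyc R N f) {p₁ p₂ p₃ p₄ : M}
    (hp : Sq a b p₁ p₂ p₃ p₄) (e₁ : Arc f (u p₁) (u p₂))
    (e₂ : Arc f (u p₃) (u p₄) ∨ Arc f (u p₄) (u p₃))
    (f₁ : Arc f (v p₁) (v p₃) ∨ Arc f (v p₃) (v p₁))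
    (f₂ : Arc f (v p₂) (v p₄) ∨ Arc f (v p₄) (v p₂)) : Good R u v a b := by
  rcases L.octagon C hp e₁ e₂ f₁ f₂ with h | h | h
  · exact h
  · exact Tw.good ⟨L, C, hp, h⟩
  · refine Good.neg_left (Tw.good ⟨L.neg_left, C.rev, ?_, h⟩) L.symm
    obtain ⟨rfl, rfl, rfl⟩ := hp
    exact ⟨by abel, rfl, by abel⟩

/-- A layer with a 4-hooked Hamilton cycle has a good system of paths. -/
theorem good_of_hooked (L : IsLayer R u v a b) (C : Cyc R N f) {p₁ p₂ p₃ p₄ : M}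
    (hp : Sq a b p₁ p₂ p₃ p₄) (e₁ : Arc f (u p₁) (u p₂) ∨ Arc f (u p₂) (u p₁))
    (e₂ : Arc f (u p₃) (u p₄) ∨ Arc f (u p₄) (u p₃))
    (f₁ : Arc f (v p₁) (v p₃) ∨ Arc f (v p₃) (v p₁))
    (f₂ : Arc f (v p₂) (v p₄) ∨ Arc f (v p₄) (v p₂)) : Good R u v a b := by
  rcases e₁ with e₁ | e₁
  · exact L.good_of_arc C hp e₁ e₂ f₁ f₂
  · refine L.good_of_arc C.rev hp (Cyc.arc_rev.2 e₁) ?_ ?_ ?_ <;>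
      rw [Cyc.arc_rev, Cyc.arc_rev, or_comm] <;> assumption

theorem exists_half (L : IsLayer R u v a b) {i j : M} (h : HamPath R (v i) (v j)) :
    ∃ q s t, Full (s + t) ∧ Half R (v i) (v j) (u q) (u (q + a)) s t := by
  obtain ⟨s, hs, l, hl, hx, hy, rfl⟩ := h
  have cut : ∀ {A B : List V} {p q : V}, l = A ++ B → A.getLast? = some p → B.head? = some q →
      Seg R (v i) p A ∧ Seg R (v j) q B ∧ R p q ∧ p ≠ q ∧ Full (A + B : Multiset V) := by
    rintro A B p q rfl hp hq
    have hc := List.isChain_append.1 hl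
    refine ⟨⟨A, hc.1, ?_, hp, rfl⟩, Seg.reverse L.symm ⟨B, hc.2.1, hq, ?_, rfl⟩,
      hc.2.2 p hp q hq, ?_, by simpa using hs⟩
    · rwa [List.head?_append_of_ne_nil _ (by rintro rfl; simp at hp)] at hx
    · rwa [List.getLast?_append_of_ne_nil _ (by rintro rfl; simp at hq)] at hy
    · rintro rfl
      exact List.disjoint_of_nodup_append (Multiset.coe_nodup.1 hs.1)
        (List.mem_of_getLast? hp) (List.mem_of_head? hq)
  obtain ⟨l₁, l₂, rfl⟩ := List.mem_iff_append.1 (Multiset.mem_coe.1 (hs.2 (u i)))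
  have n₁ : l₁ ≠ [] := by
    rintro rfl
    simp only [List.nil_append, List.head?_cons, Option.some.injEq] at hx
    exact L.u_ne_v _ _ hx
  have n₂ : l₂ ≠ [] := by
    rintro rfl
    simp only [List.getLast?_append, List.getLast?_singleton, Option.some_or,
      Option.some.injEq] at hy
    exact L.u_ne_v _ _ hy
  obtain ⟨l₁, p, rfl⟩ := (List.eq_nil_or_concat' l₁).resolve_left n₁
  obtain ⟨q, l₂, rfl⟩ := List.exists_cons_of_ne_nil n₂
  obtain ⟨s1, t1, r1, -, F1⟩ := cut (A := l₁ ++ [p]) (B := u i :: q :: l₂)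
    (p := p) rfl (by simp) rfl
  obtain ⟨s2, t2, r2, -, F2⟩ := cut (A := l₁ ++ [p] ++ [u i]) (B := q :: l₂) (p := u i) (by simp)
    (by simp) rfl
  rcases (L.u_adj _ _).1 (L.symm r1) with h | h | h <;>
    rcases (L.u_adj _ _).1 r2 with h' | h' | h' <;> subst h <;> subst h' <;>
    first
      | exact ⟨_, _, _, F2, .inl ⟨s2, t2⟩⟩
      | exact ⟨_, _, _, F1, .inr ⟨s1, t1⟩⟩
      | exact ⟨i - a, _, _, F1, .inl ⟨s1, by rwa [sub_add_cancel]⟩⟩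
      | exact ⟨i - a, _, _, F2, .inr ⟨by rwa [sub_add_cancel], t2⟩⟩
      | skip
  have := Multiset.coe_nodup.1 hs.1
  simp [List.nodup_append] at this

end IsLayer

end RoseWindow

namespace RoseWindow

/-- Two disjoint paths between `{x₁, x₂}` and `{x₃, x₄}` with vertices `s`. -/
def Linked {W : Type*} (S : W → W → Prop) (x₁ x₂ x₃ x₄ : W) (s : Multiset W) : Prop :=
  ∃ s₁ s₂, s = s₁ + s₂ ∧
    ((Seg S x₁ x₃ s₁ ∧ Seg S x₂ x₄ s₂) ∨ (Seg S x₁ x₄ s₁ ∧ Seg S x₂ x₃ s₂))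

/-- `S` has a Hamilton path with adjacent ends. -/
def HasClosedPath {W : Type*} (S : W → W → Prop) : Prop :=
  ∃ x y, HamPath S x y ∧ S y x

theorem Seg.map {V W : Type*} {R : V → V → Prop} {S : W → W → Prop} {g : V → W} {x y : V}
    {s : Multiset V} (hg : ∀ x y, R x y → S (g x) (g y)) (h : Seg R x y s) :
    Seg S (g x) (g y) (s.map g) := by
  obtain ⟨l, hl, hx, hy, rfl⟩ := h
  exact ⟨l.map g, (List.isChain_map g).2 (hl.imp hg), by simp [hx], by simp [hy], by simp⟩

theorem Half.map {V W : Type*} {R : V → V → Prop} {S : W → W → Prop} {g : V → W} {y y' p p' : V}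
    {s t : Multiset V} (hg : ∀ x y, R x y → S (g x) (g y)) (h : Half R y y' p p' s t) :
    Half S (g y) (g y') (g p) (g p') (s.map g) (t.map g) :=
  h.imp (fun h => ⟨h.1.map hg, h.2.map hg⟩) fun h => ⟨h.1.map hg, h.2.map hg⟩

theorem Full.eq_univ {V : Type*} [Fintype V] {s : Multiset V} (h : Full s) :
    s = Finset.univ.val :=
  (Multiset.Nodup.ext h.1 Finset.univ.nodup).2 fun w => by simp [h.2 w]

theorem Full.card_eq {V : Type*} [Fintype V] {s : Multiset V} (h : Full s) :
    s.card = Fintype.card V := by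
  rw [h.eq_univ]; rfl

theorem full_of_card_le {W : Type*} [Fintype W] {s : Multiset W} (h : ∀ w, w ∈ s)
    (hs : s.card ≤ Fintype.card W) : Full s := by
  have h1 : Finset.univ.val ≤ s :=
    (Multiset.le_iff_subset Finset.univ.nodup).2 fun w _ => h w
  rw [← Multiset.eq_of_le_of_card_le h1 hs]
  exact ⟨Finset.univ.nodup, fun w => Finset.mem_univ w⟩

namespace Linked

variable {W : Type*} {S : W → W → Prop} {x₁ x₂ x₃ x₄ : W} {s : Multiset W}

theorem symm (hS : ∀ {x y}, S x y → S y x) (h : Linked S x₁ x₂ x₃ x₄ s) :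
    Linked S x₃ x₄ x₁ x₂ s := by
  obtain ⟨s₁, s₂, rfl, h | h⟩ := h
  · exact ⟨_, _, rfl, .inl ⟨h.1.reverse hS, h.2.reverse hS⟩⟩
  · exact ⟨_, _, add_comm _ _, .inr ⟨h.2.reverse hS, h.1.reverse hS⟩⟩

theorem extend (hS : ∀ {x y}, S x y → S y x) (h : Linked S x₁ x₂ x₃ x₄ s) {y₁ y₂ z₁ z₂ : W}
    {t₁ t₂ : Multiset W} (h₁ : S x₁ y₁) (h₂ : S x₂ y₂) (H : Half S y₁ y₂ z₁ z₂ t₁ t₂) :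
    Linked S z₁ z₂ x₃ x₄ (s + (t₁ + t₂)) := by
  obtain ⟨s₁, s₂, rfl, h | h⟩ := h <;> rcases H with H | H
  · exact ⟨_, _, by abel, .inl ⟨(H.1.reverse hS).join (hS h₁) h.1,
      (H.2.reverse hS).join (hS h₂) h.2⟩⟩
  · exact ⟨_, _, by abel, .inr ⟨(H.2.reverse hS).join (hS h₂) h.2,
      (H.1.reverse hS).join (hS h₁) h.1⟩⟩
  · exact ⟨_, _, by abel, .inr ⟨(H.1.reverse hS).join (hS h₁) h.1,
      (H.2.reverse hS).join (hS h₂) h.2⟩⟩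
  · exact ⟨_, _, by abel, .inl ⟨(H.2.reverse hS).join (hS h₂) h.2,
      (H.1.reverse hS).join (hS h₁) h.1⟩⟩

theorem close (hS : ∀ {x y}, S x y → S y x) (h : Linked S x₁ x₂ x₃ x₄ s) (hs : Full s)
    (h₁ : S x₁ x₂) (h₂ : S x₃ x₄) : HasClosedPath S := by
  obtain ⟨s₁, s₂, rfl, h | h⟩ := h
  · exact ⟨_, _, ⟨_, hs, h.1.join h₂ (h.2.reverse hS)⟩, hS h₁⟩
  · exact ⟨_, _, ⟨_, hs, h.1.join (hS h₂) (h.2.reverse hS)⟩, hS h₁⟩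

end Linked

/-- The graph `S` on `{Uₓ} ∪ {V'ₓ}` consists of `d + 1` translates of the layer `R`,
consecutive ones joined by the edges `Uₓ V'ₓ₊ᵧ`, where `y = c`. -/
structure Chain {M A V W : Type*} [AddCommGroup M] [AddCommGroup A] [Fintype V] [Fintype W]
    (R : V → V → Prop) (u v : M → V) (S : W → W → Prop) (U V' : A → W) (ι : M →+ A)
    (T : A → V → W) (c : A) (d : ℕ) : Prop where
  symm : ∀ {x y}, S x y → S y x
  map_u : ∀ z i, T z (u i) = U (ι i + z)
  map_v : ∀ z i, T z (v i) = V' (ι i + z)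
  hom : ∀ z x y, R x y → S (T z x) (T z y)
  spoke : ∀ x, S (U x) (V' (x + c))
  surj : ∀ w, (∃ x, U x = w) ∨ ∃ x, V' x = w
  cover : ∀ x, ∃ j ≤ d, ∃ i, x = ι i + j • c
  card : (d + 1) * Fintype.card V ≤ Fintype.card W

namespace Chain

variable {M A V W : Type*} [AddCommGroup M] [AddCommGroup A] [Fintype V] [Fintype W]
  {R : V → V → Prop} {u v : M → V} {S : W → W → Prop} {U V' : A → W} {ι : M →+ A}
  {T : A → V → W} {c : A} {d : ℕ} {a b : M} {N : ℤ} {f : ℤ → V}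

theorem swap (G : Chain R u v S U V' ι T c d) : Chain R v u S V' U ι T (-c) d where
  symm := G.symm
  map_u := G.map_v
  map_v := G.map_u
  hom := G.hom
  spoke x := G.symm (by simpa using G.spoke (x + -c))
  surj w := (G.surj w).symm
  cover x := by
    obtain ⟨j, hj, i, h⟩ := G.cover (-x)
    refine ⟨j, hj, -i, ?_⟩
    rw [← neg_neg x, h, map_neg, smul_neg, neg_add]
  card := G.card

/-- `X` consists of the vertices of the layers `0, …, k`. -/
def Covers (_ : Chain R u v S U V' ι T c d) (k : ℕ) (X : Multiset W) : Prop :=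
  X.card = (k + 1) * Fintype.card V ∧
    ∀ j ≤ k, ∀ i, U (ι i + j • c) ∈ X ∧ V' (ι i + j • c) ∈ X

theorem mem_map (G : Chain R u v S U V' ι T c d) {s : Multiset V} (hs : Full s) {z : A} {q i : M}
    {k : ℕ} (hz : z = ι q + k • c) :
    U (ι i + k • c) ∈ s.map (T z) ∧ V' (ι i + k • c) ∈ s.map (T z) := by
  constructor
  · refine Multiset.mem_map.2 ⟨u (i - q), hs.2 _, ?_⟩
    rw [G.map_u, hz, map_sub]
    congr 1
    abel
  · refine Multiset.mem_map.2 ⟨v (i - q), hs.2 _, ?_⟩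
    rw [G.map_v, hz, map_sub]
    congr 1
    abel

theorem covers_zero (G : Chain R u v S U V' ι T c d) {s : Multiset V} (hs : Full s) :
    G.Covers 0 (s.map (T 0)) := by
  refine ⟨by simp [hs.card_eq], fun j hj i => ?_⟩
  obtain rfl := Nat.le_zero.1 hj
  exact G.mem_map (q := 0) hs (by simp)

theorem Covers.succ {G : Chain R u v S U V' ι T c d} {k : ℕ} {X : Multiset W}
    (h : G.Covers k X) {s : Multiset V} (hs : Full s) {z : A} {q : M}
    (hz : z = ι q + (k + 1) • c) : G.Covers (k + 1) (X + s.map (T z)) := by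
  refine ⟨?_, fun j hj i => ?_⟩
  · rw [Multiset.card_add, h.1, Multiset.card_map, hs.card_eq]
    ring
  · simp only [Multiset.mem_add]
    rcases hj.lt_or_eq with hj | rfl
    · exact (h.2 j (by omega) i).imp .inl .inl
    · exact (G.mem_map (i := i) hs hz).imp .inr .inr

theorem Covers.full {G : Chain R u v S U V' ι T c d} {X : Multiset W} (h : G.Covers d X) :
    Full X := by
  refine full_of_card_le (fun w => ?_) (h.1.trans_le G.card)
  rcases G.surj w with ⟨x, rfl⟩ | ⟨x, rfl⟩ <;> obtain ⟨j, hj, i, rfl⟩ := G.cover x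
  · exact (h.2 j hj i).1
  · exact (h.2 j hj i).2

theorem rel_U (G : Chain R u v S U V' ι T c d) (L : IsLayer R u v a b) (x : A) :
    S (U x) (U (x + ι a)) := by
  have := G.hom x _ _ (L.rel_u 0)
  rwa [G.map_u, G.map_u, map_zero, zero_add, zero_add, add_comm] at this

/-- Hamilton paths `vᵢ ~ vᵢ₊ₐ` of the layers can be assembled to a Hamilton cycle. -/
theorem closed_of_path (G : Chain R u v S U V' ι T c d) (L : IsLayer R u v a b) {p i : M}
    (hp : HamPath R (u p) (u (p + a))) (hi : HamPath R (v i) (v (i + a))) :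
    HasClosedPath S := by
  have key : ∀ k : ℕ, ∃ q X, G.Covers k X ∧ ∃ x, x = ι q + k • c ∧
      Seg S (U x) (U (x + ι a)) X := by
    intro k
    induction k with
    | zero =>
      obtain ⟨s, hs, h⟩ := hp
      refine ⟨p, _, G.covers_zero hs, _, rfl, ?_⟩
      simpa [G.map_u] using h.map (G.hom 0)
    | succ k ih =>
      obtain ⟨q, X, hX, x, hx, h⟩ := ih
      obtain ⟨r, s, t, hs, H⟩ := L.exists_half hi
      have hz : x + c - ι i = ι (q - i) + (k + 1) • c := by
        rw [hx, map_sub, succ_nsmul]; abel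
      refine ⟨r + q - i, _, hX.succ hs hz, ι r + (x + c - ι i), ?_, ?_⟩
      · rw [hz, map_sub, map_sub, map_add]; abel
      · have H' := H.map (G.hom (x + c - ι i))
        simp only [G.map_u, G.map_v, map_add, add_right_comm (ι _) (ι a)] at H'
        rw [add_sub_cancel, add_right_comm] at H'
        rw [Multiset.map_add]
        rcases H' with H' | H'
        · convert ((H'.1.reverse G.symm).join (G.symm (G.spoke _)) h).join (G.spoke _) H'.2 using 1
          abel
        · convert ((H'.2.reverse G.symm).join (G.symm (G.spoke _))
            (h.reverse G.symm)).join (G.spoke _) H'.1 using 1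
          abel
  obtain ⟨q, X, hX, x, -, h⟩ := key d
  exact ⟨_, _, ⟨X, hX.full, h⟩, G.symm (G.rel_U L x)⟩

/-- Pairs of paths `vᵢ ~ vᵢ₊ₐ`, `vᵢ₊ᵦ ~ vᵢ₊ₐ₊ᵦ` of the layers can be assembled to a Hamilton
cycle. -/
theorem closed_of_double (G : Chain R u v S U V' ι T c d) (L : IsLayer R u v a b) {p i : M}
    {s₀ : Multiset V} (hs₀ : Full s₀)
    (hp : Linked R (u p) (u (p + a)) (u (p + b)) (u (p + a + b)) s₀)
    (hi : Double R u v i (i + a) (i + b) (i + a + b)) : HasClosedPath S := by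
  have key : ∀ k : ℕ, ∃ q X, G.Covers k X ∧ ∃ x, x = ι q + k • c ∧
      Linked S (U x) (U (x + ι a)) (U (x + ι b)) (U (x + ι a + ι b)) X := by
    intro k
    induction k with
    | zero =>
      refine ⟨p, _, G.covers_zero hs₀, _, rfl, ?_⟩
      obtain ⟨s₁, s₂, rfl, h⟩ := hp
      refine ⟨_, _, Multiset.map_add _ _ _, ?_⟩
      refine h.imp (fun h => ?_) fun h => ?_ <;>
      · have h1 := h.1.map (G.hom 0)
        have h2 := h.2.map (G.hom 0)
        simp only [G.map_u, map_add, add_zero] at h1 h2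
        simp only [zero_smul, add_zero]
        exact ⟨h1, h2⟩
    | succ k ih =>
      obtain ⟨q, X, hX, x, hx, h⟩ := ih
      obtain ⟨s₁, s₂, s₃, s₄, hs, H₁, H₂⟩ := hi
      have hz : x + c - ι i = ι (q - i) + (k + 1) • c := by
        rw [hx, map_sub, succ_nsmul]; abel
      refine ⟨q, _, hX.succ hs hz, x + c, by rw [hx, succ_nsmul]; abel, ?_⟩
      have H₁' := H₁.map (G.hom (x + c - ι i))
      have H₂' := H₂.map (G.hom (x + c - ι i))
      simp only [G.map_u, G.map_v, map_add] at H₁' H₂'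
      have e0 : ι i + (x + c - ι i) = x + c := by abel
      have e1 : ι i + ι a + (x + c - ι i) = x + c + ι a := by abel
      have e2 : ι i + ι b + (x + c - ι i) = x + c + ι b := by abel
      have e3 : ι i + ι a + ι b + (x + c - ι i) = x + c + ι a + ι b := by abel
      rw [e0, e1] at H₁'
      rw [e2, e3] at H₂'
      have hc : ∀ y z, z = y + c → S (U y) (V' z) := by
        rintro y _ rfl
        exact G.spoke y
      have h1 := h.extend G.symm (hc _ _ rfl) (hc _ _ (by abel)) H₁'
      have h2 := (h1.symm G.symm).extend G.symm (hc _ _ (by abel)) (hc _ _ (by abel)) H₂'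
      convert h2.symm G.symm using 1
      simp only [Multiset.map_add]
      abel
  obtain ⟨q, X, hX, x, -, h⟩ := key d
  refine h.close G.symm hX.full (G.rel_U L x) ?_
  convert G.rel_U L (x + ι b) using 2
  abel

end Chain

namespace Cyc

variable {V : Type*} {R : V → V → Prop} {N : ℤ} {f : ℤ → V}

theorem hamPath_of_arc (C : Cyc R N f) {x y : V} (h : Arc f x y) : HamPath R x y := by
  obtain ⟨k, rfl, rfl⟩ := h
  refine ⟨_, C.full (k + 1), ?_⟩
  have h1 := C.segPer (l := k) (i := k) (by have := C.three_le; omega) rfl rfl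
  rw [add_right_comm] at h1
  exact h1.reverse C.symm

theorem linked_of_arc (C : Cyc R N f) {x₁ x₂ x₃ x₄ : V} (h : Arc f x₁ x₂)
    (h' : Arc f x₃ x₄ ∨ Arc f x₄ x₃) (h₃ : x₃ ≠ x₁) (h₄ : x₄ ≠ x₁) :
    ∃ s, Full s ∧ Linked R x₁ x₂ x₃ x₄ s := by
  obtain ⟨i, hi, hi'⟩ := h
  have key : ∀ {x y}, Arc f x y → x ≠ x₁ → ∃ s t, Full (s + t) ∧ Seg R x₁ y s ∧ Seg R x₂ x t := by
    intro x y h hx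
    obtain ⟨j, h1, h2, h3, h4⟩ := C.exists_arc hi h hx
    refine ⟨_, _, ?_, (C.segPer h2 h4 hi).reverse C.symm, C.segOf h1 hi' h3⟩
    rw [add_comm, span_add f (by omega) (by omega), add_right_comm]
    exact C.full _
  rcases h' with h | h
  · obtain ⟨s, t, hs, h1, h2⟩ := key h h₃
    exact ⟨_, hs, s, t, rfl, .inr ⟨h1, h2⟩⟩
  · obtain ⟨s, t, hs, h1, h2⟩ := key h h₄
    exact ⟨_, hs, s, t, rfl, .inl ⟨h1, h2⟩⟩

end Cyc

end RoseWindow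

namespace RoseWindow

/-- A chain of layers with a 4-hooked Hamilton cycle has a Hamilton cycle. -/
theorem Chain.closed_of_hooked {M A V W : Type*} [AddCommGroup M] [AddCommGroup A] [Fintype V]
    [Fintype W] {R : V → V → Prop} {u v : M → V} {S : W → W → Prop} {U V' : A → W} {ι : M →+ A}
    {T : A → V → W} {c : A} {d : ℕ} {a b : M} {N : ℤ} {f : ℤ → V}
    (G : Chain R u v S U V' ι T c d) (L : IsLayer R u v a b) (C : Cyc R N f) {p₁ p₂ p₃ p₄ : M}
    (hp : Sq a b p₁ p₂ p₃ p₄) (e₁ : Arc f (u p₁) (u p₂) ∨ Arc f (u p₂) (u p₁))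
    (e₂ : Arc f (u p₃) (u p₄) ∨ Arc f (u p₄) (u p₃))
    (f₁ : Arc f (v p₁) (v p₃) ∨ Arc f (v p₃) (v p₁))
    (f₂ : Arc f (v p₂) (v p₄) ∨ Arc f (v p₄) (v p₂)) : HasClosedPath S := by
  have path : ∀ {x y : V}, Arc f x y ∨ Arc f y x → HamPath R x y := by
    rintro x y (h | h)
    · exact C.hamPath_of_arc h
    · exact (C.hamPath_of_arc h).reverse C.symm
  have link : ∀ {x y z w : V}, Arc f x y ∨ Arc f y x → Arc f z w ∨ Arc f w z → z ≠ x → w ≠ x →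
      ∃ s, Full s ∧ Linked R x y z w s := by
    rintro x y z w (h | h) h' hz hw
    · exact C.linked_of_arc h h' hz hw
    · exact C.rev.linked_of_arc (Cyc.arc_rev.2 h)
        (h'.symm.imp Cyc.arc_rev.2 Cyc.arc_rev.2) hz hw
  have hgood := L.good_of_hooked C hp e₁ e₂ f₁ f₂
  obtain ⟨rfl, rfl, rfl⟩ := hp
  have ne : ∀ {x y : M}, x ≠ 0 → y + x ≠ y := fun hx h => hx (by simpa using h)
  have hab : a + b ≠ 0 := fun h => L.ne_neg (eq_neg_of_add_eq_zero_left h)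
  rcases hgood with ⟨i, h⟩ | ⟨i, h⟩ | ⟨i, h⟩ | ⟨i, h⟩
  · exact G.closed_of_path L (path e₁) h
  · exact G.swap.closed_of_path L.swap (path f₁) h
  · obtain ⟨s, hs, h'⟩ := link e₁ e₂ (fun h => ne L.swap.a_ne (L.u_inj h))
      (fun h => ne hab (by rw [← add_assoc]; exact L.u_inj h))
    exact G.closed_of_double L hs h' h
  · obtain ⟨s, hs, h'⟩ := link f₁ f₂ (fun h => ne L.a_ne (L.v_inj h))
      (fun h => ne hab (by rw [← add_assoc]; exact L.v_inj h))
    rw [add_right_comm p₁] at h'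
    rw [add_right_comm i] at h
    exact G.swap.closed_of_double L.swap hs h' h

open SimpleGraph

variable {V : Type*} {G : SimpleGraph V}

theorem isHamiltonian_of_hasClosedPath [Fintype V] [DecidableEq V] (hV : 3 ≤ Fintype.card V)
    (h : HasClosedPath G.Adj) : G.IsHamiltonian := by
  obtain ⟨x, y, ⟨_, hs, l, hl, hx, hy, rfl⟩, hyx⟩ := h
  have hne : l ≠ [] := by rintro rfl; simp at hx
  obtain ⟨p, hp⟩ : ∃ p : G.Walk x y, p.support = l := by
    have e1 : l.head hne = x := by
      rw [List.head?_eq_some_head hne] at hx; exact Option.some.inj hx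
    have e2 : l.getLast hne = y := by
      rw [List.getLast?_eq_some_getLast hne] at hy; exact Option.some.inj hy
    exact ⟨(Walk.ofSupport l hne hl).copy e1 e2, by simp⟩
  have hpath : p.IsPath := by
    rw [Walk.isPath_def, hp]; exact Multiset.coe_nodup.1 hs.1
  have hham : p.IsHamiltonian := hpath.isHamiltonian_of_mem fun w => by
    rw [hp]; exact hs.2 w
  intro _
  refine ⟨y, .cons hyx p, (Walk.cons_isCycle_iff _ _).2 ⟨hpath, fun h => ?_⟩, ?_⟩
  · rw [Sym2.eq_swap] at h
    have h1 := hpath.length_eq_one_of_mem_edges h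
    have := hham.length_eq
    omega
  · intro w
    simpa using hham w

theorem exists_cyc [Fintype V] [DecidableEq V] {w : V} {C : G.Walk w w}
    (hC : C.IsHamiltonianCycle) : ∃ (N : ℤ) (f : ℤ → V), Cyc G.Adj N f ∧
      ∀ x y, s(x, y) ∈ C.edges → Arc f x y ∨ Arc f y x := by
  have hlen : 3 ≤ C.length := hC.isCycle.three_le_length
  obtain ⟨n, hn⟩ : ∃ n, n = C.length := ⟨_, rfl⟩
  have hn0 : (n : ℤ) ≠ 0 := by omega
  have lt : ∀ i : ℤ, (i % n).toNat < n := fun i => by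
    have := Int.emod_lt_of_pos i (show (0 : ℤ) < n by omega)
    omega
  have nonneg : ∀ i : ℤ, 0 ≤ i % n := fun i => Int.emod_nonneg i hn0
  have step : ∀ i : ℤ, C.getVert ((i + 1) % n).toNat = C.getVert ((i % n).toNat + 1) := by
    intro i
    by_cases h : (i % n).toNat + 1 = n
    · have : (i + 1) % n = 0 := by
        rw [Int.add_emod, show i % n = n - 1 by have := nonneg i; omega,
          Int.emod_eq_of_lt (a := 1) (by omega) (by omega)]
        simp
      rw [this, h, hn]
      simp
    · have : (i + 1) % n = i % n + 1 := by
        rw [Int.add_emod, Int.emod_eq_of_lt (a := 1) (by omega) (by omega)]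
        exact Int.emod_eq_of_lt (by have := nonneg i; omega) (by have := lt i; omega)
      rw [this, Int.toNat_add (nonneg i) (by omega)]
      rfl
  have cast : ∀ k < n, C.getVert ((k : ℤ) % n).toNat = C.getVert k := fun k hk => by
    rw [Int.emod_eq_of_lt (by omega) (by omega), Int.toNat_natCast]
  refine ⟨n, fun i => C.getVert (i % n).toNat, ⟨fun h => h.symm, by omega, fun i j => ?_,
    fun x => ?_, fun i => ?_⟩, fun x y hxy => ?_⟩
  · rw [Int.dvd_iff_emod_eq_zero, ← Int.emod_eq_emod_iff_emod_sub_eq_zero]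
    refine ⟨fun h => ?_, fun h => by rw [h]⟩
    have := hC.isCycle.getVert_injOn' (by have := lt i; simp only [Set.mem_ofPred_eq]; omega)
      (by have := lt j; simp only [Set.mem_ofPred_eq]; omega) h
    have := nonneg i
    have := nonneg j
    omega
  · obtain ⟨k, hk, hk'⟩ := Walk.mem_support_iff_exists_getVert.1 (hC.mem_support x)
    rcases hk'.lt_or_eq with h | h
    · exact ⟨k, by rw [cast k (by omega), hk]⟩
    · refine ⟨0, ?_⟩
      rw [← hk, h]
      simp
  · rw [step]
    exact C.adj_getVert_succ (hn ▸ lt i)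
  · obtain ⟨k, hk, h⟩ := (Walk.mk_mem_edges_iff_exists C).1 hxy
    have arc : Arc (fun i : ℤ => C.getVert (i % n).toNat) (C.getVert k) (C.getVert (k + 1)) := by
      refine ⟨k, cast k (by omega), ?_⟩
      have := step k
      rwa [Int.emod_eq_of_lt (a := k) (by omega) (by omega), Int.toNat_natCast] at this
    rcases Sym2.eq_iff.1 h with ⟨rfl, rfl⟩ | ⟨rfl, rfl⟩
    · exact .inl arc
    · exact .inr arc

end RoseWindow

namespace RoseWindow

theorem exists_layers {A : Type*} [AddCommGroup A] [Finite A] {K : AddSubgroup A} {c : A}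
    (h : K ⊔ AddSubgroup.zmultiples c = ⊤) :
    ∃ d : ℕ, (∀ x, ∃ j ≤ d, ∃ k : K, x = k + j • c) ∧ (d + 1) * Nat.card K ≤ Nat.card A := by
  obtain ⟨n, hn⟩ : ∃ n, n = addOrderOf (c : A ⧸ K) := ⟨_, rfl⟩
  have hpos : 0 < n := hn ▸ addOrderOf_pos _
  have hmem : ∀ z : ℤ, (n : ℤ) ∣ z → z • c ∈ K := fun z hz => by
    rw [← QuotientAddGroup.eq_zero_iff, QuotientAddGroup.mk_zsmul]
    exact addOrderOf_dvd_iff_zsmul_eq_zero.1 (hn ▸ hz)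
  refine ⟨n - 1, fun x => ?_, ?_⟩
  · obtain ⟨k, hk, y, hy, rfl⟩ := AddSubgroup.mem_sup.1 (h ▸ AddSubgroup.mem_top x)
    obtain ⟨z, rfl⟩ := AddSubgroup.mem_zmultiples_iff.1 hy
    have h1 := Int.emod_nonneg z (show (n : ℤ) ≠ 0 by omega)
    have h2 := Int.emod_lt_of_pos z (show (0 : ℤ) < n by omega)
    refine ⟨(z % n).toNat, by omega,
      ⟨k + (z - z % n) • c, K.add_mem hk (hmem _ (Int.dvd_self_sub_emod))⟩, ?_⟩
    rw [← natCast_zsmul, Int.toNat_of_nonneg h1]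
    module
  · rw [Nat.sub_add_cancel hpos, AddSubgroup.card_eq_card_quotient_mul_card_addSubgroup K, hn]
    exact Nat.mul_le_mul_right _ addOrderOf_le_card

theorem natCast_gcd_mem {m : ℕ} (P : AddSubgroup (ZMod m)) {x y : ℕ} (hx : (x : ZMod m) ∈ P)
    (hy : (y : ZMod m) ∈ P) : ((Nat.gcd x y : ℕ) : ZMod m) ∈ P := by
  have h := congrArg (Int.cast : ℤ → ZMod m) (Nat.gcd_eq_gcd_ab x y)
  push_cast at h
  rw [h, mul_comm, mul_comm (y : ZMod m), ← zsmul_eq_mul, ← zsmul_eq_mul]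
  exact P.add_mem (P.zsmul_mem hx _) (P.zsmul_mem hy _)

variable {m : ℕ} {a b c : ZMod m}

/-- The indices of the vertices in the component of `u₀`. -/
abbrev idx (a b : ZMod m) : AddSubgroup (ZMod m) := AddSubgroup.closure {a, b}

theorem left_mem_idx : a ∈ idx a b := AddSubgroup.subset_closure (by simp)

theorem right_mem_idx : b ∈ idx a b := AddSubgroup.subset_closure (by simp)

theorem idx_sup_eq_top [NeZero m] (h : Nat.gcd m (Nat.gcd a.val (Nat.gcd b.val c.val)) = 1) :
    idx a b ⊔ AddSubgroup.zmultiples c = ⊤ := by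
  set P := idx a b ⊔ AddSubgroup.zmultiples c
  have hP : ∀ x ∈ P, ((x.val : ℕ) : ZMod m) ∈ P := fun x hx => by rwa [ZMod.natCast_zmod_val]
  have h1 := natCast_gcd_mem P (x := m) (by simp)
    (natCast_gcd_mem P (hP a (AddSubgroup.mem_sup_left left_mem_idx))
      (natCast_gcd_mem P (hP b (AddSubgroup.mem_sup_left right_mem_idx))
        (hP c (AddSubgroup.mem_sup_right (AddSubgroup.mem_zmultiples c)))))
  rw [h] at h1
  refine (AddSubgroup.eq_top_iff' P).2 fun x => ?_
  have := P.nsmul_mem h1 x.val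
  simpa using this

theorem not_three [NeZero m] (ha : a ≠ 0) (hb : b ≠ 0) (hab : a ≠ b) (hab' : a ≠ -b) :
    ¬(3 • a = 0 ∧ 3 • b = 0) := by
  rintro ⟨h, h'⟩
  have val : ∀ x : ZMod m, x ≠ 0 → 3 • x = 0 → 3 * x.val = m ∨ 3 * x.val = 2 * m := by
    intro x hx h
    have h1 := x.val_lt
    have h2 : x.val ≠ 0 := by rwa [Ne, ZMod.val_eq_zero]
    have h3 : m ∣ 3 * x.val := by
      rw [← ZMod.natCast_eq_zero_iff]
      simpa using h
    obtain ⟨k, hk⟩ := h3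
    have : k < 3 := by
      by_contra! hk3
      have := Nat.mul_le_mul_left m hk3
      omega
    interval_cases k <;> omega
  have sum : a.val + b.val = m → a = -b := fun h => by
    have := congrArg (Nat.cast : ℕ → ZMod m) h
    rw [Nat.cast_add, ZMod.natCast_zmod_val, ZMod.natCast_zmod_val, ZMod.natCast_self] at this
    exact eq_neg_of_add_eq_zero_left this
  rcases val a ha h with h1 | h1 <;> rcases val b hb h' with h2 | h2
  · exact hab (ZMod.val_injective m (by omega))
  · exact hab' (sum (by omega))
  · exact hab' (sum (by omega))
  · exact hab (ZMod.val_injective m (by omega))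

theorem roseWindow_adj_inl (i j : ZMod m) (ha : a ≠ 0) :
    (roseWindow m a b c).Adj (.inl i) (.inl j) ↔ j = i + a ∨ j = i - a := by
  simp only [roseWindow, bicirculant, SimpleGraph.fromRel_adj]
  constructor
  · rintro ⟨-, ⟨k, rfl | rfl, rfl⟩ | ⟨k, rfl | rfl, rfl⟩⟩ <;> simp [sub_eq_add_neg]
  · rintro (rfl | rfl)
    · exact ⟨by simpa using ha, .inl ⟨a, by simp, rfl⟩⟩
    · exact ⟨by simpa [sub_eq_add_neg] using ha, .inl ⟨-a, by simp, by ring⟩⟩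

theorem roseWindow_adj_inr (i j : ZMod m) (hb : b ≠ 0) :
    (roseWindow m a b c).Adj (.inr i) (.inr j) ↔ j = i + b ∨ j = i - b := by
  simp only [roseWindow, bicirculant, SimpleGraph.fromRel_adj]
  constructor
  · rintro ⟨-, ⟨k, rfl | rfl, rfl⟩ | ⟨k, rfl | rfl, rfl⟩⟩ <;> simp [sub_eq_add_neg]
  · rintro (rfl | rfl)
    · exact ⟨by simpa using hb, .inl ⟨b, by simp, rfl⟩⟩
    · exact ⟨by simpa [sub_eq_add_neg] using hb, .inl ⟨-b, by simp, by ring⟩⟩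

theorem roseWindow_adj_inl_inr (i j : ZMod m) :
    (roseWindow m a b c).Adj (.inl i) (.inr j) ↔ j = i ∨ j = i + c := by
  simp [roseWindow, bicirculant, SimpleGraph.fromRel_adj]

theorem rwH_adj_inl (i j : ZMod m) (ha : a ≠ 0) :
    (rwH m a b c).Adj (.inl i) (.inl j) ↔ j = i + a ∨ j = i - a := by
  simp [rwH, SimpleGraph.deleteEdges_adj, roseWindow_adj_inl i j ha]

theorem rwH_adj_inr (i j : ZMod m) (hb : b ≠ 0) :
    (rwH m a b c).Adj (.inr i) (.inr j) ↔ j = i + b ∨ j = i - b := by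
  simp [rwH, SimpleGraph.deleteEdges_adj, roseWindow_adj_inr i j hb]

theorem rwH_adj_inl_inr (i j : ZMod m) (hc : c ≠ 0) :
    (rwH m a b c).Adj (.inl i) (.inr j) ↔ j = i := by
  simp only [rwH, SimpleGraph.deleteEdges_adj, roseWindow_adj_inl_inr, Set.mem_ofPred_eq,
    Sym2.eq_iff, Sum.inl.injEq, Sum.inr.injEq, reduceCtorEq, and_false, or_false,
    not_exists, not_and]
  constructor
  · rintro ⟨rfl | rfl, h⟩
    · rfl
    · exact absurd rfl (h i rfl)
  · rintro rfl
    exact ⟨.inl rfl, fun x hx h => hc (by simpa [← hx] using h)⟩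

theorem rwH_adj_inr_inl (i j : ZMod m) (hc : c ≠ 0) :
    (rwH m a b c).Adj (.inr i) (.inl j) ↔ j = i := by
  rw [SimpleGraph.adj_comm, rwH_adj_inl_inr _ _ hc, eq_comm]

theorem mem_rwK_iff (ha : a ≠ 0) (hb : b ≠ 0) (hc : c ≠ 0) (x : ZMod m ⊕ ZMod m) :
    x ∈ rwK m a b c ↔ Sum.elim id id x ∈ idx a b := by
  have spoke : ∀ i, (rwH m a b c).Adj (.inl i) (.inr i) := fun i =>
    (rwH_adj_inl_inr _ _ hc).2 rfl
  simp only [rwK, SimpleGraph.ConnectedComponent.mem_supp_iff, SimpleGraph.ConnectedComponent.eq]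
  constructor
  · intro h
    induction (SimpleGraph.reachable_iff_reflTransGen _ _).1 h.symm with
    | refl => simp
    | @tail y z hy hyz ih =>
      have := ih ((SimpleGraph.reachable_iff_reflTransGen _ _).2 hy).symm
      rcases y with y | y <;> rcases z with z | z
      · rcases (rwH_adj_inl _ _ ha).1 hyz with rfl | rfl
        · exact add_mem this left_mem_idx
        · exact sub_mem this left_mem_idx
      · rwa [(rwH_adj_inl_inr _ _ hc).1 hyz]
      · rwa [(rwH_adj_inr_inl _ _ hc).1 hyz]
      · rcases (rwH_adj_inr _ _ hb).1 hyz with rfl | rfl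
        · exact add_mem this right_mem_idx
        · exact sub_mem this right_mem_idx
  · have key : ∀ i ∈ idx a b, ∀ j, (rwH m a b c).Reachable (.inl (j + i)) (.inl j) := by
      intro i hi
      induction hi using AddSubgroup.closure_induction with
      | mem x hx =>
        intro j
        rcases hx with rfl | rfl
        · exact ((rwH_adj_inl _ _ ha).2 (by simp)).reachable
        · exact (spoke _).reachable.trans ((((rwH_adj_inr _ _ hb).2 (by simp)).reachable).trans
            (spoke j).symm.reachable)
      | zero => intro j; rw [add_zero]
      | add x y _ _ hx hy =>
        intro j
        rw [← add_assoc]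
        exact (hy _).trans (hx j)
      | neg x _ hx =>
        intro j
        have := (hx (j + -x)).symm
        rwa [neg_add_cancel_right] at this
    intro h
    rcases x with x | x
    · have := key _ h 0
      rwa [zero_add] at this
    · have := key _ h 0
      rw [zero_add] at this
      exact (spoke x).symm.reachable.trans this

end RoseWindow

namespace RoseWindow

open SimpleGraph

variable {m : ℕ} {a b c : ZMod m}

theorem isLayer_rwH0 [NeZero m] (ha : a ≠ 0) (hb : b ≠ 0) (hc : c ≠ 0) (ha2 : 2 * a ≠ 0)
    (hb2 : 2 * b ≠ 0) (hab : a ≠ b) (hab' : a ≠ -b) {u v : idx a b → rwK m a b c}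
    (hu : ∀ i, (u i : ZMod m ⊕ ZMod m) = .inl i) (hv : ∀ i, (v i : ZMod m ⊕ ZMod m) = .inr i) :
    IsLayer (rwH0 m a b c).Adj u v ⟨a, left_mem_idx⟩ ⟨b, right_mem_idx⟩ where
  u_inj i j h := Subtype.ext (Sum.inl_injective (by rw [← hu, ← hu, h]))
  v_inj i j h := Subtype.ext (Sum.inr_injective (by rw [← hv, ← hv, h]))
  u_ne_v i j h := by
    have := congrArg Subtype.val h
    rw [hu, hv] at this
    exact Sum.inl_ne_inr this
  cover := by
    rintro ⟨x | x, hx⟩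
    · exact .inl ⟨⟨x, (mem_rwK_iff ha hb hc _).1 hx⟩, Subtype.ext (hu _)⟩
    · exact .inr ⟨⟨x, (mem_rwK_iff ha hb hc _).1 hx⟩, Subtype.ext (hv _)⟩
  u_adj := by
    rintro i ⟨x | x, hx⟩ <;>
      simp only [rwH0, SimpleGraph.comap_adj, Function.Embedding.subtype_apply,
      hu, hv, Subtype.ext_iff, rwH_adj_inl _ _ ha, rwH_adj_inl_inr _ _ hc] <;> simp
  v_adj := by
    rintro i ⟨x | x, hx⟩ <;>
      simp only [rwH0, SimpleGraph.comap_adj, Function.Embedding.subtype_apply,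
      hu, hv, Subtype.ext_iff, rwH_adj_inr _ _ hb, rwH_adj_inr_inl _ _ hc] <;> simp
  two_a h := ha2 (by rw [two_mul]; exact congrArg Subtype.val h)
  two_b h := hb2 (by rw [two_mul]; exact congrArg Subtype.val h)
  ne h := hab (congrArg Subtype.val h)
  ne_neg h := hab' (congrArg Subtype.val h)
  three h := not_three ha hb hab hab' ⟨congrArg Subtype.val h.1, congrArg Subtype.val h.2⟩

theorem card_rwK [NeZero m] [Fintype (rwK m a b c)] (ha : a ≠ 0) (hb : b ≠ 0) (hc : c ≠ 0) :
    Fintype.card (rwK m a b c) = 2 * Nat.card (idx a b) := by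
  have e : rwK m a b c = Sum.inl '' (idx a b : Set (ZMod m)) ∪ Sum.inr '' (idx a b : Set _) := by
    ext (x | x) <;> simp [mem_rwK_iff ha hb hc]
  rw [Fintype.card_eq_nat_card, Nat.card_coe_set_eq, e, Set.ncard_union_eq,
    Set.ncard_image_of_injective _ Sum.inl_injective,
    Set.ncard_image_of_injective _ Sum.inr_injective, ← two_mul, ← Nat.card_coe_set_eq]
  · rfl
  · rw [Set.disjoint_left]
    rintro _ ⟨x, -, rfl⟩ ⟨y, -, h⟩
    exact Sum.inr_ne_inl h

theorem chain_roseWindow [NeZero m] [Fintype (rwK m a b c)] (ha : a ≠ 0) (hb : b ≠ 0)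
    (hc : c ≠ 0) {u v : idx a b → rwK m a b c}
    (hu : ∀ i, (u i : ZMod m ⊕ ZMod m) = .inl i) (hv : ∀ i, (v i : ZMod m ⊕ ZMod m) = .inr i)
    {d : ℕ} (hd : ∀ x, ∃ j ≤ d, ∃ k : idx a b, x = k + j • c)
    (hd' : (d + 1) * Nat.card (idx a b) ≤ Nat.card (ZMod m)) :
    Chain (rwH0 m a b c).Adj u v (roseWindow m a b c).Adj .inl .inr (idx a b).subtype
      (fun z x => Sum.map (· + z) (· + z) x.1) c d where
  symm h := h.symm
  map_u z i := by rw [hu]; rfl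
  map_v z i := by rw [hv]; rfl
  hom := by
    rintro z ⟨x, hx⟩ ⟨y, hy⟩ h
    have h : (rwH m a b c).Adj x y := h
    have h : (roseWindow m a b c).Adj x y := SimpleGraph.deleteEdges_le _ h
    rcases x with x | x <;> rcases y with y | y
    · rw [roseWindow_adj_inl _ _ ha] at h
      refine (roseWindow_adj_inl _ _ ha).2 (h.imp ?_ ?_) <;> rintro rfl <;> ring
    · rw [roseWindow_adj_inl_inr] at h
      refine (roseWindow_adj_inl_inr _ _).2 (h.imp ?_ ?_) <;> rintro rfl <;> ring
    · rw [SimpleGraph.adj_comm, roseWindow_adj_inl_inr] at h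
      refine ((roseWindow_adj_inl_inr _ _).2 (h.imp ?_ ?_)).symm <;> rintro rfl <;> ring
    · rw [roseWindow_adj_inr _ _ hb] at h
      refine (roseWindow_adj_inr _ _ hb).2 (h.imp ?_ ?_) <;> rintro rfl <;> ring
  spoke x := (roseWindow_adj_inl_inr _ _).2 (.inr rfl)
  surj := by
    rintro (x | x)
    · exact .inl ⟨x, rfl⟩
    · exact .inr ⟨x, rfl⟩
  cover x := hd x
  card := by
    rw [card_rwK ha hb hc, Fintype.card_sum, ← two_mul, Fintype.card_eq_nat_card, mul_left_comm]
    exact Nat.mul_le_mul_left 2 hd'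

end RoseWindow

/-- The 4-hooked construction: if `a ≠ ±b`, `gcd(m,a,b) > 1` and `H_0` has a
Hamilton cycle containing the four edges `u_x u_{x+a}`, `u_{x+b} u_{x+a+b}`,
`v_x v_{x+b}`, `v_{x+a} v_{x+a+b}` for some vertex `u_x` of `H_0`, then the
connected `R(m;a,b,c)` is hamiltonian. -/
theorem roseWindow_four_hooked_construction (m : ℕ) [NeZero m] (hm : 3 ≤ m)
    (a b c : ZMod m) (ha : a ≠ 0) (hb : b ≠ 0) (hc : c ≠ 0)
    (ha2 : 2 * a ≠ 0) (hb2 : 2 * b ≠ 0) (hab : a ≠ b) (hab' : a ≠ -b)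
    (hgcd : Nat.gcd m (Nat.gcd a.val (Nat.gcd b.val c.val)) = 1)
    (hgcd2 : 1 < Nat.gcd m (Nat.gcd a.val b.val))
    (hcyc : ∃ (x : ZMod m), Sum.inl x ∈ rwK m a b c ∧
      ∃ (w : rwK m a b c) (C : (rwH0 m a b c).Walk w w),
        C.IsHamiltonianCycle ∧
        ∃ (h1 : Sum.inl x ∈ rwK m a b c) (h2 : Sum.inl (x + a) ∈ rwK m a b c)
          (h3 : Sum.inl (x + b) ∈ rwK m a b c) (h4 : Sum.inl (x + a + b) ∈ rwK m a b c)
          (h5 : Sum.inr x ∈ rwK m a b c) (h6 : Sum.inr (x + b) ∈ rwK m a b c)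
          (h7 : Sum.inr (x + a) ∈ rwK m a b c) (h8 : Sum.inr (x + a + b) ∈ rwK m a b c),
          s((⟨Sum.inl x, h1⟩ : rwK m a b c), (⟨Sum.inl (x + a), h2⟩ : rwK m a b c)) ∈ C.edges ∧
          s((⟨Sum.inl (x + b), h3⟩ : rwK m a b c), (⟨Sum.inl (x + a + b), h4⟩ : rwK m a b c)) ∈ C.edges ∧
          s((⟨Sum.inr x, h5⟩ : rwK m a b c), (⟨Sum.inr (x + b), h6⟩ : rwK m a b c)) ∈ C.edges ∧
          s((⟨Sum.inr (x + a), h7⟩ : rwK m a b c), (⟨Sum.inr (x + a + b), h8⟩ : rwK m a b c)) ∈ C.edges) :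
    (roseWindow m a b c).IsHamiltonian := by
  classical
  obtain ⟨x, -, w, C, hC, h1, h2, h3, h4, h5, h6, h7, h8, e₁, e₂, f₁, f₂⟩ := hcyc
  have := Fintype.ofFinite (rwK m a b c)
  have mem : ∀ {y}, y ∈ rwK m a b c ↔ Sum.elim id id y ∈ RoseWindow.idx a b := fun {y} =>
    RoseWindow.mem_rwK_iff ha hb hc y
  obtain ⟨d, hd, hd'⟩ := RoseWindow.exists_layers (RoseWindow.idx_sup_eq_top hgcd)
  let u : RoseWindow.idx a b → rwK m a b c := fun i => ⟨.inl i, mem.2 i.2⟩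
  let v : RoseWindow.idx a b → rwK m a b c := fun i => ⟨.inr i, mem.2 i.2⟩
  have G := RoseWindow.chain_roseWindow ha hb hc (u := u) (v := v) (fun _ => rfl) (fun _ => rfl)
    hd hd'
  have L := RoseWindow.isLayer_rwH0 ha hb hc ha2 hb2 hab hab' (u := u) (v := v) (fun _ => rfl)
    fun _ => rfl
  obtain ⟨N, f, hf, arc⟩ := RoseWindow.exists_cyc hC
  refine RoseWindow.isHamiltonian_of_hasClosedPath ?_ (G.closed_of_hooked L hf
    (p₁ := ⟨x, mem.1 h1⟩) ⟨rfl, rfl, rfl⟩ (arc _ _ e₁) (arc _ _ e₂) (arc _ _ f₁) (arc _ _ f₂))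
  rw [Fintype.card_sum, ZMod.card]
  omega
end

section
/- Let m ≥ 3 be an integer having at most three distinct prime divisors, and let S ⊆ ZMod m with 0 ∈ S and |S| ≥ 4. If the cyclic Haar graph H(m;S) = B(m;∅,S,∅) is connected (equivalently, the gcd of m together with the canonical integer representatives of the elements of S equals 1), then H(m;S) is Hamiltonian. -/
open SimpleGraph

/-- The cyclic Haar graph `H(m;S) = B(m;∅,S,∅)`. -/
def haarGraph (m : ℕ) (S : Set (ZMod m)) : SimpleGraph (ZMod m ⊕ ZMod m) :=
  bicirculant m ∅ S ∅

/-- A closed sequence of successively adjacent vertices, injective over one period of length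
`Fintype.card V`, makes the graph Hamiltonian. -/
theorem SimpleGraph.isHamiltonian_of_injOn_of_adj {V : Type*} [Fintype V] [DecidableEq V]
    {G : SimpleGraph V} (c : ℕ → V) (hcard : 3 ≤ Fintype.card V)
    (hinj : Set.InjOn c (Set.Iio (Fintype.card V))) (hadj : ∀ i, G.Adj (c i) (c (i + 1)))
    (hclosed : c (Fintype.card V) = c 0) : G.IsHamiltonian := by
  intro _
  set n := Fintype.card V with hn
  have key : ∀ u v : Fin n, (u - v).val = 1 → G.Adj (c v) (c u) := by
    intro u v h
    have hu : u.val = (v.val + 1) % n := by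
      have : NeZero n := ⟨by lia⟩
      have h1 : u = v + (u - v) := by abel
      rw [h1, Fin.val_add, h]
    rcases Nat.lt_or_ge (v.val + 1) n with h2 | h2
    · rw [hu, Nat.mod_eq_of_lt h2]
      exact hadj _
    · have h3 : v.val + 1 = n := by lia
      rw [hu, h3, Nat.mod_self, ← hclosed]
      simpa only [h3] using hadj v.val
  have hcont : cycleGraph n ⊑ G := by
    refine ⟨⟨⟨fun i ↦ c i, ?_⟩, ?_⟩⟩
    · intro a b hab
      rcases cycleGraph_adj'.mp hab with h | h
      · exact (key _ _ h).symm
      · exact key _ _ h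
    · intro a b hab
      exact Fin.ext (hinj a.2 b.2 hab)
  obtain ⟨v, p, hp, hlen⟩ := (cycleGraph_isContained_iff (by lia)).mp hcont
  exact ⟨v, p, Walk.isHamiltonianCycle_iff_isCycle_and_length_eq.mpr ⟨hp, hlen⟩⟩

theorem haarGraph_adj_inl_inr {m : ℕ} {S : Set (ZMod m)} {x y s : ZMod m} (hs : s ∈ S)
    (h : y = x + s) : (haarGraph m S).Adj (Sum.inl x) (Sum.inr y) := by
  simp only [haarGraph, bicirculant, fromRel_adj]
  exact ⟨by simp, Or.inl ⟨s, hs, h⟩⟩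

/-- A cyclic enumeration `w` of `ZMod m` whose steps have the form `β - γ i` with `β, γ i ∈ S`
gives a Hamiltonian cycle of the Haar graph. -/
theorem haarGraph_isHamiltonian_of_enumeration {m : ℕ} [NeZero m] (hm : 3 ≤ m)
    {S : Set (ZMod m)} (w γ : ℕ → ZMod m) {β : ZMod m} (hβ : β ∈ S) (hγ : ∀ i, γ i ∈ S)
    (hstep : ∀ i, w (i + 1) + γ i = w i + β) (hclosed : w m = w 0)
    (hinj : Set.InjOn w (Set.Iio m)) : (haarGraph m S).IsHamiltonian := by
  have hcard : Fintype.card (ZMod m ⊕ ZMod m) = 2 * m := by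
    rw [Fintype.card_sum, ZMod.card, two_mul]
  refine isHamiltonian_of_injOn_of_adj
    (fun i ↦ if i % 2 = 0 then Sum.inl (w (i / 2)) else Sum.inr (w (i / 2) + β))
    (by lia) ?_ ?_ ?_
  · rw [hcard]
    intro a ha b hb hab
    simp only [Set.mem_Iio] at ha hb
    have key : w (a / 2) = w (b / 2) → a / 2 = b / 2 := fun h ↦
      hinj (show a / 2 < m by lia) (show b / 2 < m by lia) h
    simp only at hab
    split_ifs at hab with h1 h2 h2
    · have := key (Sum.inl_injective hab)
      lia
    · have := key (add_right_cancel (Sum.inr_injective hab))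
      lia
  · intro i
    rcases Nat.mod_two_eq_zero_or_one i with h | h
    · have h1 : (i + 1) % 2 = 1 := by lia
      have h2 : (i + 1) / 2 = i / 2 := by lia
      simp only [h, h1, h2, if_true, one_ne_zero, if_false]
      exact haarGraph_adj_inl_inr hβ rfl
    · have h1 : (i + 1) % 2 = 0 := by lia
      have h2 : (i + 1) / 2 = i / 2 + 1 := by lia
      simp only [h, h1, h2, if_true, one_ne_zero, if_false]
      exact (haarGraph_adj_inl_inr (hγ (i / 2)) (hstep _).symm).symm
  · simp [hcard, hclosed]

/-- The number of `l < i` with `l % k < j`, in closed form, grows by one exactly at such `l`. -/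
theorem mul_div_add_min_mod_succ {k j : ℕ} (hk : 0 < k) (hj : j ≤ k) (i : ℕ) :
    j * ((i + 1) / k) + min ((i + 1) % k) j =
      j * (i / k) + min (i % k) j + if i % k < j then 1 else 0 := by
  have hr := Nat.mod_lt i hk
  have hi := Nat.div_add_mod i k
  rcases Nat.lt_or_ge (i % k + 1) k with h | h
  · obtain ⟨h1, h2⟩ := (Nat.div_mod_unique (a := i + 1) (d := i / k) (c := i % k + 1) hk).mpr
      ⟨by lia, h⟩
    rw [h1, h2]
    split_ifs <;> lia
  · obtain ⟨h1, h2⟩ := (Nat.div_mod_unique (a := i + 1) (d := i / k + 1) (c := 0) hk).mpr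
      ⟨by rw [mul_add]; lia, hk⟩
    rw [h1, h2, mul_add]
    split_ifs <;> lia

/-- If a Haar graph has offsets `X`, `Z` and `Z + k * a` modulo `k * n`, with `X - Z` prime to `k`
and `X - Z - j * a` prime to `n` for some `j ≤ k`, then it is Hamiltonian: the cycle steps
`k - j` times by `X - Z` and `j` times by `X - Z - k * a` in each block of `k` steps. -/
theorem haarGraph_isHamiltonian_of_isCoprime {m : ℕ} [NeZero m] (hm : 3 ≤ m)
    {S : Set (ZMod m)} {X Z a : ℤ} {k n j : ℕ} (hkn : m = k * n) (hj : j ≤ k)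
    (hX : (X : ZMod m) ∈ S) (hY : ((Z + k * a : ℤ) : ZMod m) ∈ S) (hZ : (Z : ZMod m) ∈ S)
    (hk : IsCoprime (X - Z) k) (hn : IsCoprime (X - Z - j * a) n) :
    (haarGraph m S).IsHamiltonian := by
  have hk0 : 0 < k := Nat.pos_of_ne_zero (by rintro rfl; lia)
  set t : ℕ → ℕ := fun i ↦ j * (i / k) + min (i % k) j with ht
  refine haarGraph_isHamiltonian_of_enumeration hm
    (fun i ↦ ((i * (X - Z) - k * a * t i : ℤ) : ZMod m))
    (fun i ↦ ((Z + k * a * (if i % k < j then 1 else 0) : ℤ) : ZMod m)) hX ?_ ?_ ?_ ?_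
  · intro i
    split_ifs
    · simpa using hY
    · simpa using hZ
  · intro i
    have h : (t (i + 1) : ℤ) = t i + if i % k < j then 1 else 0 := by
      have := mul_div_add_min_mod_succ hk0 hj i
      rw [ht]
      exact_mod_cast this
    rw [h, ← Int.cast_add, ← Int.cast_add]
    congr 1
    push_cast
    ring
  · have h0 : t 0 = 0 := by simp [ht]
    have hm' : t m = j * n := by simp [ht, hkn, Nat.mul_div_cancel_left n hk0]
    rw [h0, hm', ZMod.intCast_eq_intCast_iff_dvd_sub]
    refine ⟨j * a - (X - Z), ?_⟩
    rw [hkn]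
    push_cast
    ring
  · intro i hi i' hi' h
    simp only [Set.mem_Iio] at hi hi'
    dsimp only at h
    rw [ZMod.intCast_eq_intCast_iff_dvd_sub, hkn] at h
    push_cast at h
    have hmod : i % k = i' % k := by
      have h1 : (k : ℤ) ∣ (i' - i) * (X - Z) := by
        have h2 := (Dvd.intro _ rfl : (k : ℤ) ∣ k * n).trans h
        have h3 : (k : ℤ) ∣ k * (a * t i' - a * t i) := Dvd.intro _ rfl
        convert Int.dvd_add h2 h3 using 2
        ring
      have h2 := hk.symm.dvd_of_dvd_mul_right h1
      exact Nat.modEq_iff_dvd.mpr h2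
    have hi1 : (i : ℤ) = k * (i / k : ℕ) + (i % k : ℕ) := by
      exact_mod_cast (Nat.div_add_mod i k).symm
    have hi1' : (i' : ℤ) = k * (i' / k : ℕ) + (i' % k : ℕ) := by
      exact_mod_cast (Nat.div_add_mod i' k).symm
    have hdiv : (n : ℤ) ∣ (i' / k : ℕ) - (i / k : ℕ) := by
      refine hn.symm.dvd_of_dvd_mul_right ?_
      refine Int.dvd_of_mul_dvd_mul_left (a := (k : ℤ)) (by lia) ?_
      convert h using 2
      rw [hi1, hi1', ht]
      dsimp only
      rw [hmod]
      push_cast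
      ring
    have hq : i / k < n := Nat.div_lt_of_lt_mul (by lia)
    have hq' : i' / k < n := Nat.div_lt_of_lt_mul (by lia)
    have hqq : i / k = i' / k :=
      Nat.ModEq.eq_of_lt_of_lt (Nat.modEq_iff_dvd.mpr hdiv) hq hq'
    rw [← Nat.div_add_mod i k, ← Nat.div_add_mod i' k, hmod, hqq]

theorem Finset.exists_eq_insert_of_card_le_three {α : Type*} [DecidableEq α] {P : Finset α}
    (hne : P.Nonempty) (hP : P.card ≤ 3) : ∃ p q r, P = {p, q, r} := by
  have := hne.card_pos
  interval_cases h : P.card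
  · obtain ⟨p, rfl⟩ := Finset.card_eq_one.mp h
    exact ⟨p, p, p, by simp⟩
  · obtain ⟨p, q, -, rfl⟩ := Finset.card_eq_two.mp h
    exact ⟨p, q, q, by simp⟩
  · obtain ⟨p, q, r, -, -, -, rfl⟩ := Finset.card_eq_three.mp h
    exact ⟨p, q, r, rfl⟩

/-- Six consecutive terms of an arithmetic progression are not all divisible by one of at most
three primes which do not divide the common difference. -/
theorem exists_le_five_forall_not_dvd_sub_mul {P : Finset ℕ} (hP : P.card ≤ 3)
    (hprime : ∀ p ∈ P, p.Prime) (B a : ℤ) (ha : ∀ p ∈ P, ¬ (p : ℤ) ∣ a) :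
    ∃ j : ℕ, j ≤ 5 ∧ ∀ p ∈ P, ¬ (p : ℤ) ∣ B - j * a := by
  rcases P.eq_empty_or_nonempty with rfl | hne
  · exact ⟨0, by simp⟩
  obtain ⟨D, hD⟩ : ∃ D : ℕ → ℕ → Prop, ∀ p i, D p i ↔ (p : ℤ) ∣ B - i * a :=
    ⟨_, fun _ _ ↦ Iff.rfl⟩
  simp only [← hD]
  have hdiff : ∀ p ∈ P, ∀ i d : ℕ, D p i → D p (i + d) → p ∣ d := by
    intro p hp i d h1 h2
    rw [hD] at h1 h2
    have h3 : (p : ℤ) ∣ d * a := by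
      convert Int.dvd_sub h1 h2 using 2
      push_cast
      ring
    rcases (Nat.prime_iff_prime_int.mp (hprime p hp)).dvd_or_dvd h3 with h | h
    · exact_mod_cast h
    · exact absurd h (ha p hp)
  have hone : ∀ p ∈ P, ∀ i : ℕ, D p i → ¬ D p (i + 1) :=
    fun p hp i h1 h2 ↦ (hprime p hp).one_lt.ne' (Nat.dvd_one.mp (hdiff p hp i 1 h1 h2))
  have htwo : ∀ p ∈ P, ∀ i : ℕ, D p i → D p (i + 2) → p = 2 :=
    fun p hp i h1 h2 ↦ (Nat.prime_dvd_prime_iff_eq (hprime p hp) Nat.prime_two).mp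
      (hdiff p hp i 2 h1 h2)
  have hthree : ∀ p ∈ P, ∀ i : ℕ, D p i → D p (i + 3) → p = 3 :=
    fun p hp i h1 h2 ↦ (Nat.prime_dvd_prime_iff_eq (hprime p hp) Nat.prime_three).mp
      (hdiff p hp i 3 h1 h2)
  have hfour : ∀ p ∈ P, ∀ i : ℕ, D p i → D p (i + 4) → p = 2 :=
    fun p hp i h1 h2 ↦ (Nat.prime_dvd_prime_iff_eq (hprime p hp) Nat.prime_two).mp
      ((hprime p hp).dvd_of_dvd_pow (n := 2) (hdiff p hp i 4 h1 h2))
  have hfive : ∀ p ∈ P, ∀ i : ℕ, D p i → D p (i + 5) → p = 5 :=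
    fun p hp i h1 h2 ↦ (Nat.prime_dvd_prime_iff_eq (hprime p hp) Nat.prime_five).mp
      (hdiff p hp i 5 h1 h2)
  by_contra! hcon
  obtain ⟨p, q, r, rfl⟩ := Finset.exists_eq_insert_of_card_le_three hne hP
  have h0 := hcon 0 (by lia)
  have h1 := hcon 1 (by lia)
  have h2 := hcon 2 (by lia)
  have h3 := hcon 3 (by lia)
  have h4 := hcon 4 (by lia)
  have h5 := hcon 5 (by lia)
  clear hcon hdiff ha hD hprime
  simp only [Finset.mem_insert, Finset.mem_singleton, forall_eq_or_imp, forall_eq,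
    exists_eq_or_imp, exists_eq_left] at *
  grind (splits := 40)

/-- Two nonconstant functions on a set are separated by a common pair of points. -/
theorem Set.exists_ne_and_ne_of_not_constant {α β : Type*} {S : Set α} {f g : α → β}
    (hf : ∃ x ∈ S, ∃ y ∈ S, f x ≠ f y) (hg : ∃ x ∈ S, ∃ y ∈ S, g x ≠ g y) :
    ∃ x ∈ S, ∃ y ∈ S, f x ≠ f y ∧ g x ≠ g y := by
  grind

/-- If at most three functions are nonconstant on a set, then none of them is constant on some
triple of points. -/
theorem Set.exists_triple_of_not_constant {α ι β : Type*} [DecidableEq ι] {S : Set α}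
    (hS : S.Nonempty) {P : Finset ι} (hP : P.card ≤ 3) (f : ι → α → β)
    (hf : ∀ p ∈ P, ∃ x ∈ S, ∃ y ∈ S, f p x ≠ f p y) :
    ∃ x ∈ S, ∃ y ∈ S, ∃ z ∈ S, ∀ p ∈ P, ¬ (f p x = f p z ∧ f p y = f p z) := by
  rcases P.eq_empty_or_nonempty with rfl | hne
  · obtain ⟨x, hx⟩ := hS
    exact ⟨x, hx, x, hx, x, hx, by simp⟩
  obtain ⟨p, q, r, rfl⟩ := Finset.exists_eq_insert_of_card_le_three hne hP
  obtain ⟨x, hx, y, hy, hp, hq⟩ :=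
    Set.exists_ne_and_ne_of_not_constant (hf p (by simp)) (hf q (by simp))
  obtain ⟨z, hz, hr⟩ : ∃ z ∈ S, f r x ≠ f r z := by
    have := hf r (by simp)
    grind
  exact ⟨x, hx, y, hy, z, hz, by grind⟩

/-- The connection set of a connected Haar graph is not contained in a coset of a maximal
subgroup. -/
theorem haarGraph_exists_not_dvd_of_connected {m : ℕ} {S : Set (ZMod m)}
    (hconn : (haarGraph m S).Connected) {p : ℕ} (hp : p.Prime) (hpm : p ∣ m) :
    ∃ s ∈ S, ZMod.castHom hpm (ZMod p) s ≠ 0 := by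
  by_contra! h
  let φ : ZMod m ⊕ ZMod m → ZMod p := Sum.elim (ZMod.castHom hpm _) (ZMod.castHom hpm _)
  have hφ : ∀ x y, (haarGraph m S).Adj x y → φ x = φ y := by
    have key : ∀ i j, (∃ s ∈ S, j = i + s) → φ (Sum.inl i) = φ (Sum.inr j) := by
      rintro i j ⟨s, hs, rfl⟩
      simp only [φ, Sum.elim_inl, Sum.elim_inr, map_add, h s hs, add_zero]
    rintro (i | i) (j | j) hij <;> simp [haarGraph, bicirculant] at hij
    · exact key i j (by simpa using hij)
    · exact (key j i (by simpa using hij)).symm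
  have hwalk : ∀ x y, (haarGraph m S).Reachable x y → φ x = φ y := by
    rintro x y ⟨w⟩
    induction w with
    | nil => rfl
    | cons hadj _ ih => exact (hφ _ _ hadj).trans ih
  have h01 := hwalk _ _ (hconn.preconnected (Sum.inl 0) (Sum.inl 1))
  have : Fact p.Prime := ⟨hp⟩
  simp only [φ, Sum.elim_inl, map_zero, map_one, zero_ne_one] at h01

theorem haarGraph_isHamiltonian_of_gcd_eq_one {m : ℕ} [NeZero m] (hm : 3 ≤ m)
    {S : Set (ZMod m)} {X Z : ℤ} (hX : (X : ZMod m) ∈ S) (hZ : (Z : ZMod m) ∈ S)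
    (h : Int.gcd (X - Z) m = 1) : (haarGraph m S).IsHamiltonian :=
  haarGraph_isHamiltonian_of_isCoprime hm (X := X) (Z := Z) (a := 0) (k := m) (n := 1) (j := 0)
    (by simp) (by simp) hX (by simpa using hZ) hZ (Int.isCoprime_iff_gcd_eq_one.mpr h)
    (by simpa using isCoprime_one_right)

theorem haarGraph_isHamiltonian_of_five_le_gcd {m : ℕ} [NeZero m] (hm : 3 ≤ m)
    (hprimes : m.primeFactors.card ≤ 3) {S : Set (ZMod m)} {X Y Z : ℤ}
    (hX : (X : ZMod m) ∈ S) (hY : (Y : ZMod m) ∈ S) (hZ : (Z : ZMod m) ∈ S)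
    (hsep : ∀ p : ℕ, p.Prime → p ∣ m → ¬ ((p : ℤ) ∣ X - Z ∧ (p : ℤ) ∣ Y - Z))
    (hgcd : 5 ≤ Int.gcd (Y - Z) m) : (haarGraph m S).IsHamiltonian := by
  obtain ⟨a, n, hcop, ha, hn⟩ : ∃ a n : ℤ, Int.gcd a n = 1 ∧
      Y - Z = a * Int.gcd (Y - Z) m ∧ (m : ℤ) = n * Int.gcd (Y - Z) m :=
    Int.exists_gcd_one (by lia)
  set k := Int.gcd (Y - Z) m with hk
  lift n to ℕ using by nlinarith
  have hkn : m = k * n := by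
    rw [mul_comm]
    exact_mod_cast hn
  have hcoprime : ∀ {b : ℤ} {l : ℕ}, (∀ p : ℕ, p.Prime → p ∣ l → ¬ (p : ℤ) ∣ b) →
      IsCoprime b l := by
    intro b l h
    rw [Int.isCoprime_iff_gcd_eq_one]
    by_contra hne
    obtain ⟨p, hp, hpd⟩ := Nat.exists_prime_and_dvd hne
    refine h p hp ?_ (Int.dvd_trans (by exact_mod_cast hpd) (Int.gcd_dvd_left _ _))
    have := Int.dvd_trans (Int.natCast_dvd_natCast.mpr hpd) (Int.gcd_dvd_right b l)
    exact_mod_cast this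
  have hnm : n.primeFactors ⊆ m.primeFactors := Nat.primeFactors_mono ⟨k, by lia⟩ (NeZero.ne m)
  obtain ⟨j, hj, hjn⟩ := exists_le_five_forall_not_dvd_sub_mul (P := n.primeFactors)
    ((Finset.card_le_card hnm).trans hprimes) (fun p ↦ Nat.prime_of_mem_primeFactors) (X - Z) a
    (by
      intro p hp hpa
      have h1 : (p : ℤ) ∣ n := by exact_mod_cast Nat.dvd_of_mem_primeFactors hp
      have h2 := Int.dvd_coe_gcd hpa h1
      rw [hcop] at h2
      exact (Nat.prime_of_mem_primeFactors hp).one_lt.ne' (Nat.dvd_one.mp (by exact_mod_cast h2)))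
  have hn0 : n ≠ 0 := by rintro rfl; lia
  refine haarGraph_isHamiltonian_of_isCoprime hm (X := X) (Z := Z) (a := a) hkn
    (hj.trans hgcd) hX ?_ hZ (hcoprime ?_) (hcoprime ?_)
  · rwa [mul_comm, ← ha, add_sub_cancel]
  · intro p hp hpk hpX
    refine hsep p hp (hpk.trans ⟨n, hkn⟩) ⟨hpX, ?_⟩
    rw [ha]
    exact dvd_mul_of_dvd_right (by exact_mod_cast hpk) _
  · intro p hp hpn
    exact hjn p (Nat.mem_primeFactors.mpr ⟨hp, hpn, hn0⟩)

/-- Of three pairwise coprime natural numbers, either some is at most `1` or some is at least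
`5`. -/
theorem Nat.exists_five_le_of_pairwise_coprime {k l n : ℕ} (hk : 2 ≤ k) (hl : 2 ≤ l) (hn : 2 ≤ n)
    (hkl : k.Coprime l) (hkn : k.Coprime n) (hln : l.Coprime n) : 5 ≤ k ∨ 5 ≤ l ∨ 5 ≤ n := by
  by_contra! h
  obtain ⟨h1, h2, h3⟩ := h
  interval_cases k <;> interval_cases l <;> interval_cases n <;> revert hkl hkn hln <;> decide

/-- A connected cyclic Haar graph `H(m;S)` with `|S| ≥ 4` and `m` a product of at
most three prime powers is hamiltonian. -/
theorem haarGraph_isHamiltonian_of_card_ge_four (m : ℕ) [NeZero m] (hm : 3 ≤ m)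
    (hprimes : m.primeFactors.card ≤ 3)
    (S : Set (ZMod m)) (h0S : (0 : ZMod m) ∈ S) (hS : 4 ≤ S.ncard)
    (hconn : (haarGraph m S).Connected) :
    (haarGraph m S).IsHamiltonian := by
  obtain ⟨x, hx, y, hy, z, hz, hsep⟩ := Set.exists_triple_of_not_constant ⟨0, h0S⟩ hprimes
    (fun p s ↦ s.val % p) (by
      intro p hp
      have hpm := Nat.dvd_of_mem_primeFactors hp
      obtain ⟨s, hs, hne⟩ := haarGraph_exists_not_dvd_of_connected hconn
        (Nat.prime_of_mem_primeFactors hp) hpm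
      refine ⟨s, hs, 0, h0S, fun h ↦ hne ?_⟩
      rw [ZMod.castHom_apply, ZMod.cast_eq_val, ZMod.natCast_eq_zero_iff]
      exact Nat.dvd_of_mod_eq_zero (by simpa using h))
  have hcast : ∀ s : ZMod m, ((s.val : ℤ) : ZMod m) = s := by simp
  rw [← hcast x] at hx
  rw [← hcast y] at hy
  rw [← hcast z] at hz
  have hsep' : ∀ p : ℕ, p.Prime → p ∣ m →
      ¬ ((p : ℤ) ∣ x.val - z.val ∧ (p : ℤ) ∣ y.val - z.val) := by
    rintro p hp hpm ⟨h1, h2⟩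
    exact hsep p (Nat.mem_primeFactors.mpr ⟨hp, hpm, NeZero.ne m⟩)
      ⟨(Nat.modEq_iff_dvd.mpr h1).symm, (Nat.modEq_iff_dvd.mpr h2).symm⟩
  generalize (x.val : ℤ) = X at *
  generalize (y.val : ℤ) = Y at *
  generalize (z.val : ℤ) = Z at *
  have hcop : ∀ {b c : ℤ}, (∀ p : ℕ, (p : ℤ) ∣ b → (p : ℤ) ∣ c →
      (p : ℤ) ∣ X - Z ∧ (p : ℤ) ∣ Y - Z) → (Int.gcd b m).Coprime (Int.gcd c m) := by
    intro b c h
    refine Nat.coprime_of_dvd fun p hp hb hc ↦ ?_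
    have h1 : (p : ℤ) ∣ Int.gcd b m := by exact_mod_cast hb
    have h2 : (p : ℤ) ∣ Int.gcd c m := by exact_mod_cast hc
    exact hsep' p hp (by exact_mod_cast h1.trans (Int.gcd_dvd_right b m))
      (h p (h1.trans (Int.gcd_dvd_left b m)) (h2.trans (Int.gcd_dvd_left c m)))
  have hpos : ∀ b : ℤ, 0 < Int.gcd b m := fun b ↦ Int.gcd_pos_of_ne_zero_right b (by lia)
  by_cases h1 : Int.gcd (Y - Z) m = 1
  · exact haarGraph_isHamiltonian_of_gcd_eq_one hm hy hz h1
  by_cases h2 : Int.gcd (X - Z) m = 1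
  · exact haarGraph_isHamiltonian_of_gcd_eq_one hm hx hz h2
  by_cases h3 : Int.gcd (X - Y) m = 1
  · exact haarGraph_isHamiltonian_of_gcd_eq_one hm hx hy h3
  have p1 := hpos (Y - Z)
  have p2 := hpos (X - Z)
  have p3 := hpos (X - Y)
  rcases Nat.exists_five_le_of_pairwise_coprime (k := Int.gcd (Y - Z) m)
    (l := Int.gcd (X - Z) m) (n := Int.gcd (X - Y) m) (by lia) (by lia) (by lia)
    (hcop fun p h h' ↦ ⟨h', h⟩)
    (hcop fun p h h' ↦ ⟨by simpa using Int.dvd_add h' h, h⟩)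
    (hcop fun p h h' ↦ ⟨h, by simpa using Int.dvd_sub h h'⟩) with h | h | h
  · exact haarGraph_isHamiltonian_of_five_le_gcd hm hprimes hx hy hz hsep' h
  · exact haarGraph_isHamiltonian_of_five_le_gcd hm hprimes hy hx hz
      (fun p hp hpm h ↦ hsep' p hp hpm h.symm) h
  · exact haarGraph_isHamiltonian_of_five_le_gcd hm hprimes hz hx hy
      (fun p hp hpm h ↦ hsep' p hp hpm
        ⟨by simpa using Int.dvd_sub h.2 h.1, by simpa using Int.dvd_neg.mpr h.1⟩) h
end
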